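/- Fix k ≥ 1 and let A be the F₂ path algebra with trivial differential on the quiver with vertices ι_1, …, ι_{2k}, arrows a_i, b_i: ι_i → ι_{i+1} for 1 ≤ i ≤ 2k−1, and an arrow c: ι_{2k} → ι_1, modulo the relations a_i b_{i+1} = b_i a_{i+1} = b_{2k−1}c = c a_1 = 0, graded so that A is a quadratic algebra over its subalgebra of idempotents (this is the bordered Floer algebra 𝒜(𝒵, −k+1) of the genus-k antipodal pointed matched circle). Then A is π-formal: for every dg (A,A)-bimodule M, the operations d^{2i}: HH_j(A,M) → HH_{j−i}(A,M) vanish for all i ≥ 2. -/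

import Mathlib

noncomputable section
open TensorProduct

namespace LT

/-- A differential graded (dg) algebra over a commutative ring `k`: a chain complex with a
degree `-1` differential together with an associative unital multiplication satisfying the
(signed) Leibniz rule; over `𝔽₂` the signs are invisible. The grading is given by an internal
direct sum decomposition into submodules. -/
structure DGA (k : Type) [CommRing k] : Type 1 where
  V : Type
  [acg : AddCommGroup V]
  [mod : Module k V]
  gr : ℤ → Submodule k V
  internal : DirectSum.IsInternal gr
  d : V →ₗ[k] V
  d_d : ∀ x, d (d x) = 0
  d_gr : ∀ i, ∀ x ∈ gr i, d x ∈ gr (i - 1)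
  mul : V →ₗ[k] V →ₗ[k] V
  mul_assoc' : ∀ x y z, mul (mul x y) z = mul x (mul y z)
  one : V
  one_gr : one ∈ gr 0
  one_mul' : ∀ x, mul one x = x
  mul_one' : ∀ x, mul x one = x
  mul_gr : ∀ i j, ∀ x ∈ gr i, ∀ y ∈ gr j, mul x y ∈ gr (i + j)
  leibniz : ∀ i, ∀ x ∈ gr i, ∀ y, d (mul x y) = mul (d x) y + (Int.negOnePow i : ℤ) • mul x (d y)

attribute [instance] DGA.acg
attribute [instance 2000] DGA.mod

variable {k : Type} [CommRing k]

/-- A dg `(A,A)`-bimodule over a dg algebra `A`. -/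
structure DGBimod (A : DGA k) : Type 1 where
  V : Type
  [acg : AddCommGroup V]
  [mod : Module k V]
  gr : ℤ → Submodule k V
  internal : DirectSum.IsInternal gr
  d : V →ₗ[k] V
  d_d : ∀ x, d (d x) = 0
  d_gr : ∀ i, ∀ x ∈ gr i, d x ∈ gr (i - 1)
  actL : A.V →ₗ[k] V →ₗ[k] V
  actR : V →ₗ[k] A.V →ₗ[k] V
  actL_one : ∀ m, actL A.one m = m
  actR_one : ∀ m, actR m A.one = m
  actL_mul : ∀ a b m, actL (A.mul a b) m = actL a (actL b m)
  actR_mul : ∀ m a b, actR (actR m a) b = actR m (A.mul a b)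
  actLR : ∀ a m b, actR (actL a m) b = actL a (actR m b)
  actL_gr : ∀ i j, ∀ a ∈ A.gr i, ∀ m ∈ gr j, actL a m ∈ gr (i + j)
  actR_gr : ∀ i j, ∀ m ∈ gr i, ∀ a ∈ A.gr j, actR m a ∈ gr (i + j)
  leibnizL : ∀ i, ∀ a ∈ A.gr i, ∀ m, d (actL a m) = actL (A.d a) m + (Int.negOnePow i : ℤ) • actL a (d m)
  leibnizR : ∀ j, ∀ m ∈ gr j, ∀ a, d (actR m a) = actR (d m) a + (Int.negOnePow j : ℤ) • actR m (A.d a)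

attribute [instance] DGBimod.acg
attribute [instance 2000] DGBimod.mod

/-- The diagonal bimodule: `A` viewed as a bimodule over itself. -/
def DGA.diag (A : DGA k) : DGBimod A where
  V := A.V
  gr := A.gr
  internal := A.internal
  d := A.d
  d_d := A.d_d
  d_gr := A.d_gr
  actL := A.mul
  actR := A.mul
  actL_one := A.one_mul'
  actR_one := A.mul_one'
  actL_mul := fun a b m => A.mul_assoc' a b m
  actR_mul := fun m a b => A.mul_assoc' m a b
  actLR := fun a m b => A.mul_assoc' a m b
  actL_gr := A.mul_gr
  actR_gr := A.mul_gr
  leibnizL := A.leibniz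
  leibnizR := A.leibniz

variable {A : DGA k}

/-- A homomorphism of dg bimodules of degree `s`: a linear map raising degree by `s`,
commuting with the differentials and the two actions. -/
def IsBHom (M N : DGBimod A) (s : ℤ) (f : M.V →ₗ[k] N.V) : Prop :=
  (∀ i, ∀ x ∈ M.gr i, f x ∈ N.gr (i + s)) ∧
  (∀ x, f (M.d x) = N.d (f x)) ∧
  (∀ a m, f (M.actL a m) = N.actL a (f m)) ∧
  (∀ m a, f (M.actR m a) = N.actR (f m) a)

/-- Graded maps of degree `s` compatible with the bimodule actions (no compatibility with the
differential required); these are used as homotopies. -/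
def grHomSub (M N : DGBimod A) (s : ℤ) : Submodule k (M.V →ₗ[k] N.V) where
  carrier := {f | (∀ i, ∀ x ∈ M.gr i, f x ∈ N.gr (i + s)) ∧
    (∀ a m, f (M.actL a m) = N.actL a (f m)) ∧
    (∀ m a, f (M.actR m a) = N.actR (f m) a)}
  add_mem' := by
    rintro f g ⟨hf1, hf2, hf3⟩ ⟨hg1, hg2, hg3⟩
    refine ⟨fun i x hx => ?_, fun a m => ?_, fun m a => ?_⟩ <;>
      simp [LinearMap.add_apply, hf2, hg2, hf3, hg3]
    exact Submodule.add_mem _ (hf1 i x hx) (hg1 i x hx)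
  zero_mem' := by
    refine ⟨fun i x hx => ?_, fun a m => ?_, fun m a => ?_⟩ <;> simp
  smul_mem' := by
    rintro c f ⟨hf1, hf2, hf3⟩
    refine ⟨fun i x hx => ?_, fun a m => ?_, fun m a => ?_⟩ <;>
      simp [LinearMap.smul_apply, hf2, hf3]
    exact Submodule.smul_mem _ _ (hf1 i x hx)

/-- Bimodule chain maps of degree `s`, as a submodule of all linear maps. -/
def bcmSub (M N : DGBimod A) (s : ℤ) : Submodule k (M.V →ₗ[k] N.V) where
  carrier := {f | IsBHom M N s f}
  add_mem' := by
    rintro f g ⟨hf1, hf0, hf2, hf3⟩ ⟨hg1, hg0, hg2, hg3⟩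
    refine ⟨fun i x hx => ?_, fun x => ?_, fun a m => ?_, fun m a => ?_⟩ <;>
      simp [LinearMap.add_apply, hf0, hg0, hf2, hg2, hf3, hg3]
    exact Submodule.add_mem _ (hf1 i x hx) (hg1 i x hx)
  zero_mem' := by
    refine ⟨fun i x hx => ?_, fun x => ?_, fun a m => ?_, fun m a => ?_⟩ <;> simp
  smul_mem' := by
    rintro c f ⟨hf1, hf0, hf2, hf3⟩
    refine ⟨fun i x hx => ?_, fun x => ?_, fun a m => ?_, fun m a => ?_⟩ <;>
      simp [LinearMap.smul_apply, hf0, hf2, hf3]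
    exact Submodule.smul_mem _ _ (hf1 i x hx)

/-- The nullhomotopic degree-`s` maps `d ∘ h + h ∘ d` for `h` a degree `s+1` bimodule map. -/
def nullHtpSub (M N : DGBimod A) (s : ℤ) : Submodule k (M.V →ₗ[k] N.V) :=
  Submodule.map
    ((LinearMap.llcomp k M.V N.V N.V N.d) + (LinearMap.lcomp k N.V M.d))
    (grHomSub M N (s + 1))

/-- Homotopy classes of degree-`s` bimodule chain maps `M → N`; for `M` a cell retract this
computes morphisms `Σ^s M → N` in the derived category of dg bimodules. -/
def HtpyHom (M N : DGBimod A) (s : ℤ) :=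
  bcmSub M N s ⧸ Submodule.comap (bcmSub M N s).subtype (nullHtpSub M N s)

instance (M N : DGBimod A) (s : ℤ) : AddCommGroup (HtpyHom M N s) :=
  inferInstanceAs (AddCommGroup (_ ⧸ _))
instance (M N : DGBimod A) (s : ℤ) : Module k (HtpyHom M N s) :=
  inferInstanceAs (Module k (_ ⧸ _))


/-- Homology in degree `n` of a graded module with "relations": the degree-`n` part of the
homology of the quotient complex `(T/N, d)` where the grading of `T/N` is induced by `gr`.
Taking `N = ⊥` gives ordinary graded homology. -/
def Hgr (T : Type) [AddCommGroup T] [Module k T] (gr : ℤ → Submodule k T)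
    (N : Submodule k T) (d : T →ₗ[k] T) (n : ℤ) : Type :=
  ↥((gr n ⊔ N) ⊓ Submodule.comap d N) ⧸
    Submodule.comap ((gr n ⊔ N) ⊓ Submodule.comap d N).subtype
      (Submodule.map d (gr (n + 1) ⊔ N) ⊔ N)

instance (T : Type) [AddCommGroup T] [Module k T] (gr : ℤ → Submodule k T)
    (N : Submodule k T) (d : T →ₗ[k] T) (n : ℤ) : AddCommGroup (Hgr T gr N d n) :=
  inferInstanceAs (AddCommGroup (_ ⧸ _))
instance (T : Type) [AddCommGroup T] [Module k T] (gr : ℤ → Submodule k T)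
    (N : Submodule k T) (d : T →ₗ[k] T) (n : ℤ) : Module k (Hgr T gr N d n) :=
  inferInstanceAs (Module k (_ ⧸ _))

/-- `f` induces an isomorphism on (graded) homology, with a degree shift `s`; stated
elementarily: the induced map on homology classes is surjective and injective. -/
def IsQIsoDeg (T S : Type) [AddCommGroup T] [Module k T] [AddCommGroup S] [Module k S]
    (grT : ℤ → Submodule k T) (grS : ℤ → Submodule k S)
    (dT : T →ₗ[k] T) (dS : S →ₗ[k] S) (s : ℤ) (f : T →ₗ[k] S) : Prop :=
  ∀ n : ℤ,
    (∀ y ∈ grS (n + s), dS y = 0 →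
      ∃ x ∈ grT n, dT x = 0 ∧ f x - y ∈ Submodule.map dS (grS (n + s + 1))) ∧
    (∀ x ∈ grT n, dT x = 0 → f x ∈ Submodule.map dS (grS (n + s + 1)) →
      x ∈ Submodule.map dT (grT (n + 1)))

variable {A : DGA k}

/-- The bilinear "sandwich" map `(a, b) ↦ a · m · b` for a fixed element `m` of a bimodule. -/
def sandwich (M : DGBimod A) (m : M.V) : A.V →ₗ[k] A.V →ₗ[k] M.V :=
  LinearMap.mk₂ k (fun a b => M.actR (M.actL a m) b)
    (fun a₁ a₂ b => by simp)
    (fun c a b => by simp)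
    (fun a b₁ b₂ => by simp)
    (fun c a b => by simp)

/-- The bimodule map `A ⊗ A → M`, `a ⊗ b ↦ a · m · b`. -/
def sandwichT (M : DGBimod A) (m : M.V) : (A.V ⊗[k] A.V) →ₗ[k] M.V :=
  TensorProduct.lift (sandwich M m)

/-- `S'/S` is a free dg bimodule: there is a family of "generators" `g i` of degrees `deg i`,
closed cycles modulo `S`, which generate `S'` freely over `A ⊗ A` modulo `S`. -/
def IsFreeStep (M : DGBimod A) (S S' : Submodule k M.V) : Prop :=
  ∃ (I : Type) (g : I → M.V) (deg : I → ℤ),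
    (∀ i, g i ∈ S') ∧ (∀ i, M.d (g i) ∈ S) ∧
    (∀ i p q, ∀ a ∈ A.gr p, ∀ b ∈ A.gr q, M.actR (M.actL a (g i)) b ∈ M.gr (p + q + deg i)) ∧
    S' ≤ S ⊔ (⨆ i, LinearMap.range (sandwichT M (g i))) ∧
    (∀ (u : Finset I) (c : I → A.V ⊗[k] A.V),
      (∑ i ∈ u, sandwichT M (g i) (c i)) ∈ S → ∀ i ∈ u, c i = 0)

/-- As `IsFreeStep`, with a finite generating family. -/
def IsFreeStepFin (M : DGBimod A) (S S' : Submodule k M.V) : Prop :=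
  ∃ (I : Type) (_ : Finite I) (g : I → M.V) (deg : I → ℤ),
    (∀ i, g i ∈ S') ∧ (∀ i, M.d (g i) ∈ S) ∧
    (∀ i p q, ∀ a ∈ A.gr p, ∀ b ∈ A.gr q, M.actR (M.actL a (g i)) b ∈ M.gr (p + q + deg i)) ∧
    S' ≤ S ⊔ (⨆ i, LinearMap.range (sandwichT M (g i))) ∧
    (∀ (u : Finset I) (c : I → A.V ⊗[k] A.V),
      (∑ i ∈ u, sandwichT M (g i) (c i)) ∈ S → ∀ i ∈ u, c i = 0)

/-- A filtration exhibiting `M` as a cell bimodule. -/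
def IsCellFiltration (M : DGBimod A) (Fil : ℕ → Submodule k M.V) : Prop :=
  Fil 0 = ⊥ ∧ Monotone Fil ∧ (⨆ n, Fil n) = ⊤ ∧
  (∀ n, ∀ x ∈ Fil n, M.d x ∈ Fil n) ∧
  (∀ n a, ∀ x ∈ Fil n, M.actL a x ∈ Fil n) ∧
  (∀ n a, ∀ x ∈ Fil n, M.actR x a ∈ Fil n) ∧
  (∀ n, IsFreeStep M (Fil n) (Fil (n + 1)))

/-- A cell bimodule: admits a filtration with free subquotients. -/
def IsCellBimod (M : DGBimod A) : Prop := ∃ Fil, IsCellFiltration M Fil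

/-- A finite cell bimodule: a finite filtration with finite-rank free subquotients. -/
def IsFiniteCellBimod (M : DGBimod A) : Prop :=
  ∃ Fil, (Fil 0 = ⊥ ∧ Monotone Fil ∧ (⨆ n, Fil n) = ⊤ ∧
    (∀ n, ∀ x ∈ Fil n, M.d x ∈ Fil n) ∧
    (∀ n a, ∀ x ∈ Fil n, M.actL a x ∈ Fil n) ∧
    (∀ n a, ∀ x ∈ Fil n, M.actR x a ∈ Fil n) ∧
    (∀ n, IsFreeStepFin M (Fil n) (Fil (n + 1)))) ∧ (∃ n₀, Fil n₀ = ⊤)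

/-- A (finite) cell retract: a subcomplex of a (finite) cell bimodule whose inclusion admits
a bimodule retraction. -/
def IsCellRetract (P : DGBimod A) : Prop :=
  ∃ (C : DGBimod A), IsCellBimod C ∧
    ∃ (ι : P.V →ₗ[k] C.V) (r : C.V →ₗ[k] P.V),
      IsBHom P C 0 ι ∧ IsBHom C P 0 r ∧ Function.Injective ι ∧ r.comp ι = LinearMap.id

def IsFiniteCellRetract (P : DGBimod A) : Prop :=
  ∃ (C : DGBimod A), IsFiniteCellBimod C ∧
    ∃ (ι : P.V →ₗ[k] C.V) (r : C.V →ₗ[k] P.V),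
      IsBHom P C 0 ι ∧ IsBHom C P 0 r ∧ Function.Injective ι ∧ r.comp ι = LinearMap.id

/-- `ρ : R → M` is a resolution: a quasi-isomorphism of dg bimodules from a cell retract. -/
def IsResolution (R M : DGBimod A) (ρ : R.V →ₗ[k] M.V) : Prop :=
  IsCellRetract R ∧ IsBHom R M 0 ρ ∧ IsQIsoDeg R.V M.V R.gr M.gr R.d M.d 0 ρ

/-- A bimodule is perfect if it admits a resolution by a finite cell retract. -/
def IsPerfect (M : DGBimod A) : Prop :=
  ∃ (R : DGBimod A) (ρ : R.V →ₗ[k] M.V),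
    IsFiniteCellRetract R ∧ IsBHom R M 0 ρ ∧ IsQIsoDeg R.V M.V R.gr M.gr R.d M.d 0 ρ

/-- `A` is homologically smooth: perfect as a bimodule over itself. -/
def HomSmooth (A : DGA k) : Prop := IsPerfect A.diag

/-- The homology of the dg algebra `A` in degree `n`. -/
abbrev AlgH (A : DGA k) (n : ℤ) := Hgr A.V A.gr ⊥ A.d n

/-- `A` is homologically proper: its total homology is finitely generated. -/
def HomProper (A : DGA k) : Prop :=
  (∀ n, Module.Finite k (AlgH A n)) ∧ (Set.Finite {n : ℤ | Nontrivial (AlgH A n)})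

/-- A dg bimodule is bounded if it is supported in finitely many gradings. -/
def BoundedBimod (M : DGBimod A) : Prop := ∃ u : Finset ℤ, ∀ i ∉ u, M.gr i = ⊥

/-! ### Bicomplexes and the spectral sequences of their two filtrations -/

/-- A bicomplex of `k`-modules "with relations", presented as one ambient module with a
bigrading by submodules, a horizontal differential `dh` (of bidegree `(-1,0)`), a vertical
differential `dv` (of bidegree `(0,-1)`) and a submodule `N` of relations (so that the actual
bicomplex is the quotient by `N`; take `N = ⊥` for an honest bicomplex). -/
structure RelBicx (k : Type) [CommRing k] : Type 1 where
  T : Type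
  [acg : AddCommGroup T]
  [mod : Module k T]
  gr : ℤ → ℤ → Submodule k T
  N : Submodule k T
  dh : T →ₗ[k] T
  dv : T →ₗ[k] T

attribute [instance] RelBicx.acg RelBicx.mod

namespace RelBicx

variable {k : Type} [CommRing k] (B : RelBicx k)

/-- The total differential. -/
def D : B.T →ₗ[k] B.T := B.dh + B.dv

/-- The column filtration (by the first index `p`) of the total complex, in total degree `n`. -/
def Fcol (p n : ℤ) : Submodule k B.T := ⨆ (i : ℤ) (_ : i ≤ p), B.gr i (n - i)

/-- The row filtration (by the second index `q`) of the total complex, in total degree `n`. -/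
def Frow (q n : ℤ) : Submodule k B.T := ⨆ (j : ℤ) (_ : j ≤ q), B.gr (n - j) j

/-- Approximate cycles for the spectral sequence of the filtration `F`:
elements of filtration `p` (mod `N`) whose total differential drops filtration by `r`. -/
def Zpage (F : ℤ → ℤ → Submodule k B.T) (r p n : ℤ) : Submodule k B.T :=
  (F p n ⊔ B.N) ⊓ Submodule.comap B.D (F (p - r) (n - 1) ⊔ B.N)

/-- The boundaries subobject for the `r`-th page at filtration `p`, total degree `n`. -/
def Bpage (F : ℤ → ℤ → Submodule k B.T) (r p n : ℤ) : Submodule k B.T :=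
  Submodule.map B.D (B.Zpage F (r - 1) (p + r - 1) (n + 1)) ⊔ B.Zpage F (r - 1) (p - 1) n ⊔ B.N

/-- The `r`-th page of the spectral sequence of the filtration `F`, at filtration degree `p`
and total degree `n` (the classical subquotient description `Z^r/B^r`). -/
def Epage (F : ℤ → ℤ → Submodule k B.T) (r p n : ℤ) : Type :=
  ↥(B.Zpage F r p n) ⧸
    Submodule.comap (B.Zpage F r p n).subtype (B.Bpage F r p n)

instance (F : ℤ → ℤ → Submodule k B.T) (r p n : ℤ) : AddCommGroup (B.Epage F r p n) :=
  inferInstanceAs (AddCommGroup (_ ⧸ _))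
instance (F : ℤ → ℤ → Submodule k B.T) (r p n : ℤ) : Module k (B.Epage F r p n) :=
  inferInstanceAs (Module k (_ ⧸ _))

/-- The spectral sequence `ᵛʰE` (filtration by columns; one first takes homology with respect
to the vertical differential). Indexing: `vhE r p q` is `ᵛʰE^r_{p,q}`. -/
def vhE (r p q : ℤ) : Type := B.Epage B.Fcol r p (p + q)

/-- The spectral sequence `ʰᵛE` (filtration by rows; one first takes homology with respect to
the horizontal differential), in the transposed indexing of Lipshitz–Treumann:
`hvE r p q` is `ʰᵛE^r_{p,q}`, whose filtration index is the row `q`. -/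
def hvE (r p q : ℤ) : Type := B.Epage B.Frow r q (p + q)

instance (r p q : ℤ) : AddCommGroup (B.vhE r p q) := inferInstanceAs (AddCommGroup (Epage _ _ _ _ _))
instance (r p q : ℤ) : Module k (B.vhE r p q) := inferInstanceAs (Module k (Epage _ _ _ _ _))
instance (r p q : ℤ) : AddCommGroup (B.hvE r p q) := inferInstanceAs (AddCommGroup (Epage _ _ _ _ _))
instance (r p q : ℤ) : Module k (B.hvE r p q) := inferInstanceAs (Module k (Epage _ _ _ _ _))

/-- Vanishing of the differential leaving the `r`-th page at position `(p, n)`: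
the total differential of any approximate cycle is, up to boundaries of earlier pages and
relations, an approximate cycle of deeper filtration. -/
def zeroDiff (F : ℤ → ℤ → Submodule k B.T) (r p n : ℤ) : Prop :=
  Submodule.map B.D (B.Zpage F r p n) ≤
    Submodule.map B.D (B.Zpage F (r - 1) (p - 1) n) ⊔ B.Zpage F (r - 1) (p - r - 1) (n - 1) ⊔ B.N

/-- The spectral sequence of the filtration `F` collapses at the `r₀`-th page. -/
def collapsesAt (F : ℤ → ℤ → Submodule k B.T) (r₀ : ℤ) : Prop :=
  ∀ r : ℤ, r₀ ≤ r → ∀ p n : ℤ, B.zeroDiff F r p n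

/-- The part of total degree `n` of the bicomplex. -/
def totGr (n : ℤ) : Submodule k B.T := ⨆ p : ℤ, B.gr p (n - p)

/-- The degree-`n` homology of the total complex (of the quotient by `N`). -/
def Htot (n : ℤ) : Type :=
  ↥((B.totGr n ⊔ B.N) ⊓ Submodule.comap B.D B.N) ⧸
    Submodule.comap ((B.totGr n ⊔ B.N) ⊓ Submodule.comap B.D B.N).subtype
      (Submodule.map B.D (B.totGr (n + 1) ⊔ B.N) ⊔ B.N)

instance (n : ℤ) : AddCommGroup (B.Htot n) := inferInstanceAs (AddCommGroup (_ ⧸ _))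
instance (n : ℤ) : Module k (B.Htot n) := inferInstanceAs (Module k (_ ⧸ _))

/-- The graded piece `F_p H_n / F_{p-1} H_n` of the filtration induced by `F` on the homology
of the total complex. -/
def grHtot (F : ℤ → ℤ → Submodule k B.T) (p n : ℤ) : Type :=
  ↥((F p n ⊔ B.N) ⊓ Submodule.comap B.D B.N) ⧸
    Submodule.comap ((F p n ⊔ B.N) ⊓ Submodule.comap B.D B.N).subtype
      (((F (p - 1) n ⊔ B.N) ⊓ Submodule.comap B.D B.N) ⊔
        Submodule.map B.D (B.totGr (n + 1) ⊔ B.N) ⊔ B.N)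

instance (F : ℤ → ℤ → Submodule k B.T) (p n : ℤ) : AddCommGroup (B.grHtot F p n) :=
  inferInstanceAs (AddCommGroup (_ ⧸ _))
instance (F : ℤ → ℤ → Submodule k B.T) (p n : ℤ) : Module k (B.grHtot F p n) :=
  inferInstanceAs (Module k (_ ⧸ _))

/-- The spectral sequence of the filtration `F` converges to the homology of the total
complex: for every position the pages eventually stabilize and agree with the associated
graded of the induced filtration on the homology of the total complex. -/
def convergesTo (F : ℤ → ℤ → Submodule k B.T) : Prop :=
  ∀ p n : ℤ, ∃ r₀ : ℤ, ∀ r : ℤ, r₀ ≤ r →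
    Nonempty (B.Epage F r p n ≃ₗ[k] B.grHtot F p n)

end RelBicx
/-! ### Hochschild chains, the involution `τ`, and the Hochschild–Tate bicomplex (over `𝔽₂`) -/

section Hochschild

variable {A : DGA (ZMod 2)} (R M : DGBimod A)

/-- The ambient space `R ⊗ M` of the Hochschild chain complex `HC(A, M)` (with respect to the
resolution `R` of the diagonal bimodule): `HC(A,M) = (R ⊗ M)/rel2`. -/
abbrev T2 := R.V ⊗[ZMod 2] M.V

/-- The differential `∂(r ⊗ m) = ∂r ⊗ m + r ⊗ ∂m` (char. 2). -/
def d2 : T2 R M →ₗ[ZMod 2] T2 R M :=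
  TensorProduct.map R.d LinearMap.id + TensorProduct.map LinearMap.id M.d

/-- The grading of `R ⊗ M`. -/
def gr2 (n : ℤ) : Submodule (ZMod 2) (T2 R M) :=
  Submodule.span (ZMod 2)
    {z | ∃ i j, ∃ r ∈ R.gr i, ∃ m ∈ M.gr j, i + j = n ∧ z = r ⊗ₜ[ZMod 2] m}

/-- The Hochschild relations `ra ⊗ m ∼ r ⊗ am` and `ar ⊗ m ∼ r ⊗ ma` (char. 2). -/
def rel2 : Submodule (ZMod 2) (T2 R M) :=
  Submodule.span (ZMod 2)
    ({z | ∃ r a m, z = (R.actR r a) ⊗ₜ[ZMod 2] m + r ⊗ₜ[ZMod 2] (M.actL a m)} ∪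
     {z | ∃ r a m, z = (R.actL a r) ⊗ₜ[ZMod 2] m + r ⊗ₜ[ZMod 2] (M.actR m a)})

/-- The underlying space of the Hochschild chain complex `HC(A, M)`. -/
abbrev HCQ := T2 R M ⧸ rel2 R M

/-- The Hochschild homology `HH_n(A, M)` (computed from the chosen resolution `R → A`). -/
abbrev HH (n : ℤ) := Hgr (T2 R M) (gr2 R M) (rel2 R M) (d2 R M) n

/-- The ambient space `R ⊗ (M ⊗ (R ⊗ M))` of the Hochschild chain complex of the derived
tensor product: `HC(A, M ⊗̃_A M) = (R ⊗ (M ⊠ R ⊠ M))/∼ = (R ⊗ M ⊗ R ⊗ M)/rel4`. -/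
abbrev T4 := R.V ⊗[ZMod 2] (M.V ⊗[ZMod 2] (R.V ⊗[ZMod 2] M.V))

/-- The differential of `R ⊗ M ⊗ R ⊗ M` (char. 2; no signs). -/
def d4 : T4 R M →ₗ[ZMod 2] T4 R M :=
  TensorProduct.map R.d LinearMap.id +
  TensorProduct.map LinearMap.id (TensorProduct.map M.d LinearMap.id +
    TensorProduct.map LinearMap.id (TensorProduct.map R.d LinearMap.id +
      TensorProduct.map LinearMap.id M.d))

/-- The grading of `R ⊗ M ⊗ R ⊗ M`. -/
def gr4 (n : ℤ) : Submodule (ZMod 2) (T4 R M) :=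
  Submodule.span (ZMod 2)
    {z | ∃ i₁ j₁ i₂ j₂, ∃ r ∈ R.gr i₁, ∃ m ∈ M.gr j₁, ∃ r' ∈ R.gr i₂, ∃ m' ∈ M.gr j₂,
      i₁ + j₁ + i₂ + j₂ = n ∧ z = r ⊗ₜ[ZMod 2] (m ⊗ₜ[ZMod 2] (r' ⊗ₜ[ZMod 2] m'))}

/-- The combined relations presenting `HC(A, M ⊗̃_A M)` as a quotient of `R ⊗ M ⊗ R ⊗ M`:
the two relations of the naive tensor products `M ⊠_A R ⊠_A M` and the two outer Hochschild
relations (char. 2). -/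
def rel4 : Submodule (ZMod 2) (T4 R M) :=
  Submodule.span (ZMod 2)
    ({z | ∃ r a m r' m', z = (R.actR r a) ⊗ₜ[ZMod 2] (m ⊗ₜ[ZMod 2] (r' ⊗ₜ[ZMod 2] m')) +
        r ⊗ₜ[ZMod 2] ((M.actL a m) ⊗ₜ[ZMod 2] (r' ⊗ₜ[ZMod 2] m'))} ∪
     {z | ∃ r a m r' m', z = (R.actL a r) ⊗ₜ[ZMod 2] (m ⊗ₜ[ZMod 2] (r' ⊗ₜ[ZMod 2] m')) +
        r ⊗ₜ[ZMod 2] (m ⊗ₜ[ZMod 2] (r' ⊗ₜ[ZMod 2] (M.actR m' a)))} ∪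
     {z | ∃ r a m r' m', z = r ⊗ₜ[ZMod 2] ((M.actR m a) ⊗ₜ[ZMod 2] (r' ⊗ₜ[ZMod 2] m')) +
        r ⊗ₜ[ZMod 2] (m ⊗ₜ[ZMod 2] ((R.actL a r') ⊗ₜ[ZMod 2] m'))} ∪
     {z | ∃ r a m r' m', z = r ⊗ₜ[ZMod 2] (m ⊗ₜ[ZMod 2] ((R.actR r' a) ⊗ₜ[ZMod 2] m')) +
        r ⊗ₜ[ZMod 2] (m ⊗ₜ[ZMod 2] (r' ⊗ₜ[ZMod 2] (M.actL a m')))})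


instance {A : DGA (ZMod 2)} (R M : DGBimod A) :
    HasQuotient (T4 R M) (Submodule (ZMod 2) (T4 R M)) := Submodule.hasQuotient

/-- The underlying space of the Hochschild chain complex `HC(A, M ⊗̃_A M)`. -/
abbrev HCQ4 := T4 R M ⧸ rel4 R M

/-- The Hochschild homology `HH_n(A, M ⊗̃_A M)` of the derived tensor square. -/
abbrev HH4 (n : ℤ) := Hgr (T4 R M) (gr4 R M) (rel4 R M) (d4 R M) n

/-- The involution `τ` of `R ⊗ (M ⊗ (R ⊗ M))` exchanging the two halves:
`r ⊗ (m ⊗ (r' ⊗ m')) ↦ r' ⊗ (m' ⊗ (r ⊗ m))`. -/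
def tau4 : T4 R M →ₗ[ZMod 2] T4 R M :=
  ((TensorProduct.assoc (ZMod 2) R.V M.V (R.V ⊗[ZMod 2] M.V)).toLinearMap).comp
    (((TensorProduct.comm (ZMod 2) (R.V ⊗[ZMod 2] M.V) (R.V ⊗[ZMod 2] M.V)).toLinearMap).comp
      ((TensorProduct.assoc (ZMod 2) R.V M.V (R.V ⊗[ZMod 2] M.V)).symm.toLinearMap))

/-- The Hochschild–Tate bicomplex `HC^{Tate}(A, M ⊗̃_A M)`: the `ℤ`-periodic bicomplex whose
columns are the Hochschild complex of `M ⊗̃_A M` and whose horizontal differential is `1 + τ`. -/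
def TateBicx : RelBicx (ZMod 2) where
  T := ℤ →₀ T4 R M
  gr := fun p q => Submodule.map (Finsupp.lsingle p) (gr4 R M q)
  N := ⨅ p : ℤ, Submodule.comap (Finsupp.lapply p) (rel4 R M)
  dv := Finsupp.mapRange.linearMap (d4 R M)
  dh := (Finsupp.lmapDomain (T4 R M) (ZMod 2) (fun p => p - 1)).comp
    (Finsupp.mapRange.linearMap (LinearMap.id + tau4 R M))


/-- An element of the Hochschild–Tate bicomplex concentrated in column `p`. -/
def tateSingle (p : ℤ) (x : T4 R M) : (TateBicx R M).T := Finsupp.single p x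

/-- A dg bimodule `M` is `π`-formal (with respect to the resolution `R` of the diagonal
bimodule) if the spectral sequence `ʰᵛE` of the Hochschild–Tate bicomplex of `M ⊗̃_A M`
collapses at the `E³`-page; equivalently, all the induced operations
`d^{2i} : HH_k(A,M) → HH_{k-i}(A,M)`, `i ≥ 2`, vanish. -/
def PiFormalBimod : Prop := (TateBicx R M).collapsesAt (TateBicx R M).Frow 3

/-- A dg algebra is `π`-formal if every dg bimodule over it is `π`-formal. -/
def PiFormalAlg (R : DGBimod A) : Prop := ∀ M : DGBimod A, PiFormalBimod R M

end Hochschild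

section QuiverAlgebra

/-- Generators of the genus-`k` "antipodal" quiver: idempotents `e i` at the `2k` vertices,
arrows `a i, b i : ι_i → ι_{i+1}` for `1 ≤ i ≤ 2k-1`, and an arrow `c : ι_{2k} → ι_1`. -/
inductive QGen (k : ℕ) : Type
  | e (i : Fin (2 * k)) : QGen k
  | a (i : Fin (2 * k - 1)) : QGen k
  | b (i : Fin (2 * k - 1)) : QGen k
  | c : QGen k

/-- The defining relations of the path algebra with relations
`a_i b_{i+1} = b_i a_{i+1} = b_{2k-1} c = c a_1 = 0`. -/
inductive QRel (k : ℕ) (hk : 1 ≤ k) :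
    FreeAlgebra (ZMod 2) (QGen k) → FreeAlgebra (ZMod 2) (QGen k) → Prop
  | idem (i : Fin (2 * k)) :
      QRel k hk (FreeAlgebra.ι _ (QGen.e i) * FreeAlgebra.ι _ (QGen.e i))
        (FreeAlgebra.ι _ (QGen.e i))
  | orth (i j : Fin (2 * k)) (h : i ≠ j) :
      QRel k hk (FreeAlgebra.ι _ (QGen.e i) * FreeAlgebra.ι _ (QGen.e j)) 0
  | total : QRel k hk (∑ i : Fin (2 * k), FreeAlgebra.ι _ (QGen.e i)) 1
  | aPath (i : Fin (2 * k - 1)) :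
      QRel k hk (FreeAlgebra.ι _ (QGen.a i))
        (FreeAlgebra.ι _ (QGen.e (Fin.castLE (by omega) i)) * FreeAlgebra.ι _ (QGen.a i) *
          FreeAlgebra.ι _ (QGen.e (Fin.cast (by omega) i.succ)))
  | bPath (i : Fin (2 * k - 1)) :
      QRel k hk (FreeAlgebra.ι _ (QGen.b i))
        (FreeAlgebra.ι _ (QGen.e (Fin.castLE (by omega) i)) * FreeAlgebra.ι _ (QGen.b i) *
          FreeAlgebra.ι _ (QGen.e (Fin.cast (by omega) i.succ)))
  | cPath :
      QRel k hk (FreeAlgebra.ι _ (QGen.c))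
        (FreeAlgebra.ι _ (QGen.e ⟨2 * k - 1, by omega⟩) * FreeAlgebra.ι _ (QGen.c) *
          FreeAlgebra.ι _ (QGen.e ⟨0, by omega⟩))
  | ab (i : Fin (2 * k - 2)) :
      QRel k hk (FreeAlgebra.ι _ (QGen.a (Fin.castLE (by omega) i)) *
        FreeAlgebra.ι _ (QGen.b (Fin.cast (by omega) i.succ))) 0
  | ba (i : Fin (2 * k - 2)) :
      QRel k hk (FreeAlgebra.ι _ (QGen.b (Fin.castLE (by omega) i)) *
        FreeAlgebra.ι _ (QGen.a (Fin.cast (by omega) i.succ))) 0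
  | bc : QRel k hk (FreeAlgebra.ι _ (QGen.b ⟨2 * k - 2, by omega⟩) *
      FreeAlgebra.ι _ (QGen.c)) 0
  | ca : QRel k hk (FreeAlgebra.ι _ (QGen.c) *
      FreeAlgebra.ι _ (QGen.a ⟨0, by omega⟩)) 0

/-- The bordered Floer algebra `𝒜(𝒵, -k+1)` of the genus-`k` antipodal pointed matched
circle, presented as the path algebra with relations above. -/
abbrev QAlg (k : ℕ) (hk : 1 ≤ k) : Type := RingQuot (QRel k hk)

/-- The image of a generator in the path algebra with relations. -/
def qgen {k : ℕ} {hk : 1 ≤ k} (g : QGen k) : QAlg k hk :=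
  RingQuot.mkAlgHom (ZMod 2) (QRel k hk) (FreeAlgebra.ι _ g)

/-- Whether a generator is an arrow (rather than an idempotent). -/
def QGen.IsArrow {k : ℕ} : QGen k → Prop
  | QGen.e _ => False
  | _ => True

/-- The span of the paths of length `m` (products of `m` arrows, compressed between two
idempotents); this is the degree-`m` part of the path-length grading, for which the algebra
is quadratic over its subalgebra of idempotents. -/
def lengthSpan (k : ℕ) (hk : 1 ≤ k) (m : ℕ) : Submodule (ZMod 2) (QAlg k hk) :=
  Submodule.span (ZMod 2)
    {x | ∃ (l : List (QAlg k hk)) (i₀ i₁ : Fin (2 * k)),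
      l.length = m ∧ (∀ y ∈ l, ∃ g : QGen k, g.IsArrow ∧ y = qgen g) ∧
      x = qgen (QGen.e i₀) * l.prod * qgen (QGen.e i₁)}

end QuiverAlgebra


theorem c2 {V : Type*} [AddCommGroup V] [Module (ZMod 2) V] (v : V) : v + v = 0 :=
  ZModModule.add_self v

theorem c2eq {V : Type*} [AddCommGroup V] [Module (ZMod 2) V] {v w : V} (h : v + w = 0) : v = w := by
  have := c2 w
  calc v = v + (w + w) := by rw [this, add_zero]
    _ = w := by rw [← add_assoc, h, zero_add]

theorem c2' {V : Type*} [AddCommGroup V] [Module (ZMod 2) V] (v w : V) : v + (v + w) = w := by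
  rw [← add_assoc, c2, zero_add]

theorem c2neg {V : Type*} [AddCommGroup V] [Module (ZMod 2) V] (v : V) : -v = v :=
  ZModModule.neg_eq_self v

theorem c2sub {V : Type*} [AddCommGroup V] [Module (ZMod 2) V] (v w : V) : v - w = v + w :=
  ZModModule.sub_eq_add v w

theorem c2n {V : Type*} [AddCommGroup V] [Module (ZMod 2) V] (v : V) : (2 : ℕ) • v = 0 := by
  rw [two_smul, c2]
theorem c2z {V : Type*} [AddCommGroup V] [Module (ZMod 2) V] (v : V) : (2 : ℤ) • v = 0 := by
  rw [two_smul, c2]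

section
variable {A : DGA (ZMod 2)} (R M : DGBimod A)

theorem tau4_tmul (r : R.V) (m : M.V) (r' : R.V) (m' : M.V) :
    tau4 R M (r ⊗ₜ (m ⊗ₜ (r' ⊗ₜ m'))) = r' ⊗ₜ (m' ⊗ₜ (r ⊗ₜ m)) := by
  simp [tau4]

theorem T4ext {W : Type*} [AddCommGroup W] [Module (ZMod 2) W] {f g : T4 R M →ₗ[ZMod 2] W}
    (h : ∀ r m r' m', f (r ⊗ₜ (m ⊗ₜ (r' ⊗ₜ m'))) = g (r ⊗ₜ (m ⊗ₜ (r' ⊗ₜ m')))) : f = g := by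
  ext r m r' m'; exact h r m r' m'

theorem tau4_tau4 (x : T4 R M) : tau4 R M (tau4 R M x) = x := by
  have : (tau4 R M).comp (tau4 R M) = LinearMap.id := by
    apply T4ext; intros; simp [tau4_tmul]
  exact LinearMap.congr_fun this x

theorem d4_tmul (r : R.V) (m : M.V) (r' : R.V) (m' : M.V) :
    d4 R M (r ⊗ₜ (m ⊗ₜ (r' ⊗ₜ m'))) = R.d r ⊗ₜ (m ⊗ₜ (r' ⊗ₜ m')) + r ⊗ₜ (M.d m ⊗ₜ (r' ⊗ₜ m'))
     + r ⊗ₜ (m ⊗ₜ (R.d r' ⊗ₜ m')) + r ⊗ₜ (m ⊗ₜ (r' ⊗ₜ M.d m')) := by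
  simp [d4, tmul_add, add_assoc]

theorem d4_d4 (x : T4 R M) : d4 R M (d4 R M x) = 0 := by
  have : (d4 R M).comp (d4 R M) = 0 := by
    apply T4ext; intro r m r' m'
    simp only [LinearMap.comp_apply, d4_tmul, map_add, R.d_d, M.d_d, zero_tmul, tmul_zero, LinearMap.zero_apply]
    abel_nf; simp [c2n, c2z]
  exact LinearMap.congr_fun this x

theorem d4_tau4 (x : T4 R M) : d4 R M (tau4 R M x) = tau4 R M (d4 R M x) := by
  have : (d4 R M).comp (tau4 R M) = (tau4 R M).comp (d4 R M) := by
    apply T4ext; intro r m r' m'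
    simp only [LinearMap.comp_apply, d4_tmul, map_add, tau4_tmul]
    abel
  exact LinearMap.congr_fun this x

theorem rel_1 (r : R.V) (a : A.V) (m : M.V) (r' : R.V) (m' : M.V) :
    (R.actR r a) ⊗ₜ (m ⊗ₜ (r' ⊗ₜ m')) + r ⊗ₜ ((M.actL a m) ⊗ₜ (r' ⊗ₜ m')) ∈ rel4 R M :=
  Submodule.subset_span (Or.inl (Or.inl (Or.inl ⟨r, a, m, r', m', rfl⟩)))
theorem rel_2 (r : R.V) (a : A.V) (m : M.V) (r' : R.V) (m' : M.V) :
    (R.actL a r) ⊗ₜ (m ⊗ₜ (r' ⊗ₜ m')) + r ⊗ₜ (m ⊗ₜ (r' ⊗ₜ (M.actR m' a))) ∈ rel4 R M :=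
  Submodule.subset_span (Or.inl (Or.inl (Or.inr ⟨r, a, m, r', m', rfl⟩)))
theorem rel_3 (r : R.V) (a : A.V) (m : M.V) (r' : R.V) (m' : M.V) :
    r ⊗ₜ ((M.actR m a) ⊗ₜ (r' ⊗ₜ m')) + r ⊗ₜ (m ⊗ₜ ((R.actL a r') ⊗ₜ m')) ∈ rel4 R M :=
  Submodule.subset_span (Or.inl (Or.inr ⟨r, a, m, r', m', rfl⟩))
theorem rel_4 (r : R.V) (a : A.V) (m : M.V) (r' : R.V) (m' : M.V) :
    r ⊗ₜ (m ⊗ₜ ((R.actR r' a) ⊗ₜ m')) + r ⊗ₜ (m ⊗ₜ (r' ⊗ₜ (M.actL a m'))) ∈ rel4 R M :=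
  Submodule.subset_span (Or.inr ⟨r, a, m, r', m', rfl⟩)

theorem rel_le {S : Submodule (ZMod 2) (T4 R M)}
    (h1 : ∀ r a m r' m', (R.actR r a) ⊗ₜ (m ⊗ₜ (r' ⊗ₜ m')) + r ⊗ₜ ((M.actL a m) ⊗ₜ (r' ⊗ₜ m')) ∈ S)
    (h2 : ∀ r a m r' m', (R.actL a r) ⊗ₜ (m ⊗ₜ (r' ⊗ₜ m')) + r ⊗ₜ (m ⊗ₜ (r' ⊗ₜ (M.actR m' a))) ∈ S)
    (h3 : ∀ r a m r' m', r ⊗ₜ ((M.actR m a) ⊗ₜ (r' ⊗ₜ m')) + r ⊗ₜ (m ⊗ₜ ((R.actL a r') ⊗ₜ m')) ∈ S)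
    (h4 : ∀ r a m r' m', r ⊗ₜ (m ⊗ₜ ((R.actR r' a) ⊗ₜ m')) + r ⊗ₜ (m ⊗ₜ (r' ⊗ₜ (M.actL a m'))) ∈ S) :
    rel4 R M ≤ S := by
  rw [rel4, Submodule.span_le]
  rintro _ (((⟨r, a, m, r', m', rfl⟩ | ⟨r, a, m, r', m', rfl⟩) | ⟨r, a, m, r', m', rfl⟩) | ⟨r, a, m, r', m', rfl⟩)
  · exact h1 ..
  · exact h2 ..
  · exact h3 ..
  · exact h4 ..

theorem tau4_rel (x : T4 R M) (hx : x ∈ rel4 R M) : tau4 R M x ∈ rel4 R M := by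
  have : rel4 R M ≤ (rel4 R M).comap (tau4 R M) := by
    conv_lhs => rw [rel4]
    rw [Submodule.span_le]
    rintro _ (((⟨r, a, m, r', m', rfl⟩ | ⟨r, a, m, r', m', rfl⟩) | ⟨r, a, m, r', m', rfl⟩) | ⟨r, a, m, r', m', rfl⟩)
    all_goals
      simp only [SetLike.mem_coe, Submodule.mem_comap, map_add, tau4_tmul]
      apply Submodule.subset_span
    · exact Or.inr ⟨_, _, _, _, _, rfl⟩
    · exact Or.inl (Or.inr ⟨r', a, m', r, m, add_comm _ _⟩)
    · exact Or.inl (Or.inl (Or.inr ⟨r', a, m', r, m, add_comm _ _⟩))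
    · exact Or.inl (Or.inl (Or.inl ⟨_, _, _, _, _, rfl⟩))
  exact this hx

theorem DdL {A : DGA (ZMod 2)} (hd : A.d = 0) (R : DGBimod A) (a : A.V) (r : R.V) :
    R.d (R.actL a r) = R.actL a (R.d r) := by
  have h := DirectSum.IsInternal.submodule_iSup_eq_top A.internal
  have ha : a ∈ ⨆ i, A.gr i := by rw [h]; trivial
  induction ha using Submodule.iSup_induction' with
  | mem i x hx =>
    rw [R.leibnizL i x hx, hd]
    rcases Int.even_or_odd i with h | h
    · simp [Int.negOnePow_even _ h]
    · simp [Int.negOnePow_odd _ h, c2neg]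
  | zero => simp
  | add x y _ _ h1 h2 => simp [h1, h2]

theorem DdR {A : DGA (ZMod 2)} (hd : A.d = 0) (R : DGBimod A) (a : A.V) (r : R.V) :
    R.d (R.actR r a) = R.actR (R.d r) a := by
  have h := DirectSum.IsInternal.submodule_iSup_eq_top R.internal
  have ha : r ∈ ⨆ i, R.gr i := by rw [h]; trivial
  induction ha using Submodule.iSup_induction' with
  | mem i x hx => rw [R.leibnizR i x hx, hd]; simp
  | zero => simp
  | add x y _ _ h1 h2 => simp [h1, h2]

theorem d4_rel (hd : A.d = 0) (x : T4 R M) (hx : x ∈ rel4 R M) : d4 R M x ∈ rel4 R M := by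
  have : rel4 R M ≤ (rel4 R M).comap (d4 R M) := by
    apply rel_le
    all_goals
      intro r a m r' m'
      simp only [Submodule.mem_comap, map_add, d4_tmul, DdL hd, DdR hd]
    · have h := fun r m r' m' => rel_1 R M r a m r' m'
      convert Submodule.add_mem _ (Submodule.add_mem _ (h (R.d r) m r' m') (h r (M.d m) r' m')) (Submodule.add_mem _ (h r m (R.d r') m') (h r m r' (M.d m'))) using 1
      abel
    · have h := fun r m r' m' => rel_2 R M r a m r' m'
      convert Submodule.add_mem _ (Submodule.add_mem _ (h (R.d r) m r' m') (h r (M.d m) r' m')) (Submodule.add_mem _ (h r m (R.d r') m') (h r m r' (M.d m'))) using 1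
      abel
    · have h := fun r m r' m' => rel_3 R M r a m r' m'
      convert Submodule.add_mem _ (Submodule.add_mem _ (h (R.d r) m r' m') (h r (M.d m) r' m')) (Submodule.add_mem _ (h r m (R.d r') m') (h r m r' (M.d m'))) using 1
      abel
    · have h := fun r m r' m' => rel_4 R M r a m r' m'
      convert Submodule.add_mem _ (Submodule.add_mem _ (h (R.d r) m r' m') (h r (M.d m) r' m')) (Submodule.add_mem _ (h r m (R.d r') m') (h r m r' (M.d m'))) using 1
      abel
  exact this hx

def ev (c : ℤ) : (TateBicx R M).T →ₗ[ZMod 2] T4 R M :=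
  (Finsupp.lapply c : (ℤ →₀ T4 R M) →ₗ[ZMod 2] T4 R M)
def sg (p : ℤ) : T4 R M →ₗ[ZMod 2] (TateBicx R M).T :=
  (Finsupp.lsingle p : T4 R M →ₗ[ZMod 2] (ℤ →₀ T4 R M))

theorem ev_sg (c p : ℤ) (x : T4 R M) : ev R M c (sg R M p x) = if p = c then x else 0 :=
  Finsupp.single_apply

theorem T_ext {z w : (TateBicx R M).T} (h : ∀ c, ev R M c z = ev R M c w) : z = w :=
  Finsupp.ext h

theorem T_decomp (z : (TateBicx R M).T) : ∃ s : Finset ℤ, z = ∑ c ∈ s, sg R M c (ev R M c z) :=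
  ⟨Finsupp.support (M := T4 R M) z, (Finsupp.sum_single (M := T4 R M) z).symm⟩

theorem mem_N (z : (TateBicx R M).T) : z ∈ (TateBicx R M).N ↔ ∀ c, ev R M c z ∈ rel4 R M :=
  Submodule.mem_iInf (R := ZMod 2) (M := ℤ →₀ T4 R M) (fun p : ℤ => Submodule.comap (Finsupp.lapply p) (rel4 R M))

theorem D_apply (z : (TateBicx R M).T) (c : ℤ) :
    ev R M c ((TateBicx R M).D z) = d4 R M (ev R M c z) + (ev R M (c + 1) z + tau4 R M (ev R M (c + 1) z)) := by
  have h : ∀ z : ℤ →₀ T4 R M, ((Finsupp.mapDomain (fun p => p - 1)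
    (Finsupp.mapRange.linearMap (LinearMap.id + tau4 R M) z) + Finsupp.mapRange.linearMap (d4 R M) z : ℤ →₀ T4 R M)) c
      = d4 R M (z c) + (z (c + 1) + tau4 R M (z (c + 1))) := by
    intro z
    rw [Finsupp.add_apply, add_comm]
    congr 1
    have h2 : c = (fun p : ℤ => p - 1) (c + 1) := by simp
    conv_lhs => rw [h2]
    rw [Finsupp.mapDomain_apply (by intro a b; simp)]
    simp
  exact h z

theorem mem_Frow (q n : ℤ) (z : (TateBicx R M).T) :
    z ∈ (TateBicx R M).Frow q n ⊔ (TateBicx R M).N ↔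
      ∀ c, ev R M c z ∈ (if n - c ≤ q then gr4 R M (n - c) else ⊥) ⊔ rel4 R M := by
  constructor
  · intro h
    have : (TateBicx R M).Frow q n ⊔ (TateBicx R M).N ≤
        (⨅ c : ℤ, Submodule.comap (ev R M c)
          ((if n - c ≤ q then gr4 R M (n - c) else ⊥) ⊔ rel4 R M)) := by
      refine sup_le (iSup₂_le fun j hj => ?_) ?_
      · rintro _ ⟨x, hx, rfl⟩
        change sg R M _ x ∈ _
        rw [Submodule.mem_iInf]
        intro c
        rw [Submodule.mem_comap, ev_sg]
        by_cases h1 : n - j = c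
        · subst h1
          rw [if_pos rfl, if_pos (by omega)]
          apply Submodule.mem_sup_left
          rw [sub_sub_cancel]; exact hx
        · rw [if_neg h1]; exact Submodule.zero_mem _
      · refine iInf_mono fun c => Submodule.comap_mono le_sup_right
    have h2 := this h
    rw [Submodule.mem_iInf] at h2
    exact h2
  · intro h
    have h' : ∀ c, ∃ u ∈ (if n - c ≤ q then gr4 R M (n - c) else ⊥), ∃ v ∈ rel4 R M, u + v = ev R M c z :=
      fun c => Submodule.mem_sup.1 (h c)
    choose u hu v hv huv using h'
    obtain ⟨s, hs⟩ := T_decomp R M z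
    rw [hs]
    refine Submodule.sum_mem _ fun c _ => ?_
    rw [← huv, map_add]
    refine Submodule.add_mem _ ?_ ?_
    · apply Submodule.mem_sup_left
      have := hu c
      split_ifs at this with hc
      · refine Submodule.mem_iSup_of_mem (n - c) (Submodule.mem_iSup_of_mem hc ?_)
        refine ⟨u c, this, ?_⟩
        change sg R M _ _ = _
        congr 2; ring
      · rw [Submodule.mem_bot] at this; rw [this, map_zero]; exact Submodule.zero_mem _
    · apply Submodule.mem_sup_right
      rw [mem_N]
      intro p
      rw [ev_sg]
      split_ifs
      · exact hv c
      · simp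

def Pgr : Prop := ∀ (q : ℤ) (z0 z1 z2 : T4 R M), z0 ∈ gr4 R M q ⊔ rel4 R M →
    z0 + tau4 R M z0 ∈ rel4 R M → d4 R M z0 + (z1 + tau4 R M z1) ∈ rel4 R M →
    d4 R M z1 + (z2 + tau4 R M z2) ∈ rel4 R M →
    ∃ t0 ∈ gr4 R M q, ∃ t1 ∈ gr4 R M (q - 1), ∃ y0 ∈ gr4 R M q, ∃ y1 ∈ gr4 R M (q + 1),
      ∃ y2 ∈ gr4 R M (q + 2),
      t0 + tau4 R M t0 ∈ rel4 R M ∧ d4 R M t0 + (t1 + tau4 R M t1) ∈ rel4 R M ∧ d4 R M t1 ∈ rel4 R M ∧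
      z0 + t0 + (y0 + tau4 R M y0) + d4 R M y1 ∈ rel4 R M ∧
      d4 R M y2 + (y1 + tau4 R M y1) ∈ rel4 R M ∧ y2 + tau4 R M y2 ∈ rel4 R M

theorem d4_gr (q : ℤ) (x : T4 R M) (hx : x ∈ gr4 R M q) : d4 R M x ∈ gr4 R M (q - 1) := by
  have : gr4 R M q ≤ (gr4 R M (q - 1)).comap (d4 R M) := by
    conv_lhs => rw [gr4]
    rw [Submodule.span_le]
    rintro _ ⟨i₁, j₁, i₂, j₂, r, hr, m, hm, r', hr', m', hm', h, rfl⟩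
    simp only [SetLike.mem_coe, Submodule.mem_comap, d4_tmul]
    refine Submodule.add_mem _ (Submodule.add_mem _ (Submodule.add_mem _ ?_ ?_) ?_) ?_ <;>
      apply Submodule.subset_span
    · exact ⟨_, _, _, _, _, R.d_gr _ _ hr, _, hm, _, hr', _, hm', by omega, rfl⟩
    · exact ⟨_, _, _, _, _, hr, _, M.d_gr _ _ hm, _, hr', _, hm', by omega, rfl⟩
    · exact ⟨_, _, _, _, _, hr, _, hm, _, R.d_gr _ _ hr', _, hm', by omega, rfl⟩
    · exact ⟨_, _, _, _, _, hr, _, hm, _, hr', _, M.d_gr _ _ hm', by omega, rfl⟩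
  exact this hx

theorem collapse_of_Pgr (hd : A.d = 0) (hP : Pgr R M) : PiFormalBimod R M := by
  intro r hr q n
  rintro _ ⟨z, hz, rfl⟩
  obtain ⟨hz1, hz2⟩ := hz
  rw [SetLike.mem_coe, Submodule.mem_comap] at hz2
  rw [SetLike.mem_coe] at hz1
  have hz1' := hz1
  have hz2' := hz2
  rw [mem_Frow] at hz1
  rw [mem_Frow] at hz2
  have hD := D_apply R M
  have hz2s : ∀ c, c < n - 1 - (q - r) → d4 R M ((ev R M c z)) + ((ev R M (c + 1) z) + tau4 R M ((ev R M (c + 1) z))) ∈ rel4 R M := by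
    intro c hc
    have := hz2 c
    rw [hD, if_neg (by omega)] at this
    simpa using this
  have hz0r : ∀ c, c < n - q → (ev R M c z) ∈ rel4 R M := by
    intro c hc
    have := hz1 c
    rw [if_neg (by omega)] at this
    simpa using this
  obtain ⟨t0, ht0, t1, ht1, y0, hy0, y1, hy1, y2, hy2, e1, e2, e3, e4, e5, e6⟩ :=
    hP q ((ev R M (n - q) z)) ((ev R M (n - q + 1) z)) ((ev R M (n - q + 1 + 1) z))
    (by have := hz1 (n - q); rw [if_pos (by omega)] at this; simpa using this)
    (by
      have h1 := hz2s (n - q - 1) (by omega)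
      have h2 := d4_rel R M hd _ (hz0r (n - q - 1) (by omega))
      rw [sub_add_cancel] at h1
      have := Submodule.add_mem _ h2 h1
      rwa [c2'] at this)
    (hz2s _ (by omega)) (hz2s _ (by omega))
  let z'  : (TateBicx R M).T := sg R M (n - q) t0 + sg R M (n - q + 1) t1
  let y  : (TateBicx R M).T := sg R M (n + 1 - q) y0 + sg R M (n - q) y1 + sg R M (n - q - 1) y2
  have hz' : (TateBicx R M).D z' ∈ (TateBicx R M).N := by
    rw [mem_N]
    intro c
    rw [hD]
    by_cases h1 : c = n - q
    · subst h1; simpa [z', ev_sg] using e2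
    by_cases h2 : c = n - q - 1
    · subst h2
      have a1 : n - q ≠ n - q - 1 := by omega
      have a2 : n - q + 1 ≠ n - q - 1 := by omega
      simpa [z', ev_sg, a1, a2] using e1
    by_cases h3 : c = n - q + 1
    · subst h3; simpa [z', ev_sg, add_assoc] using e3
    · have a1 : ¬ (n - q = c) := by omega
      have a2 : ¬ (n - q + 1 = c) := by omega
      have a3 : ¬ (n - q = c + 1) := by omega
      have a4 : ¬ (n - q = c) := by omega
      simp [z', ev_sg, a1, a2, a3, a4]
  have hDy : ∀ c, ev R M c ((TateBicx R M).D y) = d4 R M ((ev R M c y)) + ((ev R M (c + 1) y) + tau4 R M ((ev R M (c + 1) y))) := hD y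
  have hDD : (TateBicx R M).D ((TateBicx R M).D y) = 0 := by
    apply T_ext
    intro c
    rw [hD, hD, hD]
    simp only [map_add, d4_d4, tau4_tau4, d4_tau4, map_zero]
    abel_nf; simp [c2z]
  let z''  : (TateBicx R M).T := z + z' + (TateBicx R M).D y
  have hDz : (TateBicx R M).D z'' = (TateBicx R M).D z + (TateBicx R M).D z' := by
    change (TateBicx R M).D (z + z' + (TateBicx R M).D y) = _
    rw [map_add, map_add, hDD, add_zero]
  have hz''1 : z'' ∈ (TateBicx R M).Frow (q - 1) n ⊔ (TateBicx R M).N := by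
    rw [mem_Frow]
    intro c
    have hc : (ev R M c z'') = (ev R M c z) + (ev R M c z') + (d4 R M ((ev R M c y)) + ((ev R M (c + 1) y) + tau4 R M ((ev R M (c + 1) y)))) := by
      rw [← hDy, ← map_add, ← map_add]
    rw [hc]
    by_cases h1 : c = n - q
    · subst h1
      apply Submodule.mem_sup_right
      convert e4 using 1
      have a1 : n + 1 - q ≠ n - q := by omega
      have a2 : n - q + 1 = n + 1 - q := by omega
      have a3 : n - q ≠ n + 1 - q := by omega
      have a4 : n - q - 1 ≠ n + 1 - q := by omega
      simp [z', y, ev_sg, a1, a2, a3, a4]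
      abel
    by_cases h2 : c = n - q - 1
    · subst h2
      apply Submodule.mem_sup_right
      have := Submodule.add_mem _ (hz0r (n - q - 1) (by omega)) e5
      convert this using 1
      have a1 : n + 1 - q ≠ n - q := by omega
      have a5 : n + 1 - q ≠ n - q - 1 := by omega
      have a2 : n - q + 1 ≠ n - q - 1 := by omega
      have a7 : n - q ≠ n - q - 1 := by omega
      simp [z', y, ev_sg, a1, a2, a5, a7]
    by_cases h3 : c = n - q - 2
    · subst h3
      apply Submodule.mem_sup_right
      have := Submodule.add_mem _ (hz0r (n - q - 2) (by omega)) e6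
      convert this using 1
      have a1 : n + 1 - q ≠ n - q - 2 := by omega
      have a2 : n - q + 1 ≠ n - q - 2 := by omega
      have a5 : n + 1 - q ≠ n - q - 2 + 1 := by omega
      have a6 : n - q ≠ n - q - 2 + 1 := by omega
      have a7 : n - q - 1 = n - q - 2 + 1 := by omega
      have a8 : n - q - 1 ≠ n - q - 2 := by omega
      have a9 : n - q ≠ n - q - 2 := by omega
      simp [z', y, ev_sg, a1, a2, a5, a6, a7, a9]
    by_cases h4 : c = n - q + 1
    · subst h4
      rw [if_pos (by omega)]
      have e : n - (n - q + 1) = q - 1 := by omega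
      have hzc := hz1 (n - q + 1)
      rw [if_pos (by omega), e] at hzc
      rw [e]
      have hy0' := d4_gr R M _ _ hy0
      have := Submodule.add_mem _ (Submodule.add_mem _ hzc (Submodule.mem_sup_left ht1)) (Submodule.mem_sup_left (T := rel4 R M) hy0')
      convert this using 1
      have a1 : n + 1 - q = n - q + 1 := by omega
      have a2 : n - q ≠ n - q + 1 := by omega
      have a5 : n + 1 - q ≠ n - q + 1 + 1 := by omega
      have a6 : n - q ≠ n - q + 1 + 1 := by omega
      have a7 : n - q - 1 ≠ n - q + 1 + 1 := by omega
      have a8 : n - q - 1 ≠ n - q + 1 := by omega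
      simp [z', y, ev_sg, a1, a6, a7, a8]
    · have e : (ev R M c z') = 0 := by
        have a1 : n - q ≠ c := by omega
        have a2 : n - q + 1 ≠ c := by omega
        simp [z', ev_sg, a1, a2]
      have e' : (ev R M c y) = 0 := by
        have a1 : n - q ≠ c := by omega
        have a2 : n + 1 - q ≠ c := by omega
        have a3 : n - q - 1 ≠ c := by omega
        simp [y, ev_sg, a1, a2, a3]
      have e'' : (ev R M (c + 1) y) = 0 := by
        have a1 : n - q ≠ c + 1 := by omega
        have a2 : n + 1 - q ≠ c + 1 := by omega
        have a3 : n - q - 1 ≠ c + 1 := by omega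
        simp [y, ev_sg, a1, a2, a3]
      rw [e, e', e'']
      have := hz1 c
      simp only [add_zero, map_zero]
      by_cases h : n - c ≤ q - 1
      · rw [if_pos h]; rwa [if_pos (by omega)] at this
      · rw [if_neg h]; rwa [if_neg (by omega)] at this
  have hz''2 : z'' ∈ (TateBicx R M).Zpage (TateBicx R M).Frow (r - 1) (q - 1) n := by
    refine ⟨hz''1, ?_⟩
    rw [SetLike.mem_coe, Submodule.mem_comap, hDz]
    refine Submodule.add_mem _ ?_ (Submodule.mem_sup_right hz')
    convert hz2' using 3
    ring
  have key : (TateBicx R M).D z = (TateBicx R M).D z'' + (TateBicx R M).D z' := by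
    rw [hDz, add_assoc]
    rw [c2 ((TateBicx R M).D z'), add_zero]
  rw [key]
  refine Submodule.add_mem _ ?_ (Submodule.mem_sup_right hz')
  exact Submodule.mem_sup_left (Submodule.mem_sup_left ⟨z'', hz''2, rfl⟩)
end


section
variable {V W : Type} [AddCommGroup V] [Module (ZMod 2) V] [AddCommGroup W] [Module (ZMod 2) W]

theorem hind {gr : ℤ → Submodule (ZMod 2) V} (h : DirectSum.IsInternal gr) (S : Submodule (ZMod 2) W)
    (f : V → W) (hadd : ∀ x y, f (x + y) = f x + f y) (hom : ∀ i, ∀ x ∈ gr i, f x ∈ S) (x : V) : f x ∈ S := by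
  have h0 : f 0 = 0 := by
    have := hadd 0 0
    simpa using this
  have h := DirectSum.IsInternal.submodule_iSup_eq_top h
  have ha : x ∈ ⨆ i, gr i := by rw [h]; trivial
  induction ha using Submodule.iSup_induction' with
  | mem i x hx => exact hom i x hx
  | zero => rw [h0]; exact S.zero_mem
  | add x y _ _ h1 h2 => rw [hadd]; exact S.add_mem h1 h2

def tp {gr : ℤ → Submodule (ZMod 2) V} (h : DirectSum.IsInternal gr) (q : ℤ → W →ₗ[ZMod 2] W) (n : ℤ) :
    V ⊗[ZMod 2] W →ₗ[ZMod 2] V ⊗[ZMod 2] W :=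
  TensorProduct.lift ((DirectSum.toModule (ZMod 2) ℤ (W →ₗ[ZMod 2] V ⊗[ZMod 2] W)
    (fun i => ((TensorProduct.mk (ZMod 2) V W).compl₂ (q (n - i))) ∘ₗ (gr i).subtype)) ∘ₗ
    (LinearEquiv.ofBijective (DirectSum.coeLinearMap gr) h).symm.toLinearMap)

theorem symm_of_mem {gr : ℤ → Submodule (ZMod 2) V} (h : DirectSum.IsInternal gr) {i : ℤ} {v : V} (hv : v ∈ gr i) :
    (LinearEquiv.ofBijective (DirectSum.coeLinearMap gr) h).symm v = DirectSum.lof (ZMod 2) ℤ (fun i => gr i) i ⟨v, hv⟩ := by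
  rw [LinearEquiv.symm_apply_eq]
  exact (DirectSum.coeLinearMap_lof gr i ⟨v, hv⟩).symm

theorem tp_apply {gr : ℤ → Submodule (ZMod 2) V} (h : DirectSum.IsInternal gr) (q : ℤ → W →ₗ[ZMod 2] W) (n : ℤ)
    {i : ℤ} {v : V} (hv : v ∈ gr i) (w : W) : tp h q n (v ⊗ₜ w) = v ⊗ₜ q (n - i) w := by
  rw [tp, TensorProduct.lift.tmul, LinearMap.comp_apply, LinearEquiv.coe_toLinearMap, symm_of_mem h hv, DirectSum.toModule_lof]
  simp

def pr {gr : ℤ → Submodule (ZMod 2) V} (h : DirectSum.IsInternal gr) (n : ℤ) : V →ₗ[ZMod 2] V :=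
  (DirectSum.toModule (ZMod 2) ℤ V (fun i => if i = n then (gr i).subtype else 0)) ∘ₗ
    (LinearEquiv.ofBijective (DirectSum.coeLinearMap gr) h).symm.toLinearMap

theorem pr_apply {gr : ℤ → Submodule (ZMod 2) V} (h : DirectSum.IsInternal gr) (n : ℤ)
    {i : ℤ} {v : V} (hv : v ∈ gr i) : pr h n v = if i = n then v else 0 := by
  rw [pr, LinearMap.comp_apply, LinearEquiv.coe_toLinearMap, symm_of_mem h hv, DirectSum.toModule_lof]
  split_ifs <;> simp
end

section
variable {A : DGA (ZMod 2)} (R M : DGBimod A)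

def Q4 (n : ℤ) : T4 R M →ₗ[ZMod 2] T4 R M :=
  tp R.internal (tp M.internal (tp R.internal (pr M.internal))) n

theorem Q4_apply (n : ℤ) {i₁ j₁ i₂ j₂ : ℤ} {r m r' m'} (hr : r ∈ R.gr i₁) (hm : m ∈ M.gr j₁) (hr' : r' ∈ R.gr i₂)
    (hm' : m' ∈ M.gr j₂) : Q4 R M n (r ⊗ₜ (m ⊗ₜ (r' ⊗ₜ m'))) =
      if i₁ + j₁ + i₂ + j₂ = n then r ⊗ₜ (m ⊗ₜ (r' ⊗ₜ m')) else 0 := by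
  rw [Q4, tp_apply _ _ _ hr, tp_apply _ _ _ hm, tp_apply _ _ _ hr', pr_apply _ _ hm']
  split_ifs with h1 h2 h2
  · rfl
  · omega
  · omega
  · simp

theorem T4hom {W : Type} [AddCommGroup W] [Module (ZMod 2) W] (S : Submodule (ZMod 2) W) (f : T4 R M →ₗ[ZMod 2] W)
    (h : ∀ i₁ j₁ i₂ j₂, ∀ r ∈ R.gr i₁, ∀ m ∈ M.gr j₁, ∀ r' ∈ R.gr i₂, ∀ m' ∈ M.gr j₂,
      f (r ⊗ₜ (m ⊗ₜ (r' ⊗ₜ m'))) ∈ S) (x : T4 R M) : f x ∈ S := by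
  have key : ∀ r m r' m', f (r ⊗ₜ (m ⊗ₜ (r' ⊗ₜ m'))) ∈ S := by
    intro r m r' m'
    refine hind R.internal S (fun r => f (r ⊗ₜ (m ⊗ₜ (r' ⊗ₜ m')))) (by simp [add_tmul, tmul_add]) (fun i r hr => ?_) r
    refine hind M.internal S (fun m => f (r ⊗ₜ (m ⊗ₜ (r' ⊗ₜ m')))) (by simp [add_tmul, tmul_add]) (fun j m hm => ?_) m
    refine hind R.internal S (fun r' => f (r ⊗ₜ (m ⊗ₜ (r' ⊗ₜ m')))) (by simp [add_tmul, tmul_add]) (fun i' r' hr' => ?_) r'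
    refine hind M.internal S (fun m' => f (r ⊗ₜ (m ⊗ₜ (r' ⊗ₜ m')))) (by simp [add_tmul, tmul_add]) (fun j' m' hm' => ?_) m'
    exact h _ _ _ _ r hr m hm r' hr' m' hm'
  have : S.mkQ.comp f = 0 := by
    apply T4ext
    intro r m r' m'
    simpa using key r m r' m'
  have h2 := LinearMap.congr_fun this x
  simpa using h2

theorem T4hom_eq {W : Type} [AddCommGroup W] [Module (ZMod 2) W] (f g : T4 R M →ₗ[ZMod 2] W)
    (h : ∀ i₁ j₁ i₂ j₂, ∀ r ∈ R.gr i₁, ∀ m ∈ M.gr j₁, ∀ r' ∈ R.gr i₂, ∀ m' ∈ M.gr j₂,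
      f (r ⊗ₜ (m ⊗ₜ (r' ⊗ₜ m'))) = g (r ⊗ₜ (m ⊗ₜ (r' ⊗ₜ m')))) (x : T4 R M) : f x = g x := by
  have := T4hom R M ⊥ (f - g) (by
    intro i₁ j₁ i₂ j₂ r hr m hm r' hr' m' hm'
    simp [h _ _ _ _ r hr m hm r' hr' m' hm']) x
  simpa [sub_eq_zero] using this

theorem Q4_gr (n : ℤ) (x : T4 R M) : Q4 R M n x ∈ gr4 R M n := by
  apply T4hom
  intro i₁ j₁ i₂ j₂ r hr m hm r' hr' m' hm'
  rw [Q4_apply R M n hr hm hr' hm']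
  split_ifs with h
  · exact Submodule.subset_span ⟨_, _, _, _, _, hr, _, hm, _, hr', _, hm', h, rfl⟩
  · simp

theorem Q4_id (n : ℤ) (x : T4 R M) (hx : x ∈ gr4 R M n) : Q4 R M n x = x := by
  have : gr4 R M n ≤ LinearMap.eqLocus (Q4 R M n) LinearMap.id := by
    conv_lhs => rw [gr4]
    rw [Submodule.span_le]
    rintro _ ⟨i₁, j₁, i₂, j₂, r, hr, m, hm, r', hr', m', hm', h, rfl⟩
    simp only [SetLike.mem_coe, LinearMap.mem_eqLocus]
    rw [Q4_apply R M n hr hm hr' hm', if_pos h]; rfl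
  exact this hx

theorem Q4_tau (n : ℤ) (x : T4 R M) : tau4 R M (Q4 R M n x) = Q4 R M n (tau4 R M x) := by
  apply T4hom_eq R M ((tau4 R M).comp (Q4 R M n)) ((Q4 R M n).comp (tau4 R M))
  intro i₁ j₁ i₂ j₂ r hr m hm r' hr' m' hm'
  simp only [LinearMap.comp_apply]
  rw [Q4_apply R M n hr hm hr' hm', tau4_tmul, Q4_apply R M n hr' hm' hr hm]
  have : i₁ + j₁ + i₂ + j₂ = i₂ + j₂ + i₁ + j₁ := by ring
  rw [this]
  split_ifs <;> simp [tau4_tmul]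

theorem Q4_d (n n' : ℤ) (hn : n' = n - 1) (x : T4 R M) : d4 R M (Q4 R M n x) = Q4 R M n' (d4 R M x) := by
  subst hn
  apply T4hom_eq R M ((d4 R M).comp (Q4 R M n)) ((Q4 R M (n-1)).comp (d4 R M))
  intro i₁ j₁ i₂ j₂ r hr m hm r' hr' m' hm'
  simp only [LinearMap.comp_apply]
  rw [Q4_apply R M n hr hm hr' hm', d4_tmul, map_add, map_add, map_add, Q4_apply R M _ (R.d_gr _ _ hr) hm hr' hm',
    Q4_apply R M _ hr (M.d_gr _ _ hm) hr' hm', Q4_apply R M _ hr hm (R.d_gr _ _ hr') hm', Q4_apply R M _ hr hm hr' (M.d_gr _ _ hm')]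
  by_cases h : i₁ + j₁ + i₂ + j₂ = n
  · rw [if_pos h, if_pos (by omega), if_pos (by omega), if_pos (by omega), if_pos (by omega), d4_tmul]
  · rw [if_neg h, if_neg (by omega), if_neg (by omega), if_neg (by omega), if_neg (by omega)]; simp

theorem Q4_rel (n : ℤ) (x : T4 R M) (hx : x ∈ rel4 R M) : Q4 R M n x ∈ rel4 R M := by
  have : rel4 R M ≤ (rel4 R M).comap (Q4 R M n) := by
    apply rel_le
    · intro r a m r' m'
      rw [Submodule.mem_comap]
      refine hind R.internal _ (fun r => Q4 R M n (R.actR r a ⊗ₜ (m ⊗ₜ (r' ⊗ₜ m')) + r ⊗ₜ (M.actL a m ⊗ₜ (r' ⊗ₜ m')))) (by intros; simp [add_tmul, tmul_add]; abel) (fun i r hr => ?_) r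
      refine hind A.internal _ (fun a => Q4 R M n (R.actR r a ⊗ₜ (m ⊗ₜ (r' ⊗ₜ m')) + r ⊗ₜ (M.actL a m ⊗ₜ (r' ⊗ₜ m')))) (by intros; simp [add_tmul, tmul_add]; abel) (fun s a ha => ?_) a
      refine hind M.internal _ (fun m => Q4 R M n (R.actR r a ⊗ₜ (m ⊗ₜ (r' ⊗ₜ m')) + r ⊗ₜ (M.actL a m ⊗ₜ (r' ⊗ₜ m')))) (by intros; simp [add_tmul, tmul_add]; abel) (fun j m hm => ?_) m
      refine hind R.internal _ (fun r' => Q4 R M n (R.actR r a ⊗ₜ (m ⊗ₜ (r' ⊗ₜ m')) + r ⊗ₜ (M.actL a m ⊗ₜ (r' ⊗ₜ m')))) (by intros; simp [add_tmul, tmul_add]; abel) (fun i' r' hr' => ?_) r'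
      refine hind M.internal _ (fun m' => Q4 R M n (R.actR r a ⊗ₜ (m ⊗ₜ (r' ⊗ₜ m')) + r ⊗ₜ (M.actL a m ⊗ₜ (r' ⊗ₜ m')))) (by intros; simp [add_tmul, tmul_add]; abel) (fun j' m' hm' => ?_) m'
      simp only [map_add]
      rw [Q4_apply R M n (R.actR_gr _ _ _ hr _ ha) hm hr' hm', Q4_apply R M n hr (M.actL_gr _ _ _ ha _ hm) hr' hm']
      by_cases h : i + s + j + i' + j' = n
      · rw [if_pos h, if_pos (by omega)]; apply rel_1
      · rw [if_neg h, if_neg (by omega)]; simp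
    · intro r a m r' m'
      rw [Submodule.mem_comap]
      refine hind R.internal _ (fun r => Q4 R M n (R.actL a r ⊗ₜ (m ⊗ₜ (r' ⊗ₜ m')) + r ⊗ₜ (m ⊗ₜ (r' ⊗ₜ M.actR m' a)))) (by intros; simp [add_tmul, tmul_add]; abel) (fun i r hr => ?_) r
      refine hind A.internal _ (fun a => Q4 R M n (R.actL a r ⊗ₜ (m ⊗ₜ (r' ⊗ₜ m')) + r ⊗ₜ (m ⊗ₜ (r' ⊗ₜ M.actR m' a)))) (by intros; simp [add_tmul, tmul_add]; abel) (fun s a ha => ?_) a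
      refine hind M.internal _ (fun m => Q4 R M n (R.actL a r ⊗ₜ (m ⊗ₜ (r' ⊗ₜ m')) + r ⊗ₜ (m ⊗ₜ (r' ⊗ₜ M.actR m' a)))) (by intros; simp [add_tmul, tmul_add]; abel) (fun j m hm => ?_) m
      refine hind R.internal _ (fun r' => Q4 R M n (R.actL a r ⊗ₜ (m ⊗ₜ (r' ⊗ₜ m')) + r ⊗ₜ (m ⊗ₜ (r' ⊗ₜ M.actR m' a)))) (by intros; simp [add_tmul, tmul_add]; abel) (fun i' r' hr' => ?_) r'
      refine hind M.internal _ (fun m' => Q4 R M n (R.actL a r ⊗ₜ (m ⊗ₜ (r' ⊗ₜ m')) + r ⊗ₜ (m ⊗ₜ (r' ⊗ₜ M.actR m' a)))) (by intros; simp [add_tmul, tmul_add]; abel) (fun j' m' hm' => ?_) m'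
      simp only [map_add]
      rw [Q4_apply R M n (R.actL_gr _ _ _ ha _ hr) hm hr' hm', Q4_apply R M n hr hm hr' (M.actR_gr _ _ _ hm' _ ha)]
      by_cases h : s + i + j + i' + j' = n
      · rw [if_pos h, if_pos (by omega)]; apply rel_2
      · rw [if_neg h, if_neg (by omega)]; simp
    · intro r a m r' m'
      rw [Submodule.mem_comap]
      refine hind R.internal _ (fun r => Q4 R M n (r ⊗ₜ (M.actR m a ⊗ₜ (r' ⊗ₜ m')) + r ⊗ₜ (m ⊗ₜ (R.actL a r' ⊗ₜ m')))) (by intros; simp [add_tmul, tmul_add]; abel) (fun i r hr => ?_) r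
      refine hind A.internal _ (fun a => Q4 R M n (r ⊗ₜ (M.actR m a ⊗ₜ (r' ⊗ₜ m')) + r ⊗ₜ (m ⊗ₜ (R.actL a r' ⊗ₜ m')))) (by intros; simp [add_tmul, tmul_add]; abel) (fun s a ha => ?_) a
      refine hind M.internal _ (fun m => Q4 R M n (r ⊗ₜ (M.actR m a ⊗ₜ (r' ⊗ₜ m')) + r ⊗ₜ (m ⊗ₜ (R.actL a r' ⊗ₜ m')))) (by intros; simp [add_tmul, tmul_add]; abel) (fun j m hm => ?_) m
      refine hind R.internal _ (fun r' => Q4 R M n (r ⊗ₜ (M.actR m a ⊗ₜ (r' ⊗ₜ m')) + r ⊗ₜ (m ⊗ₜ (R.actL a r' ⊗ₜ m')))) (by intros; simp [add_tmul, tmul_add]; abel) (fun i' r' hr' => ?_) r'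
      refine hind M.internal _ (fun m' => Q4 R M n (r ⊗ₜ (M.actR m a ⊗ₜ (r' ⊗ₜ m')) + r ⊗ₜ (m ⊗ₜ (R.actL a r' ⊗ₜ m')))) (by intros; simp [add_tmul, tmul_add]; abel) (fun j' m' hm' => ?_) m'
      simp only [map_add]
      rw [Q4_apply R M n hr (M.actR_gr _ _ _ hm _ ha) hr' hm', Q4_apply R M n hr hm (R.actL_gr _ _ _ ha _ hr') hm']
      by_cases h : i + (j + s) + i' + j' = n
      · rw [if_pos h, if_pos (by omega)]; apply rel_3
      · rw [if_neg h, if_neg (by omega)]; simp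
    · intro r a m r' m'
      rw [Submodule.mem_comap]
      refine hind R.internal _ (fun r => Q4 R M n (r ⊗ₜ (m ⊗ₜ (R.actR r' a ⊗ₜ m')) + r ⊗ₜ (m ⊗ₜ (r' ⊗ₜ M.actL a m')))) (by intros; simp [add_tmul, tmul_add]; abel) (fun i r hr => ?_) r
      refine hind A.internal _ (fun a => Q4 R M n (r ⊗ₜ (m ⊗ₜ (R.actR r' a ⊗ₜ m')) + r ⊗ₜ (m ⊗ₜ (r' ⊗ₜ M.actL a m')))) (by intros; simp [add_tmul, tmul_add]; abel) (fun s a ha => ?_) a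
      refine hind M.internal _ (fun m => Q4 R M n (r ⊗ₜ (m ⊗ₜ (R.actR r' a ⊗ₜ m')) + r ⊗ₜ (m ⊗ₜ (r' ⊗ₜ M.actL a m')))) (by intros; simp [add_tmul, tmul_add]; abel) (fun j m hm => ?_) m
      refine hind R.internal _ (fun r' => Q4 R M n (r ⊗ₜ (m ⊗ₜ (R.actR r' a ⊗ₜ m')) + r ⊗ₜ (m ⊗ₜ (r' ⊗ₜ M.actL a m')))) (by intros; simp [add_tmul, tmul_add]; abel) (fun i' r' hr' => ?_) r'
      refine hind M.internal _ (fun m' => Q4 R M n (r ⊗ₜ (m ⊗ₜ (R.actR r' a ⊗ₜ m')) + r ⊗ₜ (m ⊗ₜ (r' ⊗ₜ M.actL a m')))) (by intros; simp [add_tmul, tmul_add]; abel) (fun j' m' hm' => ?_) m'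
      simp only [map_add]
      rw [Q4_apply R M n hr hm (R.actR_gr _ _ _ hr' _ ha) hm', Q4_apply R M n hr hm hr' (M.actL_gr _ _ _ ha _ hm')]
      by_cases h : i + j + (i' + s) + j' = n
      · rw [if_pos h, if_pos (by omega)]; apply rel_4
      · rw [if_neg h, if_neg (by omega)]; simp
  exact this hx

def Pun : Prop := ∀ (z0 z1 z2 : T4 R M),
    z0 + tau4 R M z0 ∈ rel4 R M → d4 R M z0 + (z1 + tau4 R M z1) ∈ rel4 R M →
    d4 R M z1 + (z2 + tau4 R M z2) ∈ rel4 R M →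
    ∃ t0 t1 y0 y1 y2 : T4 R M,
      t0 + tau4 R M t0 ∈ rel4 R M ∧ d4 R M t0 + (t1 + tau4 R M t1) ∈ rel4 R M ∧ d4 R M t1 ∈ rel4 R M ∧
      z0 + t0 + (y0 + tau4 R M y0) + d4 R M y1 ∈ rel4 R M ∧
      d4 R M y2 + (y1 + tau4 R M y1) ∈ rel4 R M ∧ y2 + tau4 R M y2 ∈ rel4 R M

theorem Pgr_of_Pun (h : Pun R M) : Pgr R M := by
  intro q z0 z1 z2 h0 h1 h2 h3
  obtain ⟨t0, t1, y0, y1, y2, e1, e2, e3, e4, e5, e6⟩ := h z0 z1 z2 h1 h2 h3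
  refine ⟨Q4 R M q t0, Q4_gr _ _ _ _, Q4 R M (q-1) t1, Q4_gr _ _ _ _, Q4 R M q y0, Q4_gr _ _ _ _, Q4 R M (q+1) y1, Q4_gr _ _ _ _,
    Q4 R M (q+2) y2, Q4_gr _ _ _ _, ?_, ?_, ?_, ?_, ?_, ?_⟩
  · rw [Q4_tau, ← map_add]; exact Q4_rel _ _ _ _ e1
  · rw [Q4_tau, Q4_d _ _ q (q-1) rfl, ← map_add, ← map_add]; exact Q4_rel _ _ _ _ e2
  · rw [Q4_d _ _ (q-1) (q-2) (by ring)]; exact Q4_rel _ _ _ _ e3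
  · obtain ⟨u, hu, v, hv, rfl⟩ := Submodule.mem_sup.1 h0
    have h4 := Q4_rel R M q _ e4
    have h5 := Submodule.add_mem _ (Submodule.add_mem _ h4 (Q4_rel R M q _ hv)) hv
    convert h5 using 1
    rw [Q4_tau, Q4_d _ _ (q+1) q (by ring)]
    simp only [map_add]
    rw [Q4_id R M q u hu]
    have := c2 (Q4 R M q v)
    rw [← sub_eq_zero]; abel_nf; simp [c2z]
  · rw [Q4_tau, Q4_d _ _ (q+2) (q+1) (by ring), ← map_add, ← map_add]; exact Q4_rel _ _ _ _ e5
  · rw [Q4_tau, ← map_add]; exact Q4_rel _ _ _ _ e6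
end


section Tate
variable {Z : Type} [AddCommGroup Z] [Module (ZMod 2) Z]

/-- swap -/
abbrev sw (Z : Type) [AddCommGroup Z] [Module (ZMod 2) Z] : Z ⊗[ZMod 2] Z →ₗ[ZMod 2] Z ⊗[ZMod 2] Z :=
  (TensorProduct.comm (ZMod 2) Z Z).toLinearMap

theorem sw_tmul (x y : Z) : sw Z (x ⊗ₜ y) = y ⊗ₜ x := by simp [sw]

theorem sw_sw (x : Z ⊗[ZMod 2] Z) : sw Z (sw Z x) = x := by
  have : (sw Z).comp (sw Z) = LinearMap.id := by ext; simp
  exact LinearMap.congr_fun this x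

theorem tate_inj (ζ : Z) (u : Z ⊗[ZMod 2] Z) (h : ζ ⊗ₜ ζ = u + sw Z u) : ζ = 0 := by
  rw [← Module.forall_dual_apply_eq_zero_iff (ZMod 2)]
  intro f
  let F : Z ⊗[ZMod 2] Z →ₗ[ZMod 2] ZMod 2 := (LinearMap.mul' (ZMod 2) (ZMod 2)).comp (TensorProduct.map f f)
  have h1 : F.comp (sw Z) = F := by
    ext x y; simp [F, mul_comm]
  have h2 : F (ζ ⊗ₜ ζ) = 0 := by
    rw [h, map_add]
    have := LinearMap.congr_fun h1 u
    rw [LinearMap.comp_apply] at this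
    rw [this, c2]
  have h3 : f ζ * f ζ = 0 := by simpa [F] using h2
  simpa using h3

def SqSub (Z : Type) [AddCommGroup Z] [Module (ZMod 2) Z] : Submodule (ZMod 2) (Z ⊗[ZMod 2] Z) where
  carrier := {η | ∃ ζ u, η = ζ ⊗ₜ ζ + (u + sw Z u)}
  add_mem' := by
    rintro _ _ ⟨ζ, u, rfl⟩ ⟨ζ', u', rfl⟩
    refine ⟨ζ + ζ', u + u' + ζ ⊗ₜ ζ', ?_⟩
    simp only [tmul_add, add_tmul, map_add, sw_tmul]
    apply c2eq; abel_nf; simp [c2z]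
  zero_mem' := ⟨0, 0, by simp⟩
  smul_mem' := by
    rintro c _ ⟨ζ, u, rfl⟩
    have : c = 0 ∨ c = 1 := by revert c; decide
    rcases this with rfl | rfl
    · exact ⟨0, 0, by simp⟩
    · exact ⟨ζ, u, by simp⟩

theorem tate_surj (ξ : Z ⊗[ZMod 2] Z) (h : sw Z ξ = ξ) : ∃ ζ u, ξ = ζ ⊗ₜ ζ + (u + sw Z u) := by
  classical
  let b := Module.Basis.ofVectorSpace (ZMod 2) Z
  let bb := b.tensorProduct b
  let I := Module.Basis.ofVectorSpaceIndex (ZMod 2) Z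
  letI : LinearOrder I := linearOrderOfSTO WellOrderingRel
  let U : Z ⊗[ZMod 2] Z →ₗ[ZMod 2] Z ⊗[ZMod 2] Z :=
    bb.constr (ZMod 2) (fun p : I × I => if p.1 < p.2 then b p.1 ⊗ₜ b p.2 else 0)
  let Dg : Z ⊗[ZMod 2] Z →ₗ[ZMod 2] Z ⊗[ZMod 2] Z :=
    bb.constr (ZMod 2) (fun p : I × I => if p.1 = p.2 then b p.1 ⊗ₜ b p.2 else 0)
  have hU : ∀ i j : I, U (b i ⊗ₜ b j) = if i < j then b i ⊗ₜ b j else 0 := by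
    intro i j
    have : (b i ⊗ₜ[ZMod 2] b j) = bb (i, j) := by simp [bb]
    conv_lhs => rw [this]
    rw [Module.Basis.constr_basis]
  have hDg : ∀ i j : I, Dg (b i ⊗ₜ b j) = if i = j then b i ⊗ₜ b j else 0 := by
    intro i j
    have : (b i ⊗ₜ[ZMod 2] b j) = bb (i, j) := by simp [bb]
    conv_lhs => rw [this]
    rw [Module.Basis.constr_basis]
  have key : LinearMap.id = Dg + (U + (sw Z).comp (U.comp (sw Z))) := by
    refine bb.ext fun p => ?_
    obtain ⟨i, j⟩ := p
    have : bb (i, j) = (b i ⊗ₜ[ZMod 2] b j)  := by simp [bb]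
    rw [this]
    simp only [LinearMap.add_apply, LinearMap.comp_apply, sw_tmul, hU, hDg, LinearMap.id_apply]
    rcases lt_trichotomy i j with h | h | h
    · simp [h, h.ne, h.not_gt]
    · subst h; simp
    · simp [h, h.ne', h.not_gt, sw_tmul]
  have hD : Dg ξ ∈ SqSub Z := by
    have : (SqSub Z).mkQ.comp Dg = 0 := by
      refine bb.ext fun p => ?_
      obtain ⟨i, j⟩ := p
      have : bb (i, j) = (b i ⊗ₜ[ZMod 2] b j)  := by simp [bb]
      rw [this]
      simp only [LinearMap.comp_apply, hDg, LinearMap.zero_apply, Submodule.mkQ_apply, Submodule.Quotient.mk_eq_zero]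
      split_ifs with h
      · subst h; exact ⟨b i, 0, by simp⟩
      · exact Submodule.zero_mem _
    have := LinearMap.congr_fun this ξ
    simpa using this
  have hk := LinearMap.congr_fun key ξ
  simp only [LinearMap.add_apply, LinearMap.comp_apply, LinearMap.id_apply, h] at hk
  have : ξ ∈ SqSub Z := by
    rw [hk]
    exact Submodule.add_mem _ hD ⟨0, U ξ, by simp⟩
  exact this
end Tate


/-- Module data for the explicit model. -/
structure MD (P N : ℕ) (M : Type) [AddCommGroup M] [Module (ZMod 2) M] where
  d : M →ₗ[ZMod 2] M
  l : ℕ → M →ₗ[ZMod 2] M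
  r : ℕ → M →ₗ[ZMod 2] M
  hP : 0 < P
  hN : N + 1 = 2 * P
  dd : ∀ m, d (d m) = 0
  dl : ∀ i m, d (l i m) = l i (d m)
  dr : ∀ i m, d (r i m) = r i (d m)
  lr : ∀ i j m, l i (r j m) = r j (l i m)
  ll : ∀ i m, l i (l (i + 1) m) = 0
  rr : ∀ i m, r (i + 1) (r i m) = 0
  l0 : ∀ i, N ≤ i → ∀ m, l i m = 0
  r0 : ∀ i, N ≤ i → ∀ m, r i m = 0

def cl (P : ℕ) (i j : ℕ) : ℕ × ℕ := if i = j then (i % P, i % P) else (i, j)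

section
variable {M : Type} [AddCommGroup M] [Module (ZMod 2) M] {X : Type} [AddCommGroup X] [Module (ZMod 2) X]

/-- bilinear map out of finsupps -/
def bi (f : ℕ × ℕ → ℕ × ℕ → (M →ₗ[ZMod 2] M →ₗ[ZMod 2] X)) :
    (ℕ × ℕ →₀ M) ⊗[ZMod 2] (ℕ × ℕ →₀ M) →ₗ[ZMod 2] X :=
  TensorProduct.lift (Finsupp.lsum (ZMod 2) (fun w => LinearMap.flip (Finsupp.lsum (ZMod 2) (fun w' => (f w w').flip))))

theorem bi_single (f : ℕ × ℕ → ℕ × ℕ → (M →ₗ[ZMod 2] M →ₗ[ZMod 2] X)) (w w' m m') :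
    bi f (Finsupp.single w m ⊗ₜ Finsupp.single w' m') = f w w' m m' := by
  simp [bi]

theorem ZZext {f g : (ℕ × ℕ →₀ M) ⊗[ZMod 2] (ℕ × ℕ →₀ M) →ₗ[ZMod 2] X}
    (h : ∀ a b m a' b' m', f (Finsupp.single (a, b) m ⊗ₜ Finsupp.single (a', b') m') =
      g (Finsupp.single (a, b) m ⊗ₜ Finsupp.single (a', b') m')) : f = g := by
  apply TensorProduct.ext
  apply Finsupp.lhom_ext
  rintro ⟨a, b⟩ m
  apply Finsupp.lhom_ext
  rintro ⟨a', b'⟩ m'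
  exact h a b m a' b' m'
end

namespace MD
variable {P N : ℕ} {M : Type} [AddCommGroup M] [Module (ZMod 2) M] (K : MD P N M)

local notation "ZM" => (ℕ × ℕ →₀ M)
local notation "Sg" => Finsupp.single (M := M)

/-- `single w ⊗ single w'` as a bilinear map -/
def mk2 (w w' : ℕ × ℕ) (f g : M →ₗ[ZMod 2] M) : M →ₗ[ZMod 2] M →ₗ[ZMod 2] (ZM ⊗[ZMod 2] ZM) :=
  (TensorProduct.mk (ZMod 2) ZM ZM).compl₁₂ ((Finsupp.lsingle w) ∘ₗ f) ((Finsupp.lsingle w') ∘ₗ g)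

theorem mk2_apply (w w' : ℕ × ℕ) (f g : M →ₗ[ZMod 2] M) (m m' : M) :
    mk2 w w' f g m m' = Sg w (f m) ⊗ₜ[ZMod 2] Sg w' (g m') := by simp [mk2]

/-- half of the differential of the model -/
def D1 : ZM ⊗[ZMod 2] ZM →ₗ[ZMod 2] ZM ⊗[ZMod 2] ZM :=
  bi (fun w w' => mk2 w w' K.d LinearMap.id +
    (if w.1 < w.2 then mk2 (cl P w.1 (w.2 - 1)) w' (K.l (w.2 - 1)) LinearMap.id +
      mk2 (cl P (w.1 + 1) w.2) w' LinearMap.id (K.r w.1) else 0))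

def D2 : ZM ⊗[ZMod 2] ZM →ₗ[ZMod 2] ZM ⊗[ZMod 2] ZM :=
  bi (fun w w' => mk2 w w' LinearMap.id K.d +
    (if w'.1 < w'.2 then mk2 w (cl P w'.1 (w'.2 - 1)) LinearMap.id (K.l (w'.2 - 1)) +
      mk2 w (cl P (w'.1 + 1) w'.2) (K.r w'.1) LinearMap.id else 0))

def dX : ZM ⊗[ZMod 2] ZM →ₗ[ZMod 2] ZM ⊗[ZMod 2] ZM := K.D1 + K.D2

theorem D1_s (a b m a' b' m') : K.D1 (Sg (a, b) m ⊗ₜ Sg (a', b') m') = Sg (a, b) (K.d m) ⊗ₜ Sg (a', b') m' +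
    if a < b then Sg (cl P a (b - 1)) (K.l (b - 1) m) ⊗ₜ Sg (a', b') m' +
      Sg (cl P (a + 1) b) m ⊗ₜ Sg (a', b') (K.r a m') else 0 := by
  rw [D1, bi_single]
  split_ifs <;> simp [mk2_apply]

theorem D2_s (a b m a' b' m') : K.D2 (Sg (a, b) m ⊗ₜ Sg (a', b') m') = Sg (a, b) m ⊗ₜ Sg (a', b') (K.d m') +
    if a' < b' then Sg (a, b) m ⊗ₜ Sg (cl P a' (b' - 1)) (K.l (b' - 1) m') +
      Sg (a, b) (K.r a' m) ⊗ₜ Sg (cl P (a' + 1) b') m' else 0 := by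
  rw [D2, bi_single]
  split_ifs <;> simp [mk2_apply]

theorem sw_D1 (x) : sw ZM (K.D1 x) = K.D2 (sw ZM x) := by
  have : (sw ZM).comp K.D1 = K.D2.comp (sw ZM) := by
    apply ZZext
    intro a b m a' b' m'
    simp only [LinearMap.comp_apply, sw_tmul, D1_s, D2_s]
    split_ifs <;> simp [sw_tmul]
  exact LinearMap.congr_fun this x

theorem sw_D2 (x) : sw ZM (K.D2 x) = K.D1 (sw ZM x) := by
  conv_lhs => rw [← sw_sw x]
  rw [← sw_D1, sw_sw]

theorem sw_dX (x) : sw ZM (K.dX x) = K.dX (sw ZM x) := by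
  simp only [dX, LinearMap.add_apply, map_add, sw_D1, sw_D2, add_comm]

theorem D1_diag (v m y) : K.D1 (Sg (v, v) m ⊗ₜ y) = Sg (v, v) (K.d m) ⊗ₜ y := by
  have : K.D1.comp (TensorProduct.mk _ ZM ZM (Sg (v, v) m)) = TensorProduct.mk _ ZM ZM (Sg (v, v) (K.d m)) := by
    apply Finsupp.lhom_ext
    rintro ⟨a', b'⟩ m'
    simp [D1_s]
  exact LinearMap.congr_fun this y

theorem cl_self (v) : cl P v v = (v % P, v % P) := by simp [cl]
theorem cl_ne {i j} (h : i ≠ j) : cl P i j = (i, j) := by simp [cl, h]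

theorem D1_cl (i j m a' b' m') (h : i ≤ j) : K.D1 (Sg (cl P i j) m ⊗ₜ Sg (a', b') m') =
    Sg (cl P i j) (K.d m) ⊗ₜ Sg (a', b') m' +
    if i < j then Sg (cl P i (j - 1)) (K.l (j - 1) m) ⊗ₜ Sg (a', b') m' +
      Sg (cl P (i + 1) j) m ⊗ₜ Sg (a', b') (K.r i m') else 0 := by
  rcases h.eq_or_lt with rfl | h
  · simp [cl_self, D1_s]
  · rw [cl_ne h.ne, D1_s]

theorem D1_clw (i j m w' m') (h : i ≤ j) : K.D1 (Sg (cl P i j) m ⊗ₜ Sg w' m') =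
    Sg (cl P i j) (K.d m) ⊗ₜ Sg w' m' +
    if i < j then Sg (cl P i (j - 1)) (K.l (j - 1) m) ⊗ₜ Sg w' m' +
      Sg (cl P (i + 1) j) m ⊗ₜ Sg w' (K.r i m') else 0 := K.D1_cl i j m w'.1 w'.2 m' h

theorem D2_clw (i j m w' m') (h : i ≤ j) : K.D2 (Sg w' m' ⊗ₜ Sg (cl P i j) m) =
    Sg w' m' ⊗ₜ Sg (cl P i j) (K.d m) +
    if i < j then Sg w' m' ⊗ₜ Sg (cl P i (j - 1)) (K.l (j - 1) m) +
       Sg w' (K.r i m') ⊗ₜ Sg (cl P (i + 1) j) m else 0 := by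
  rw [← sw_tmul, ← sw_D1, D1_clw _ _ _ _ _ _ h]
  split_ifs <;> simp [sw_tmul]

theorem D1D1 (x) : K.D1 (K.D1 x) = 0 := by
  have : K.D1.comp K.D1 = 0 := by
    apply ZZext
    intro a b m a' b' m'
    simp only [LinearMap.comp_apply, LinearMap.zero_apply]
    rw [D1_s]
    by_cases h : a < b
    · rw [if_pos h, map_add, map_add, D1_clw _ _ _ _ _ _ (by omega), D1_clw _ _ _ _ _ _ (by omega), D1_s, if_pos h]
      by_cases h2 : a + 1 < b
      · rw [if_pos (by omega), if_pos h2]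
        have e : b - 1 = b - 1 - 1 + 1 := by omega
        have e2 : K.l (b - 1 - 1) (K.l (b - 1) m) = 0 := by
          conv_lhs => rw [e]
          exact K.ll _ _
        rw [e2, K.dl, K.dd, K.rr]
        simp
        abel_nf; simp [c2z]
      · rw [if_neg (by omega), if_neg h2]
        rw [K.dl, K.dd]
        simp
        abel_nf; simp [c2z]
    · rw [if_neg h, add_zero, D1_s, if_neg h, K.dd]; simp
  exact LinearMap.congr_fun this x

theorem D2D2 (x) : K.D2 (K.D2 x) = 0 := by
  rw [← sw_sw x, ← sw_D1, ← sw_D1, D1D1, map_zero]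

theorem D1D2 (x) : K.D1 (K.D2 x) = K.D2 (K.D1 x) := by
  have : K.D1.comp K.D2 = K.D2.comp K.D1 := by
    apply ZZext
    intro a b m a' b' m'
    simp only [LinearMap.comp_apply]
    rw [D1_s, D2_s]
    by_cases h : a < b <;> by_cases h' : a' < b'
    · rw [if_pos h, if_pos h']
      simp only [map_add]
      conv_lhs => rw [D1_s, ← cl_ne h.ne, D1_clw _ _ _ _ _ _ h.le, D1_clw _ _ _ _ _ _ h.le, if_pos h, if_pos h, if_pos h]
      conv_rhs => rw [D2_s, ← cl_ne h'.ne, D2_clw _ _ _ _ _ _ h'.le, D2_clw _ _ _ _ _ _ h'.le, if_pos h', if_pos h', if_pos h']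
      rw [cl_ne h.ne, cl_ne h'.ne]
      simp only [K.dl, K.dr, K.lr]
      abel
    · rw [if_pos h, if_neg h']
      simp only [map_add, add_zero, map_zero, D1_s, D2_s, if_pos h, if_neg h']
      have := fun w m => K.D2_s (Prod.fst w) (Prod.snd w) m a' b'
      simp only [Prod.mk.eta, if_neg h', add_zero] at this
      rw [this, this]
      simp only [K.dl, K.dr, K.lr]
    · rw [if_neg h, if_pos h']
      simp only [map_add, add_zero, map_zero, D1_s, D2_s, if_neg h, if_pos h']
      have := fun w m m' => K.D1_s a b m (Prod.fst w) (Prod.snd w) m'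
      simp only [Prod.mk.eta, if_neg h, add_zero] at this
      rw [this, this]
      simp only [K.dl, K.dr, K.lr]
    · simp [h, h', D1_s, D2_s]
  exact LinearMap.congr_fun this x

theorem dXdX (x) : K.dX (K.dX x) = 0 := by
  simp only [dX, LinearMap.add_apply, map_add, D1D1, D2D2, D1D2, zero_add, add_zero, c2]

theorem dX_sq (η : ZM) : ∃ v, K.dX (η ⊗ₜ η) = v + sw ZM v :=
  ⟨K.D1 (η ⊗ₜ η), by rw [sw_D1, sw_tmul]; rfl⟩

/-- unrolled matrices -/
def del : ZM →ₗ[ZMod 2] ZM :=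
  Finsupp.lsum (ZMod 2) (fun w => (Finsupp.lsingle w) ∘ₗ K.d +
    (if 1 ≤ w.2 then (Finsupp.lsingle (w.1, w.2 - 1)) ∘ₗ K.l (w.2 - 1) else 0) +
    (Finsupp.lsingle (w.1 + 1, w.2)) ∘ₗ K.r w.1)

theorem del_s (i j m) : K.del (Sg (i, j) m) = Sg (i, j) (K.d m) +
    (if 1 ≤ j then Sg (i, j - 1) (K.l (j - 1) m) else 0) + Sg (i + 1, j) (K.r i m) := by
  simp only [del, Finsupp.lsum_single]
  split_ifs <;> simp

theorem del_del (x) : K.del (K.del x) = 0 := by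
  have : K.del.comp K.del = 0 := by
    apply Finsupp.lhom_ext
    rintro ⟨i, j⟩ m
    simp only [LinearMap.comp_apply, LinearMap.zero_apply]
    rw [del_s, map_add, map_add]
    by_cases h : 1 ≤ j
    · rw [if_pos h, del_s, del_s, del_s, if_pos h, if_pos h]
      by_cases h2 : 1 ≤ j - 1
      · rw [if_pos h2]
        have e : j - 1 = j - 1 - 1 + 1 := by omega
        have e2 : K.l (j - 1 - 1) (K.l (j - 1) m) = 0 := by
          conv_lhs => rw [e]
          exact K.ll _ _
        rw [e2, K.rr, K.dd, K.dl, K.dr, K.lr]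
        simp; abel_nf; simp [c2z]
      · rw [if_neg h2, K.rr, K.dd, K.dl, K.dr, K.lr]
        simp; abel_nf; simp [c2z]
    · rw [if_neg h, del_s, map_zero, del_s, if_neg h, if_neg h, K.rr, K.dd, K.dr]
      simp [c2]
  exact LinearMap.congr_fun this x

def Psi (P : ℕ) : ZM ⊗[ZMod 2] ZM →ₗ[ZMod 2] ZM ⊗[ZMod 2] ZM :=
  bi (fun w w' => if w'.1 ≤ w.2 ∧ w.1 ≤ w'.2 then
    mk2 (cl P w'.1 w.2) (cl P w.1 w'.2) LinearMap.id LinearMap.id else 0)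

theorem Psi_s (i' j m i j' m') : Psi P (Sg (i', j) m ⊗ₜ Sg (i, j') m') =
    if i ≤ j ∧ i' ≤ j' then Sg (cl P i j) m ⊗ₜ[ZMod 2] Sg (cl P i' j') m' else 0 := by
  rw [Psi, bi_single]
  split_ifs <;> simp [mk2_apply]

theorem sw_Psi (x) : sw ZM (Psi P x) = Psi P (sw ZM x) := by
  have : (sw ZM).comp (Psi P) = (Psi P).comp (sw ZM) := by
    apply ZZext
    intro a b m a' b' m'
    simp only [LinearMap.comp_apply, sw_tmul, Psi_s]
    have e : (a' ≤ b ∧ a ≤ b') ↔ (a ≤ b' ∧ a' ≤ b) := and_comm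
    simp only [e]
    split_ifs <;> simp [sw_tmul]
  exact LinearMap.congr_fun this x

theorem Psi_chain (x y : ZM) : Psi P (K.del x ⊗ₜ y) + Psi P (x ⊗ₜ K.del y) = K.dX (Psi P (x ⊗ₜ y)) := by
  have : (Psi P).comp (TensorProduct.map K.del LinearMap.id) + (Psi P).comp (TensorProduct.map LinearMap.id K.del)
      = K.dX.comp (Psi P) := by
    apply ZZext
    intro i' j m i j' m'
    simp only [LinearMap.comp_apply, LinearMap.add_apply, TensorProduct.map_tmul, LinearMap.id_apply, del_s]
    rw [Psi_s]
    by_cases h : i ≤ j ∧ i' ≤ j'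
    · rw [if_pos h, dX, LinearMap.add_apply, D1_clw _ _ _ _ _ _ h.1, D2_clw _ _ _ _ _ _ h.2]
      simp only [add_tmul, tmul_add, map_add, Psi_s, if_pos h]
      have e1 : (Psi P ((if 1 ≤ j then Sg (i', j - 1) (K.l (j - 1) m) else 0) ⊗ₜ[ZMod 2] Sg (i, j') m')) =
          if i < j then Sg (cl P i (j - 1)) (K.l (j - 1) m) ⊗ₜ[ZMod 2] Sg (cl P i' j') m' else 0 := by
        by_cases hj : i < j
        · rw [if_pos hj, if_pos (by omega), Psi_s, if_pos (by omega)]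
        · rw [if_neg hj]
          split_ifs with h3
          · rw [Psi_s, if_neg (by omega)]
          · simp
      have e2 : (Psi P (Sg (i', j) m ⊗ₜ[ZMod 2] (if 1 ≤ j' then Sg (i, j' - 1) (K.l (j' - 1) m') else 0))) =
          if i' < j' then Sg (cl P i j) m ⊗ₜ[ZMod 2] Sg (cl P i' (j' - 1)) (K.l (j' - 1) m') else 0 := by
        by_cases hj : i' < j'
        · rw [if_pos hj, if_pos (by omega), Psi_s, if_pos (by omega)]
        · rw [if_neg hj]
          split_ifs with h3
          · rw [Psi_s, if_neg (by omega)]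
          · simp
      rw [e1, e2]
      have h1 : (i ≤ j ∧ i' + 1 ≤ j') ↔ i' < j' := by omega
      have h2 : (i + 1 ≤ j ∧ i' ≤ j') ↔ i < j := by omega
      simp only [h1, h2]
      split_ifs <;> abel
    · rw [if_neg h, map_zero]
      simp only [add_tmul, tmul_add, map_add, Psi_s, if_neg h]
      have e1 : (Psi P ((if 1 ≤ j then Sg (i', j - 1) (K.l (j - 1) m) else 0) ⊗ₜ[ZMod 2] Sg (i, j') m')) = 0 := by
          split_ifs with h3
          · rw [Psi_s, if_neg (by omega)]
          · simp
      have e2 : (Psi P (Sg (i', j) m ⊗ₜ[ZMod 2] (if 1 ≤ j' then Sg (i, j' - 1) (K.l (j' - 1) m') else 0))) = 0 := by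
          split_ifs with h3
          · rw [Psi_s, if_neg (by omega)]
          · simp
      rw [e1, e2, if_neg (by omega), if_neg (by omega)]
      simp
  have h := LinearMap.congr_fun this (x ⊗ₜ y)
  simpa using h

end MD

namespace MD
variable {P N : ℕ} {M : Type} [AddCommGroup M] [Module (ZMod 2) M] (K : MD P N M)

local notation "ZM" => (ℕ × ℕ →₀ M)
local notation "Sg" => Finsupp.single (M := M)

theorem Zext {X : Type} [AddCommGroup X] [Module (ZMod 2) X] {f g : ZM →ₗ[ZMod 2] X}
    (h : ∀ a b m, f (Sg (a, b) m) = g (Sg (a, b) m)) : f = g := by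
  apply Finsupp.lhom_ext
  rintro ⟨a, b⟩ m
  exact h a b m

/-- restriction to words satisfying a predicate -/
def Fl (p : ℕ × ℕ → Prop) [DecidablePred p] : ZM →ₗ[ZMod 2] ZM :=
  Finsupp.lsum (ZMod 2) (fun w => if p w then Finsupp.lsingle w else 0)

theorem Fl_s (p : ℕ × ℕ → Prop) [DecidablePred p] (w m) : Fl p (Sg w m) = if p w then Sg w m else 0 := by
  simp only [Fl, Finsupp.lsum_single]; split_ifs <;> simp

theorem Fl_apply (p : ℕ × ℕ → Prop) [DecidablePred p] (x : ZM) (w) : (Fl p x) w = if p w then x w else 0 := by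
  induction x using Finsupp.induction_linear with
  | zero => simp
  | add f g hf hg => rw [map_add, Finsupp.add_apply, hf, hg]; split_ifs <;> simp
  | single v m =>
    rw [Fl_s]
    by_cases h : v = w
    · subst h; split_ifs <;> simp
    · split_ifs <;> simp [Finsupp.single_apply, h]

/-- closing up of words -/
def sg (P : ℕ) : ZM →ₗ[ZMod 2] ZM :=
  Finsupp.lsum (ZMod 2) (fun w => if w.1 ≤ w.2 then Finsupp.lsingle (cl P w.1 w.2) else 0)

theorem sg_s (i j m) : sg P (Sg (i, j) m) = if i ≤ j then Sg (cl P i j) m else 0 := by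
  simp only [sg, Finsupp.lsum_single]; split_ifs <;> simp

/-- the image of the norm `1 + τ` -/
def trc (Z : Type) [AddCommGroup Z] [Module (ZMod 2) Z] : Submodule (ZMod 2) (Z ⊗[ZMod 2] Z) :=
  LinearMap.range (LinearMap.id + sw Z)

theorem trc_mem {Z : Type} [AddCommGroup Z] [Module (ZMod 2) Z] (u : Z ⊗[ZMod 2] Z) : u + sw Z u ∈ trc Z :=
  ⟨u, rfl⟩

theorem sg_Psi (x : ZM) : Psi P (x ⊗ₜ x) + sg P x ⊗ₜ sg P x ∈ trc ZM := by
  induction x using Finsupp.induction_linear with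
  | zero => simp
  | add f g hf hg =>
    have e : Psi P ((f + g) ⊗ₜ (f + g)) + sg P (f + g) ⊗ₜ sg P (f + g) =
        (Psi P (f ⊗ₜ f) + sg P f ⊗ₜ sg P f) + (Psi P (g ⊗ₜ g) + sg P g ⊗ₜ sg P g) +
        (Psi P (f ⊗ₜ g) + sw ZM (Psi P (f ⊗ₜ g))) + (sg P f ⊗ₜ sg P g + sw ZM (sg P f ⊗ₜ sg P g)) := by
      rw [sw_Psi, sw_tmul, sw_tmul]
      simp only [map_add, tmul_add, add_tmul]
      abel
    rw [e]
    exact add_mem (add_mem (add_mem hf hg) (trc_mem _)) (trc_mem _)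
  | single w m =>
    obtain ⟨i, j⟩ := w
    rw [Psi_s, sg_s]
    by_cases h : i ≤ j
    · simp [h, c2]
    · simp [h]

theorem sg_lt (x : ZM) (i j) (h : i < j) : sg P x (i, j) = x (i, j) := by
  induction x using Finsupp.induction_linear with
  | zero => simp
  | add f g hf hg => rw [map_add, Finsupp.add_apply, hf, hg]; simp
  | single w m =>
    obtain ⟨a, b⟩ := w
    rw [sg_s]
    by_cases h1 : a = b
    · subst h1
      simp only [le_refl, if_true, cl_self, Finsupp.single_apply, Prod.mk.injEq]
      rw [if_neg (by omega), if_neg (by omega)]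
    · rw [cl_ne h1]
      split_ifs with h2
      · rfl
      · simp only [Finsupp.coe_zero, Pi.zero_apply, Finsupp.single_apply, Prod.mk.injEq]
        rw [if_neg (by omega)]

theorem sg_diag (x : ZM) (v) (h : v < P) :
    sg P (Fl (fun w => w.1 < 2 * P ∧ w.2 < 2 * P) x) (v, v) =
    (Fl (fun w => w.1 < 2 * P ∧ w.2 < 2 * P) x) (v, v) + (Fl (fun w => w.1 < 2 * P ∧ w.2 < 2 * P) x) (v + P, v + P) := by
  induction x using Finsupp.induction_linear with
  | zero => simp
  | add f g hf hg => simp only [map_add, Finsupp.add_apply, hf, hg]; abel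
  | single w m =>
    obtain ⟨a, b⟩ := w
    rw [Fl_s]
    split_ifs with h0
    · rw [sg_s]
      simp only at h0
      by_cases h1 : a = b
      · subst h1
        simp only [le_refl, if_true, cl_self, Finsupp.single_apply, Prod.mk.injEq, and_self]
        by_cases h3 : a < P
        · rw [Nat.mod_eq_of_lt h3, if_neg (show ¬ a = v + P by omega)]; simp
        · have : a % P = a - P := by
            rw [Nat.mod_eq_sub_mod (by omega), Nat.mod_eq_of_lt (by omega)]
          rw [this, if_neg (show ¬ a = v by omega), zero_add]
          congr 1
          apply propext; omega
      · rw [cl_ne h1]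
        have : ∀ c, (Sg (a, b) m) (c, c) = 0 := by
          intro c
          simp only [Finsupp.single_apply, Prod.mk.injEq]
          rw [if_neg (by omega)]
        rw [this, this]
        split_ifs <;> simp [this]
    · simp

theorem Psi_FF (x y : ZM) : Psi P (Fl (fun w => w.2 < w.1) x ⊗ₜ Fl (fun w => w.2 < w.1) y) = 0 := by
  have : (Psi P).comp (TensorProduct.map (Fl (M := M) (fun w => w.2 < w.1)) (Fl (fun w => w.2 < w.1))) = 0 := by
    apply ZZext
    intro a b m a' b' m'
    simp only [LinearMap.comp_apply, TensorProduct.map_tmul, Fl_s, LinearMap.zero_apply]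
    split_ifs <;> simp [Psi_s]
    intros; omega
  exact LinearMap.congr_fun this (x ⊗ₜ y)

theorem Psi_FD (x : ZM) (n m) : Psi P (Fl (fun w => w.2 < w.1) x ⊗ₜ Sg (n, n) m) = 0 := by
  have : (Psi P).comp ((TensorProduct.mk (ZMod 2) ZM ZM).flip (Sg (n, n) m) ∘ₗ (Fl (M := M) (fun w => w.2 < w.1))) = 0 := by
    apply Zext
    intro a b m
    simp only [LinearMap.comp_apply, Fl_s, LinearMap.zero_apply]
    split_ifs <;> simp [Psi_s]
    intros; omega
  exact LinearMap.congr_fun this x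

theorem Psi_DF (x : ZM) (n m) : Psi P (Sg (n, n) m ⊗ₜ Fl (fun w => w.2 < w.1) x) = 0 := by
  rw [← sw_tmul, ← sw_Psi, Psi_FD, map_zero]

theorem Psi_van (hP : 0 < P) (x : ZM) (h0 : sg P x = 0) (hs : Fl (fun w => w.1 < 2 * P ∧ w.2 < 2 * P) x = x) :
    Psi P (x ⊗ₜ x) = 0 := by
  have hd : ∀ v, v < P → x (v + P, v + P) = x (v, v) := by
    intro v hv
    have := sg_diag x v hv
    rw [hs, h0] at this
    exact (c2eq (by rw [add_comm, ← this]; rfl))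
  have hu : ∀ n, 2 * P ≤ n → x (n, n) = 0 := by
    intro n hn
    rw [← hs, Fl_apply, if_neg (by simp; omega)]
  let β : ℕ → ZM := fun v => Sg (v, v) (x (v, v)) + Sg (v + P, v + P) (x (v, v))
  let lam : ZM := x + ∑ v ∈ Finset.range P, β v
  have hl : Fl (fun w => w.2 < w.1) lam = lam := by
    ext ⟨i, j⟩
    rw [Fl_apply]
    split_ifs with h
    · rfl
    simp only [not_lt] at h
    symm
    simp only [lam, β, Finsupp.add_apply, Finsupp.finsetSum_apply, Finsupp.single_apply, Prod.mk.injEq]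
    rcases h.eq_or_lt with rfl | h
    · simp only [and_self]
      by_cases h1 : i < P
      · rw [Finset.sum_eq_single i]
        · rw [if_pos rfl, if_neg (by omega), add_zero, c2]
        · intro b hb hbi
          rw [Finset.mem_range] at hb
          rw [if_neg hbi, if_neg (by omega), add_zero]
        · simp [h1]
      · by_cases h2 : i < 2 * P
        · rw [Finset.sum_eq_single (i - P)]
          · rw [if_neg (by omega), if_pos (by omega), zero_add]
            have := hd (i - P) (by omega)
            rw [Nat.sub_add_cancel (by omega)] at this
            rw [this, c2]
          · intro b hb hbi
            rw [Finset.mem_range] at hb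
            rw [if_neg (by omega), if_neg (by omega), add_zero]
          · intro h; exfalso; apply h; rw [Finset.mem_range]; omega
        · rw [hu i (by omega), Finset.sum_eq_zero, add_zero]
          intro b hb
          rw [Finset.mem_range] at hb
          rw [if_neg (by omega), if_neg (by omega), add_zero]
    · rw [← sg_lt (P := P) x i j h, h0, Finset.sum_eq_zero, add_zero]
      · rfl
      · intro b hb
        rw [if_neg (by omega), if_neg (by omega), add_zero]
  have hx : x = lam + ∑ v ∈ Finset.range P, β v := by
    simp only [lam, add_assoc, c2, add_zero]
  have hlb : ∀ v, Psi P (lam ⊗ₜ β v) = 0 := by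
    intro v; rw [← hl]; simp only [β, tmul_add, map_add, Psi_FD, add_zero]
  have hbl : ∀ v, Psi P (β v ⊗ₜ lam) = 0 := by
    intro v; rw [← hl]; simp only [β, add_tmul, map_add, Psi_DF, add_zero]
  have hbb : ∀ v ∈ Finset.range P, ∀ v' ∈ Finset.range P, Psi P (β v ⊗ₜ β v') = 0 := by
    intro v hv v' hv'
    rw [Finset.mem_range] at hv hv'
    simp only [β, add_tmul, tmul_add, map_add, Psi_s]
    by_cases h : v = v'
    · subst h
      rw [if_pos (by omega), if_neg (by omega), if_neg (by omega), if_pos (by omega)]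
      simp only [cl_self, Nat.add_mod_right, zero_add, add_zero, c2]
    · rw [if_neg (by omega), if_neg (by omega), if_neg (by omega), if_neg (by omega)]
      simp
  have e1 : Psi P (lam ⊗ₜ[ZMod 2] lam) = 0 := by rw [← hl]; exact Psi_FF _ _
  clear_value lam β
  rw [hx, tmul_add, add_tmul, add_tmul, map_add, map_add, map_add]
  rw [e1, TensorProduct.tmul_sum, TensorProduct.sum_tmul, map_sum, map_sum]
  rw [Finset.sum_eq_zero (fun v _ => hbl v), Finset.sum_eq_zero (fun v _ => hlb v)]
  rw [TensorProduct.tmul_sum, map_sum, Finset.sum_eq_zero, ]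
  · simp
  intro v' hv'
  rw [TensorProduct.sum_tmul, map_sum, Finset.sum_eq_zero]
  intro v hv
  exact hbb v hv v' hv'

def valid (P N : ℕ) (w : ℕ × ℕ) : Prop := (w.1 < w.2 ∧ w.2 ≤ N) ∨ (w.1 = w.2 ∧ w.1 < P)

instance (P N : ℕ) : DecidablePred (valid P N) := fun w => by unfold valid; infer_instance

theorem sg_valid (x : ZM) : sg P (Fl (valid P N) x) = Fl (valid P N) x := by
  have : (sg P).comp (Fl (M := M) (valid P N)) = Fl (valid P N) := by
    apply Zext
    intro a b m
    rw [LinearMap.comp_apply, Fl_s]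
    split_ifs with h
    · rw [sg_s]
      rcases h with h | h
      · rw [if_pos (by simp at h; omega), cl_ne (by simp at h; omega)]
      · simp only at h
        obtain ⟨rfl, h⟩ := h
        simp [cl_self, Nat.mod_eq_of_lt h]
    · simp
  exact LinearMap.congr_fun this x

theorem del_box (x : ZM) : Fl (fun w => w.1 < 2 * P ∧ w.2 < 2 * P) (K.del (Fl (valid P N) x)) =
    K.del (Fl (valid P N) x) := by
  have hN := K.hN
  have : (Fl (fun w => w.1 < 2 * P ∧ w.2 < 2 * P)).comp (K.del.comp (Fl (M := M) (valid P N))) =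
      K.del.comp (Fl (valid P N)) := by
    apply Zext
    intro a b m
    simp only [LinearMap.comp_apply, Fl_s]
    split_ifs with h
    · have h' : a + 1 < 2 * P ∧ b < 2 * P := by
        rcases h with h | h <;> simp only at h <;> omega
      rw [del_s, map_add, map_add, Fl_s, Fl_s, if_pos ⟨by simp; omega, h'.2⟩, if_pos h']
      split_ifs
      · rw [Fl_s, if_pos ⟨by simp; omega, by simp; omega⟩]
      · simp
    · simp
  exact LinearMap.congr_fun this x

theorem X_claim (w0 w1 w2 : ZM ⊗[ZMod 2] ZM)
    (hE : TensorProduct.map (Fl (valid P N)) (Fl (valid P N)) w0 = w0)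
    (h0 : sw ZM w0 = w0) (h1 : K.dX w0 = w1 + sw ZM w1) (h2 : K.dX w1 = w2 + sw ZM w2) :
    ∃ t0 t1 u, sw ZM t0 = t0 ∧ K.dX t0 = t1 + sw ZM t1 ∧ K.dX t1 = 0 ∧ w0 = t0 + (u + sw ZM u) := by
  obtain ⟨ζ0, u0, hw⟩ := tate_surj w0 h0
  obtain ⟨ζ, u1, hz, hw⟩ : ∃ ζ u, Fl (valid P N) ζ = ζ ∧ w0 = ζ ⊗ₜ ζ + (u + sw ZM u) := by
    refine ⟨Fl (valid P N) ζ0, TensorProduct.map (Fl (valid P N)) (Fl (valid P N)) u0, ?_, ?_⟩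
    · ext w; rw [Fl_apply, Fl_apply]; split_ifs <;> rfl
    · conv_lhs => rw [← hE, hw]
      simp only [map_add, TensorProduct.map_tmul]
      congr 2
      have : (TensorProduct.map (Fl (M := M) (valid P N)) (Fl (valid P N))).comp (sw ZM) =
        (sw ZM).comp (TensorProduct.map (Fl (valid P N)) (Fl (valid P N))) := by
        apply TensorProduct.ext'
        intro x y; simp
      exact LinearMap.congr_fun this u0
  have hsz : sg P ζ = ζ := by rw [← hz, sg_valid]
  obtain ⟨v, hv⟩ := sg_Psi (P := P) ζ
  rw [hsz] at hv
  simp only [LinearMap.add_apply, LinearMap.id_apply] at hv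
  set t0 := Psi P (ζ ⊗ₜ[ZMod 2] ζ) with ht0
  set t1 := Psi P (K.del ζ ⊗ₜ[ZMod 2] ζ) with ht1
  have hd0 : K.dX t0 = t1 + sw ZM t1 := by
    rw [ht0, ← Psi_chain, ht1, sw_Psi, sw_tmul]
  have hd1 : K.dX t1 = Psi P (K.del ζ ⊗ₜ K.del ζ) := by
    rw [ht1, ← Psi_chain, del_del, zero_tmul, map_zero, zero_add]
  have hwt : w0 = t0 + ((u1 + v) + sw ZM (u1 + v)) := by
    have e : t0 + ((u1 + v) + sw ZM (u1 + v)) = t0 + (v + sw ZM v) + (u1 + sw ZM u1) := by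
      rw [map_add]; abel
    rw [e, hv, hw, c2']
  refine ⟨t0, t1, u1 + v, by rw [ht0, sw_Psi, sw_tmul], hd0, ?_, hwt⟩
  set u := u1 + v
  have hs : sw ZM (w1 + t1 + K.dX u) = w1 + t1 + K.dX u := by
    have e : K.dX w0 = t1 + sw ZM t1 + (K.dX u + sw ZM (K.dX u)) := by
      rw [hwt, map_add, map_add, hd0, sw_dX]
    rw [h1] at e
    apply c2eq
    rw [map_add, map_add]
    have e2 : w1 + sw ZM w1 + (t1 + sw ZM t1 + (K.dX u + sw ZM (K.dX u))) = 0 := by rw [e, c2]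
    rw [← e2]; abel
  obtain ⟨η, q, hq⟩ := tate_surj _ hs
  have hm : K.dX t1 ∈ trc ZM := by
    have e : K.dX t1 = K.dX (w1 + t1 + K.dX u) + K.dX w1 := by
      rw [map_add, map_add, dXdX]; apply c2eq; abel_nf; simp [c2z]
    rw [e, h2, hq, map_add, map_add, ← sw_dX]
    obtain ⟨p, hp⟩ := K.dX_sq η
    rw [hp]
    exact add_mem (add_mem (trc_mem _) (trc_mem _)) (trc_mem _)
  rw [hd1] at hm ⊢
  have hm2 : sg P (K.del ζ) ⊗ₜ sg P (K.del ζ) ∈ trc ZM := by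
    have := add_mem hm (sg_Psi (P := P) (K.del ζ))
    rwa [c2'] at this
  obtain ⟨p, hp⟩ := hm2
  have hz0 : sg P (K.del ζ) = 0 := tate_inj _ p hp.symm
  apply Psi_van K.hP _ hz0
  rw [← hz, del_box]

end MD


/-- ungraded dg bimodules over an algebra with zero differential -/
structure UB (A : DGA (ZMod 2)) : Type 1 where
  V : Type
  [acg : AddCommGroup V]
  [mod : Module (ZMod 2) V]
  d : V →ₗ[ZMod 2] V
  dd : ∀ x, d (d x) = 0
  L : A.V →ₗ[ZMod 2] V →ₗ[ZMod 2] V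
  R : V →ₗ[ZMod 2] A.V →ₗ[ZMod 2] V
  L_one : ∀ m, L A.one m = m
  R_one : ∀ m, R m A.one = m
  L_mul : ∀ a b m, L (A.mul a b) m = L a (L b m)
  R_mul : ∀ m a b, R (R m a) b = R m (A.mul a b)
  LR : ∀ a m b, R (L a m) b = L a (R m b)
  dL : ∀ a m, d (L a m) = L a (d m)
  dR : ∀ m a, d (R m a) = R (d m) a

attribute [instance] UB.acg
attribute [instance 2000] UB.mod

section cell
variable {A : DGA (ZMod 2)}

/-- the sandwich map for ungraded bimodules -/
def UB.sand (E : UB A) (m : E.V) : A.V ⊗[ZMod 2] A.V →ₗ[ZMod 2] E.V :=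
  TensorProduct.lift (E.R ∘ₗ (E.L.flip m))

theorem UB.sand_tmul (E : UB A) (m : E.V) (a b) : E.sand m (a ⊗ₜ b) = E.R (E.L a m) b := by
  simp [UB.sand]

theorem sandT_tmul (C : DGBimod A) (m : C.V) (a b) : sandwichT C m (a ⊗ₜ b) = C.actR (C.actL a m) b := by
  simp [sandwichT, sandwich]

/-- Partial solutions. -/
def CQ (C : DGBimod A) (E : UB A) (E0 : Submodule (ZMod 2) E.V) (ν F : C.V →ₗ[ZMod 2] E.V) :
    Submodule (ZMod 2) C.V where
  carrier := {x | F x ∈ E0 ∧ (∀ a, F (C.actL a x) = E.L a (F x)) ∧ (∀ a, F (C.actR x a) = E.R (F x) a) ∧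
    E.d (F x) = F (C.d x) + ν x}
  add_mem' := by
    rintro x y ⟨h1, h2, h3, h4⟩ ⟨g1, g2, g3, g4⟩
    refine ⟨?_, ?_, ?_, ?_⟩
    · rw [map_add]; exact add_mem h1 g1
    · intro a; simp [h2, g2]
    · intro a; simp [h3, g3]
    · simp only [map_add, h4, g4]; abel
  zero_mem' := by simp
  smul_mem' := by
    rintro c x ⟨h1, h2, h3, h4⟩
    refine ⟨?_, ?_, ?_, ?_⟩
    · rw [map_smul]; exact Submodule.smul_mem _ _ h1
    · intro a; simp [h2]
    · intro a; simp [h3]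
    · simp only [map_smul, h4, smul_add]

theorem cell_step (hd : A.d = 0) (C : DGBimod A) (E : UB A) (E0 : Submodule (ZMod 2) E.V)
    (hL : ∀ a, ∀ x ∈ E0, E.L a x ∈ E0) (hR : ∀ a, ∀ x ∈ E0, E.R x a ∈ E0)
    (hac : ∀ x ∈ E0, E.d x = 0 → ∃ y ∈ E0, E.d y = x)
    (ν : C.V →ₗ[ZMod 2] E.V) (hν0 : ∀ x, ν x ∈ E0)
    (hνL : ∀ a x, ν (C.actL a x) = E.L a (ν x)) (hνR : ∀ x a, ν (C.actR x a) = E.R (ν x) a)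
    (hνd : ∀ x, ν (C.d x) = E.d (ν x))
    (S S' : Submodule (ZMod 2) C.V) (hSL : ∀ a, ∀ x ∈ S, C.actL a x ∈ S) (hSR : ∀ a, ∀ x ∈ S, C.actR x a ∈ S)
    (hS : IsFreeStep C S S') (F : C.V →ₗ[ZMod 2] E.V) (hF : S ≤ CQ C E E0 ν F)
    (hSd : ∀ x ∈ S, C.d x ∈ S) :
    ∃ F' : C.V →ₗ[ZMod 2] E.V, S' ≤ CQ C E E0 ν F' ∧ ∀ x ∈ S, F' x = F x := by
  classical
  obtain ⟨I, g, deg, hg, hgd, -, hgen, hfree⟩ := hS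
  have hch : ∀ i, ∃ f ∈ E0, E.d f = F (C.d (g i)) + ν (g i) := by
    intro i
    obtain ⟨h1, h2, h3, h4⟩ := hF (hgd i)
    apply hac
    · exact add_mem h1 (hν0 _)
    · rw [map_add, h4, C.d_d, map_zero, zero_add, hνd, c2]
  choose f hf0 hfd using hch
  let Θ1 : (I →₀ A.V ⊗[ZMod 2] A.V) →ₗ[ZMod 2] C.V := Finsupp.lsum (ZMod 2) (fun i => sandwichT C (g i))
  let Ξ1 : (I →₀ A.V ⊗[ZMod 2] A.V) →ₗ[ZMod 2] E.V := Finsupp.lsum (ZMod 2) (fun i => E.sand (f i))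
  let Θ : (I →₀ A.V ⊗[ZMod 2] A.V) × S →ₗ[ZMod 2] C.V := Θ1.coprod S.subtype
  have hinj : Function.Injective Θ := by
    rw [← LinearMap.ker_eq_bot, LinearMap.ker_eq_bot']
    rintro ⟨c, x⟩ h
    have h1 : Θ1 c + (x : C.V) = 0 := by simpa [Θ] using h
    have h2 : Θ1 c = x := c2eq h1
    have h3 : Θ1 c = ∑ i ∈ c.support, sandwichT C (g i) (c i) := by
      simp [Θ1, Finsupp.lsum_apply, Finsupp.sum]
    have h4 : c = 0 := by
      ext i
      by_cases hi : i ∈ c.support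
      · exact hfree c.support c (by rw [← h3, h2]; exact x.2) i hi
      · simpa using hi
    subst h4
    have : (x : C.V) = 0 := by rw [← h2, map_zero]
    have : x = 0 := Subtype.ext this
    rw [this]; rfl
  obtain ⟨G, hG⟩ := LinearMap.exists_leftInverse_of_injective Θ (LinearMap.ker_eq_bot.2 hinj)
  let F' : C.V →ₗ[ZMod 2] E.V := (Ξ1.coprod (F ∘ₗ S.subtype)) ∘ₗ G
  have hFΘ : ∀ c x, F' (Θ (c, x)) = Ξ1 c + F x := by
    intro c x
    have := LinearMap.congr_fun hG (c, x)
    simp only [LinearMap.comp_apply, LinearMap.id_apply] at this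
    simp only [F', LinearMap.comp_apply, this]
    simp
  have hFS : ∀ x ∈ S, F' x = F x := by
    intro x hx
    have := hFΘ 0 ⟨x, hx⟩
    simpa [Θ] using this
  have hFg : ∀ i a b, F' (C.actR (C.actL a (g i)) b) = E.R (E.L a (f i)) b := by
    intro i a b
    have := hFΘ (Finsupp.single i (a ⊗ₜ b)) 0
    simpa [Θ, Θ1, Ξ1, sandT_tmul, UB.sand_tmul] using this
  refine ⟨F', hgen.trans (sup_le ?_ (iSup_le fun i => ?_)), hFS⟩
  · intro x hx
    obtain ⟨h1, h2, h3, h4⟩ := hF hx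
    refine ⟨?_, ?_, ?_, ?_⟩
    · rw [hFS x hx]; exact h1
    · intro a; rw [hFS x hx, hFS _ (hSL a x hx), h2]
    · intro a; rw [hFS x hx, hFS _ (hSR a x hx), h3]
    · rw [hFS x hx, hFS _ (hSd x hx), h4]
  · rintro _ ⟨c, rfl⟩
    induction c using TensorProduct.induction_on with
    | zero => rw [map_zero]; exact zero_mem _
    | add p q hp hq => rw [map_add]; exact add_mem hp hq
    | tmul p q =>
      rw [sandT_tmul]
      refine ⟨?_, ?_, ?_, ?_⟩
      · rw [hFg]; exact hR _ _ (hL _ _ (hf0 i))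
      · intro a
        rw [← C.actLR, ← C.actL_mul, hFg, hFg, E.L_mul, E.LR]
      · intro a
        rw [C.actR_mul, hFg, hFg, E.R_mul]
      · rw [hFg, E.dR, E.dL, hfd, DdR hd, DdL hd, hνR, hνL]
        obtain ⟨h1, h2, h3, h4⟩ := hF (hgd i)
        obtain ⟨k1, k2, k3, k4⟩ := hF (hSL p _ (hgd i))
        rw [hFS _ (hSR _ _ (hSL _ _ (hgd i))), k3, h2]
        simp
 
theorem cell_lemma (hd : A.d = 0) (C : DGBimod A) (hC : IsCellBimod C) (E : UB A) (E0 : Submodule (ZMod 2) E.V)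
    (hL : ∀ a, ∀ x ∈ E0, E.L a x ∈ E0) (hR : ∀ a, ∀ x ∈ E0, E.R x a ∈ E0)
    (hac : ∀ x ∈ E0, E.d x = 0 → ∃ y ∈ E0, E.d y = x)
    (ν : C.V →ₗ[ZMod 2] E.V) (hν0 : ∀ x, ν x ∈ E0)
    (hνL : ∀ a x, ν (C.actL a x) = E.L a (ν x)) (hνR : ∀ x a, ν (C.actR x a) = E.R (ν x) a)
    (hνd : ∀ x, ν (C.d x) = E.d (ν x)) :
    ∃ F : C.V →ₗ[ZMod 2] E.V, ∀ x, x ∈ CQ C E E0 ν F := by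
  obtain ⟨Fil, h0, hmono, htop, hFd, hFL, hFR, hstep⟩ := hC
  have step : ∀ n (F : {F : C.V →ₗ[ZMod 2] E.V // Fil n ≤ CQ C E E0 ν F}),
      ∃ F' : {F : C.V →ₗ[ZMod 2] E.V // Fil (n + 1) ≤ CQ C E E0 ν F}, ∀ x ∈ Fil n, F'.1 x = F.1 x := by
    rintro n ⟨F, hF⟩
    obtain ⟨F', h1, h2⟩ := cell_step hd C E E0 hL hR hac ν hν0 hνL hνR hνd (Fil n) (Fil (n + 1))
      (fun a => hFL n a) (fun a => hFR n a) (hstep n) F hF (hFd n)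
    exact ⟨⟨F', h1⟩, h2⟩
  choose nx hnx using step
  let Fs : ∀ n, {F : C.V →ₗ[ZMod 2] E.V // Fil n ≤ CQ C E E0 ν F} :=
    fun n => Nat.rec ⟨0, by rw [h0]; exact bot_le⟩ (fun n F => nx n F) n
  have hFs : ∀ n, ∀ x ∈ Fil n, (Fs (n + 1)).1 x = (Fs n).1 x := fun n x hx => hnx n (Fs n) x hx
  have hFs2 : ∀ n m, n ≤ m → ∀ x ∈ Fil n, (Fs m).1 x = (Fs n).1 x := by
    intro n m h x hx
    induction m, h using Nat.le_induction with
    | base => rfl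
    | succ m hm ih => rw [hFs m x (hmono hm hx), ih]
  have hex : ∀ x : C.V, ∃ n, x ∈ Fil n := by
    intro x
    have : x ∈ ⨆ n, Fil n := by rw [htop]; trivial
    rwa [Submodule.mem_iSup_of_directed _ hmono.directed_le] at this
  choose nn hnn using hex
  have key : ∀ x n, x ∈ Fil n → (Fs (nn x)).1 x = (Fs n).1 x := by
    intro x n hx
    rcases le_total n (nn x) with h | h
    · exact hFs2 _ _ h x hx
    · exact (hFs2 _ _ h x (hnn x)).symm
  let F : C.V →ₗ[ZMod 2] E.V :=
    { toFun := fun x => (Fs (nn x)).1 x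
      map_add' := by
        intro x y
        have hx := hmono (le_max_left (nn x) (nn y)) (hnn x)
        have hy := hmono (le_max_right (nn x) (nn y)) (hnn y)
        rw [key x _ hx, key y _ hy, key (x + y) _ (add_mem hx hy), map_add]
      map_smul' := by
        intro c x
        rw [key (c • x) _ (Submodule.smul_mem _ c (hnn x)), map_smul]; rfl }
  have hF : ∀ n, ∀ x ∈ Fil n, F x = (Fs n).1 x := fun n x hx => key x n hx
  refine ⟨F, fun x => ?_⟩
  have hx := hnn x
  obtain ⟨h1, h2, h3, h4⟩ := (Fs (nn x)).2 hx
  refine ⟨?_, ?_, ?_, ?_⟩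
  · rw [hF _ x hx]; exact h1
  · intro a; rw [hF _ x hx, hF _ _ (hFL _ a x hx), h2]
  · intro a; rw [hF _ x hx, hF _ _ (hFR _ a x hx), h3]
  · rw [hF _ x hx, hF _ _ (hFd _ x hx), h4]
end cell


section
variable {V : Type} [AddCommGroup V] [Module (ZMod 2) V]

theorem pr_mem {gr : ℤ → Submodule (ZMod 2) V} (h : DirectSum.IsInternal gr) (n : ℤ) (z : V) : pr h n z ∈ gr n := by
  refine hind h (gr n) (fun z => pr h n z) (fun x y => map_add _ x y) ?_ z
  intro i x hx
  simp only [pr_apply h n hx]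
  split_ifs with hi
  · subst hi; exact hx
  · exact zero_mem _

theorem pr_sum {gr : ℤ → Submodule (ZMod 2) V} (h : DirectSum.IsInternal gr) (z : V) :
    ∃ u : Finset ℤ, ∀ u', u ⊆ u' → ∑ n ∈ u', pr h n z = z := by
  classical
  have h' := DirectSum.IsInternal.submodule_iSup_eq_top h
  have ha : z ∈ ⨆ i, gr i := by rw [h']; trivial
  induction ha using Submodule.iSup_induction' with
  | mem i x hx =>
    refine ⟨{i}, fun u' hu => ?_⟩
    rw [Finset.sum_congr rfl (fun n _ => pr_apply h n hx)]
    rw [Finset.sum_ite_eq]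
    rw [if_pos (hu (by simp))]
  | zero => exact ⟨∅, fun u' _ => by simp⟩
  | add x y _ _ h1 h2 =>
    obtain ⟨u, hu⟩ := h1
    obtain ⟨v, hv⟩ := h2
    refine ⟨u ∪ v, fun u' h => ?_⟩
    simp only [map_add, Finset.sum_add_distrib]
    rw [hu _ (Finset.union_subset_left h), hv _ (Finset.union_subset_right h)]

theorem pr_all {gr : ℤ → Submodule (ZMod 2) V} (h : DirectSum.IsInternal gr) (S : Submodule (ZMod 2) V) (z : V)
    (hz : ∀ n, pr h n z ∈ S) : z ∈ S := by
  obtain ⟨u, hu⟩ := pr_sum h z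
  rw [← hu u subset_rfl]
  exact sum_mem fun n _ => hz n
end

section qiso
variable {A : DGA (ZMod 2)} {R : DGBimod A} {ρ : R.V →ₗ[ZMod 2] A.diag.V}

theorem res_surj (hd : A.d = 0) (h : IsResolution R A.diag ρ) (c : A.V) : ∃ z, R.d z = 0 ∧ ρ z = c := by
  obtain ⟨-, -, hq⟩ := h
  have : c ∈ Submodule.map ρ (LinearMap.ker R.d) := by
    refine hind A.internal (Submodule.map ρ (LinearMap.ker R.d)) (fun c => c) (fun _ _ => rfl) ?_ c
    intro i x hx
    obtain ⟨z, hz, hz1, hz2⟩ := (hq i).1 x (by rw [add_zero]; exact hx) (by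
      change A.d x = 0
      rw [hd]; rfl)
    refine ⟨z, hz1, ?_⟩
    obtain ⟨y, -, hy⟩ := hz2
    have hy' : A.d y = @HSub.hSub A.V A.V A.V _ (ρ z) x := hy
    rw [hd] at hy'
    exact (sub_eq_zero.1 hy'.symm)
  obtain ⟨z, h1, h2⟩ := this
  exact ⟨z, h1, h2⟩

theorem res_inj (h : IsResolution R A.diag ρ) (z : R.V) (hz : R.d z = 0) (hz2 : ρ z = 0) :
    ∃ y, R.d y = z := by
  obtain ⟨-, hb, hq⟩ := h
  have h1 : ∀ n z, R.d (pr R.internal n z) = pr R.internal (n - 1) (R.d z) := by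
    intro n z
    have := hind R.internal ⊥ (fun z => R.d (pr R.internal n z) - pr R.internal (n - 1) (R.d z)) 
      (by intro x y; simp only [map_add]; abel) ?_ z
    · exact sub_eq_zero.1 this
    · intro i x hx
      simp only [pr_apply _ _ hx, pr_apply _ _ (R.d_gr i x hx)]
      by_cases hi : i = n
      · subst hi; simp
      · rw [if_neg hi, if_neg (by omega)]; simp
  have h2 : ∀ n z, ρ (pr R.internal n z) = pr A.diag.internal n (ρ z) := by
    intro n z
    have := hind R.internal ⊥ (fun z => ρ (pr R.internal n z) - pr A.diag.internal n (ρ z)) 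
      (by intro x y; simp only [map_add]; abel) ?_ z
    · exact sub_eq_zero.1 this
    · intro i x hx
      have := hb.1 i x hx
      rw [add_zero] at this
      simp only [pr_apply _ _ hx, pr_apply _ _ this]
      by_cases hi : i = n
      · subst hi; simp
      · rw [if_neg hi, if_neg hi]; simp
  have : z ∈ LinearMap.range R.d := by
    apply pr_all R.internal
    intro n
    obtain ⟨y, -, hy⟩ := (hq n).2 (pr R.internal n z) (pr_mem _ _ _) (by rw [h1, hz, map_zero]) (by
      rw [h2, hz2, map_zero]; exact zero_mem _)
    exact ⟨y, hy⟩
  obtain ⟨y, hy⟩ := this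
  exact ⟨y, hy⟩
end qiso

/-- the algebraic data underlying the Koszul complex -/
structure KD (A : DGA (ZMod 2)) (P N : ℕ) where
  e : ℕ → A.V
  x : ℕ → A.V
  hP : 0 < P
  hN : N + 1 = 2 * P
  per : ∀ i, e (i % P) = e i
  ee : ∀ i, A.mul (e i) (e i) = e i
  sum : ∑ v ∈ Finset.range P, e v = A.one
  ex : ∀ i, A.mul (e i) (x i) = x i
  xe : ∀ i, A.mul (x i) (e (i + 1)) = x i
  xx : ∀ i, A.mul (x i) (x (i + 1)) = 0
  x0 : ∀ i, N ≤ i → x i = 0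

section gam
variable {A : DGA (ZMod 2)} {R : DGBimod A} {ρ : R.V →ₗ[ZMod 2] A.diag.V} {P N : ℕ} (K : KD A P N)

theorem gam_step (hd : A.d = 0) (h : IsResolution R A.diag ρ) (n : ℕ) (γ : ℕ → R.V)
    (h1 : ∀ i, R.actL (K.x i) (R.d (γ (i + 1))) + R.actR (R.d (γ i)) (K.x (i + n)) = 0)
    (h2 : ∀ i, A.mul (K.x i) (ρ (γ (i + 1))) + A.mul (ρ (γ i)) (K.x (i + n)) = 0) :
    ∃ γ' : ℕ → R.V, (∀ i, R.d (γ' i) = R.actL (K.x i) (γ (i + 1)) + R.actR (γ i) (K.x (i + n))) ∧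
      (∀ i, ρ (γ' i) = 0) := by
  obtain ⟨-, hbd, hbL, hbR⟩ := h.2.1
  have : ∀ i, ∃ y, R.d y = R.actL (K.x i) (γ (i + 1)) + R.actR (γ i) (K.x (i + n)) ∧ ρ y = 0 := by
    intro i
    obtain ⟨y, hy⟩ := res_inj h (R.actL (K.x i) (γ (i + 1)) + R.actR (γ i) (K.x (i + n)))
      (by rw [map_add, DdL hd, DdR hd, h1]) (by rw [map_add, hbL, hbR]; exact h2 i)
    obtain ⟨z, hz, hz2⟩ := res_surj hd h (ρ y)
    exact ⟨y + z, by rw [map_add, hz, hy, add_zero], by rw [map_add, hz2, c2]⟩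
  choose γ' a b using this
  exact ⟨γ', a, b⟩

theorem gam_ex (hd : A.d = 0) (h : IsResolution R A.diag ρ) : ∃ γ : ℕ → ℕ → R.V,
    (∀ i, γ 0 (i % P) = γ 0 i) ∧ (∀ i, R.d (γ 0 i) = 0) ∧ (∀ i, ρ (γ 0 i) = K.e i) ∧
    (∀ n i, R.d (γ (n + 1) i) = R.actL (K.x i) (γ n (i + 1)) + R.actR (γ n i) (K.x (i + n))) ∧
    (∀ n i, ρ (γ (n + 1) i) = 0) := by
  have : ∀ v, ∃ z, R.d z = 0 ∧ ρ z = K.e v := fun v => res_surj hd h _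
  choose G hG1 hG2 using this
  let T : ℕ → Type := fun n => {γ : ℕ → R.V // 
    (∀ i, R.actL (K.x i) (R.d (γ (i + 1))) + R.actR (R.d (γ i)) (K.x (i + n)) = 0) ∧
    (∀ i, A.mul (K.x i) (ρ (γ (i + 1))) + A.mul (ρ (γ i)) (K.x (i + n)) = 0) }
  have step : ∀ n (γ : T n), ∃ γ' : T (n + 1), 
      (∀ i, R.d (γ'.1 i) = R.actL (K.x i) (γ.1 (i + 1)) + R.actR (γ.1 i) (K.x (i + n))) ∧
      (∀ i, ρ (γ'.1 i) = 0) := by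
    rintro n ⟨γ, h1, h2⟩
    obtain ⟨γ', a, b⟩ := gam_step K hd h n γ h1 h2
    refine ⟨⟨γ', ?_, ?_⟩, a, b⟩
    · intro i
      rw [a, a, map_add, map_add, LinearMap.add_apply, ← R.actL_mul, K.xx, R.actR_mul]
      rw [← add_assoc i n 1, K.xx, add_right_comm i 1 n]
      rw [← R.actLR]
      simp [c2]
    · intro i; rw [b, b]
      change A.mul (K.x i) (0 : A.V) + A.mul (0 : A.V) _ = 0
      simp
  choose nx hn1 hn2 using step
  let z : T 0 := ⟨fun i => G (i % P), by
    intro i; rw [hG1, hG1]; simp, by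
    intro i
    rw [hG2, hG2, K.per, K.per, K.xe, add_zero, K.ex, c2]⟩
  let γ : ∀ n, T n := fun n => Nat.rec z (fun n g => nx n g) n
  refine ⟨fun n => (γ n).1, ?_, ?_, ?_, fun n i => hn1 n (γ n) i, fun n i => hn2 n (γ n) i⟩
  · intro i
    change G (i % P % P) = G (i % P)
    rw [Nat.mod_mod]
  · intro i; exact hG1 _
  · intro i
    change ρ (G (i % P)) = _
    rw [hG2, K.per]
end gam

namespace KD
open MD
variable {A : DGA (ZMod 2)} {P N : ℕ} (K : KD A P N)

/-- underlying space of the Koszul complex -/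
abbrev Kh (A : DGA (ZMod 2)) : Type := ℕ × ℕ →₀ A.V ⊗[ZMod 2] A.V

theorem Khext {X : Type} [AddCommGroup X] [Module (ZMod 2) X] {f g : Kh A →ₗ[ZMod 2] X}
    (h : ∀ i j a b, f (Finsupp.single (i, j) (a ⊗ₜ b)) = g (Finsupp.single (i, j) (a ⊗ₜ b))) : f = g := by
  apply Finsupp.lhom_ext'
  rintro ⟨i, j⟩
  apply TensorProduct.ext'
  intro a b
  exact h i j a b

local notation "sn" => Finsupp.single (M := A.V ⊗[ZMod 2] A.V)

/-- Koszul differential -/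
def dK : Kh A →ₗ[ZMod 2] Kh A :=
  Finsupp.lsum (ZMod 2) (fun w => if w.1 < w.2 then
    Finsupp.lsingle (cl P (w.1 + 1) w.2) ∘ₗ TensorProduct.map (A.mul.flip (K.x w.1)) LinearMap.id +
    Finsupp.lsingle (cl P w.1 (w.2 - 1)) ∘ₗ TensorProduct.map LinearMap.id (A.mul (K.x (w.2 - 1))) else 0)

theorem dK_s (i j a b) : K.dK (sn (i, j) (a ⊗ₜ b)) = if i < j then
    sn (cl P (i + 1) j) (A.mul a (K.x i) ⊗ₜ b) + sn (cl P i (j - 1)) (a ⊗ₜ A.mul (K.x (j - 1)) b) else 0 := by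
  simp only [dK, Finsupp.lsum_single]
  split_ifs <;> simp

theorem dK_cl (i j a b) (h : i ≤ j) : K.dK (sn (cl P i j) (a ⊗ₜ b)) = if i < j then
    sn (cl P (i + 1) j) (A.mul a (K.x i) ⊗ₜ b) + sn (cl P i (j - 1)) (a ⊗ₜ A.mul (K.x (j - 1)) b) else 0 := by
  rcases h.eq_or_lt with rfl | h
  · simp [cl_self, dK_s]
  · rw [cl_ne h.ne, dK_s]

theorem xx' (i) (h : 1 ≤ i) : A.mul (K.x (i - 1)) (K.x i) = 0 := by
  obtain ⟨n, rfl⟩ : ∃ n, i = n + 1 := ⟨i - 1, by omega⟩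
  exact K.xx n

theorem dKdK (x) : K.dK (K.dK x) = 0 := by
  have : K.dK.comp K.dK = 0 := by
    apply Khext
    intro i j a b
    rw [LinearMap.comp_apply, dK_s, LinearMap.zero_apply]
    split_ifs with h
    · rw [map_add, dK_cl _ _ _ _ _ (by omega), dK_cl _ _ _ _ _ (by omega)]
      by_cases h2 : i + 1 < j
      · rw [if_pos h2, if_pos (by omega)]
        rw [A.mul_assoc', K.xx, ← A.mul_assoc' (K.x (j - 1 - 1)), K.xx' (j - 1) (by omega)]
        simp [c2]
      · rw [if_neg h2, if_neg (by omega)]; simp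
    · simp
  exact LinearMap.congr_fun this x

/-- left action -/
def LK : A.V →ₗ[ZMod 2] Kh A →ₗ[ZMod 2] Kh A :=
  LinearMap.mk₂ (ZMod 2) (fun a κ => Finsupp.mapRange.linearMap (TensorProduct.map (A.mul a) LinearMap.id) κ)
    (by intro a b κ; ext w; simp [TensorProduct.map_add_left])
    (by intro c a κ; ext w; simp [TensorProduct.map_smul_left])
    (by intro a b κ; exact map_add _ _ _)
    (by intro c a κ; exact map_smul _ _ _)

/-- right action -/
def RK : Kh A →ₗ[ZMod 2] A.V →ₗ[ZMod 2] Kh A :=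
  LinearMap.mk₂ (ZMod 2) (fun κ a => Finsupp.mapRange.linearMap (TensorProduct.map LinearMap.id (A.mul.flip a)) κ)
    (by intro a b κ; exact map_add _ _ _)
    (by intro c a κ; exact map_smul _ _ _)
    (by intro a b κ; ext w; simp [TensorProduct.map_add_right])
    (by intro c a κ; ext w; simp [TensorProduct.map_smul_right])

theorem LK_s (a w p q) : LK a (sn w (p ⊗ₜ q)) = sn w (A.mul a p ⊗ₜ q) := by
  simp [LK]

theorem RK_s (a w p q) : RK (sn w (p ⊗ₜ q)) a = sn w (p ⊗ₜ A.mul q a) := by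
  simp [RK]

def UK : UB A where
  V := Kh A
  d := K.dK
  dd := K.dKdK
  L := LK
  R := RK
  L_one := by
    intro m
    have : LK (A := A) A.one = LinearMap.id := by
      apply Khext; intro i j a b; rw [LK_s, A.one_mul']; rfl
    exact LinearMap.congr_fun this m
  R_one := by
    intro m
    have : RK.flip A.one = LinearMap.id := by
      apply Khext; intro i j a b; rw [LinearMap.flip_apply, RK_s, A.mul_one']; rfl
    exact LinearMap.congr_fun this m
  L_mul := by
    intro a b m
    have : LK (A.mul a b) = (LK a).comp (LK b) := by
      apply Khext; intro i j p q; rw [LinearMap.comp_apply, LK_s, LK_s, LK_s, A.mul_assoc']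
    exact LinearMap.congr_fun this m
  R_mul := by
    intro m a b
    have : (RK.flip b).comp (RK.flip a) = RK.flip (A.mul a b) := by
      apply Khext; intro i j p q; 
      simp only [LinearMap.comp_apply, LinearMap.flip_apply, RK_s, A.mul_assoc']
    exact LinearMap.congr_fun this m
  LR := by
    intro a m b
    have : (RK.flip b).comp (LK a) = (LK a).comp (RK.flip b) := by
      apply Khext; intro i j p q; 
      simp only [LinearMap.comp_apply, LinearMap.flip_apply, RK_s, LK_s]
    exact LinearMap.congr_fun this m
  dL := by
    intro a m
    have : K.dK.comp (LK a) = (LK a).comp K.dK := by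
      apply Khext; intro i j p q; 
      simp only [LinearMap.comp_apply, LK_s, dK_s]
      split_ifs <;> simp [LK_s, A.mul_assoc']
    exact LinearMap.congr_fun this m
  dR := by
    intro m a
    have : K.dK.comp (RK.flip a) = (RK.flip a).comp K.dK := by
      apply Khext; intro i j p q; 
      simp only [LinearMap.comp_apply, RK_s, dK_s, LinearMap.flip_apply]
      split_ifs <;> simp [RK_s, A.mul_assoc']
    exact LinearMap.congr_fun this m

/-- projection to the honest Koszul complex -/
def piK : Kh A →ₗ[ZMod 2] Kh A :=
  Finsupp.lsum (ZMod 2) (fun w => if valid P N w then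
    Finsupp.lsingle w ∘ₗ TensorProduct.map (A.mul.flip (K.e w.1)) (A.mul (K.e w.2)) else 0)

theorem piK_s (w a b) : K.piK (sn w (a ⊗ₜ b)) = if valid P N w then
    sn w (A.mul a (K.e w.1) ⊗ₜ A.mul (K.e w.2) b) else 0 := by
  simp only [piK, Finsupp.lsum_single]
  split_ifs <;> simp

theorem piK_L (a x) : K.piK (LK a x) = LK a (K.piK x) := by
  have : K.piK.comp (LK a) = (LK a).comp K.piK := by
    apply Khext; intro i j p q
    simp only [LinearMap.comp_apply, LK_s, piK_s]
    split_ifs <;> simp [LK_s, A.mul_assoc']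
  exact LinearMap.congr_fun this x

theorem piK_R (x a) : K.piK (RK x a) = RK (K.piK x) a := by
  have : K.piK.comp (RK.flip a) = (RK.flip a).comp K.piK := by
    apply Khext; intro i j p q
    simp only [LinearMap.comp_apply, LinearMap.flip_apply, RK_s, piK_s]
    split_ifs <;> simp [RK_s, A.mul_assoc']
  exact LinearMap.congr_fun this x

theorem piK_pi (x) : K.piK (K.piK x) = K.piK x := by
  have : K.piK.comp K.piK = K.piK := by
    apply Khext; intro i j p q
    simp only [LinearMap.comp_apply, piK_s]
    split_ifs with h
    · rw [piK_s, if_pos h, A.mul_assoc', K.ee, ← A.mul_assoc', K.ee]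
    · simp
  exact LinearMap.congr_fun this x

theorem ecl1 (i j) : K.e (cl P i j).1 = K.e i := by
  unfold cl; split_ifs
  · exact K.per i
  · rfl

theorem ecl2 (i j) : K.e (cl P i j).2 = K.e j := by
  unfold cl; split_ifs with h
  · rw [← h]; exact K.per i
  · rfl

theorem valid_cl (hP : 0 < P) {i j} (h : i ≤ j) (hj : j ≤ N) : valid P N (cl P i j) := by
  unfold cl; split_ifs with h1
  · exact Or.inr ⟨rfl, Nat.mod_lt _ hP⟩
  · exact Or.inl ⟨by simp; omega, hj⟩

theorem piK_d (x) : K.piK (K.dK x) = K.dK (K.piK x) := by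
  have : K.piK.comp K.dK = K.dK.comp K.piK := by
    apply Khext; intro i j p q
    simp only [LinearMap.comp_apply, piK_s, dK_s]
    by_cases h : i < j
    · rw [if_pos h]
      by_cases hj : j ≤ N
      · rw [if_pos (show valid P N (i, j) from Or.inl ⟨h, hj⟩), map_add, piK_s, piK_s,
          if_pos (valid_cl K.hP (by omega) hj), if_pos (valid_cl K.hP (by omega) (by omega)), dK_s, if_pos h]
        simp only [ecl1, ecl2]
        have e1 := K.xe (j - 1)
        rw [Nat.sub_add_cancel (by omega)] at e1
        rw [A.mul_assoc', K.xe, A.mul_assoc', K.ex, ← A.mul_assoc', K.ex, ← A.mul_assoc', e1]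
      · rw [if_neg (show ¬ valid P N (i, j) by unfold valid; simp; omega), K.x0 (j - 1) (by omega), map_zero, map_add]
        simp only [LinearMap.zero_apply, tmul_zero, Finsupp.single_zero, map_zero, add_zero]
        by_cases h2 : i + 1 = j
        · rw [K.x0 i (by omega)]; simp
        · rw [piK_s, if_neg]
          rw [cl_ne h2]; unfold valid; simp; omega
    · rw [if_neg h]
      split_ifs
      · rw [dK_s, if_neg h]; simp
      · simp
  exact LinearMap.congr_fun this x

/-- augmentation -/
def ep : Kh A →ₗ[ZMod 2] A.V :=
  Finsupp.lsum (ZMod 2) (fun w => if w.1 = w.2 then TensorProduct.lift (A.mul ∘ₗ (A.mul.flip (K.e w.1))) else 0)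

theorem ep_s (i j a b) : K.ep (sn (i, j) (a ⊗ₜ b)) = if i = j then A.mul (A.mul a (K.e i)) b else 0 := by
  simp only [ep, Finsupp.lsum_single]
  split_ifs <;> simp

/-- section of the augmentation -/
def s0 : A.V →ₗ[ZMod 2] Kh A :=
  ∑ v ∈ Finset.range P, Finsupp.lsingle (v, v) ∘ₗ (TensorProduct.mk (ZMod 2) A.V A.V (K.e v)) ∘ₗ (A.mul (K.e v))

theorem s0_apply (c) : K.s0 c = ∑ v ∈ Finset.range P, sn (v, v) (K.e v ⊗ₜ A.mul (K.e v) c) := by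
  simp [s0]

theorem d_s0 (c) : K.dK (K.s0 c) = 0 := by
  rw [s0_apply, map_sum, Finset.sum_eq_zero]
  intro v _; rw [dK_s, if_neg (lt_irrefl v)]

theorem pi_s0 (c) : K.piK (K.s0 c) = K.s0 c := by
  rw [s0_apply, map_sum]
  apply Finset.sum_congr rfl
  intro v hv
  rw [Finset.mem_range] at hv
  rw [piK_s, if_pos (show valid P N (v, v) from Or.inr ⟨rfl, hv⟩), K.ee, ← A.mul_assoc', K.ee]

theorem ep_s0 (c) : K.ep (K.s0 c) = c := by
  rw [s0_apply, map_sum]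
  have : ∀ v ∈ Finset.range P, K.ep (sn (v, v) (K.e v ⊗ₜ A.mul (K.e v) c)) = A.mul (K.e v) c := by
    intro v hv
    rw [ep_s, if_pos rfl, K.ee, ← A.mul_assoc', K.ee]
  rw [Finset.sum_congr rfl this, ← LinearMap.sum_apply, ← map_sum, K.sum, A.one_mul']

/-- acyclicity of the augmented Koszul complex -/
def Acyc : Prop := ∀ κ, K.piK κ = κ → K.dK κ = 0 → K.ep κ = 0 → ∃ κ', K.piK κ' = κ' ∧ K.dK κ' = κ

end KD

namespace KD
open MD
variable {A : DGA (ZMod 2)} {P N : ℕ} (K : KD A P N)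
local notation "sn" => Finsupp.single (M := A.V ⊗[ZMod 2] A.V)

/-- coherent choice of images of the Koszul generators -/
structure Gam (K : KD A P N) (R : DGBimod A) (ρ : R.V →ₗ[ZMod 2] A.diag.V) where
  γ : ℕ → ℕ → R.V
  per : ∀ i, γ 0 (i % P) = γ 0 i
  d0 : ∀ i, R.d (γ 0 i) = 0
  ρ0 : ∀ i, ρ (γ 0 i) = K.e i
  d1 : ∀ n i, R.d (γ (n + 1) i) = R.actL (K.x i) (γ n (i + 1)) + R.actR (γ n i) (K.x (i + n))
  ρ1 : ∀ n i, ρ (γ (n + 1) i) = 0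

namespace Gam
variable {K : KD A P N} {R : DGBimod A} {ρ : R.V →ₗ[ZMod 2] A.diag.V} (G : Gam K R ρ)

def g (w : ℕ × ℕ) : R.V := if w.1 ≤ w.2 then G.γ (w.2 - w.1) w.1 else 0

theorem g_cl (i j) (h : i ≤ j) : G.g (cl P i j) = G.γ (j - i) i := by
  rcases h.eq_or_lt with rfl | h
  · simp [cl_self, g, G.per]
  · rw [cl_ne h.ne, g, if_pos h.le]

theorem dg (i j) : R.d (G.g (i, j)) = if i < j then
    R.actL (K.x i) (G.g (cl P (i + 1) j)) + R.actR (G.g (cl P i (j - 1))) (K.x (j - 1)) else 0 := by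
  split_ifs with h
  · rw [g_cl _ _ _ (by omega), g_cl _ _ _ (by omega), g, if_pos (by simp; omega)]
    obtain ⟨n, rfl⟩ : ∃ n, j = i + n + 1 := ⟨j - i - 1, by omega⟩
    have e1 : (i, i + n + 1).2 - (i, i + n + 1).1 = n + 1 := by simp; omega
    rw [e1, G.d1]
    congr 2
    · congr 2; omega
    · congr 2; omega
  · rw [g]
    split_ifs with h2
    · have : (i, j).2 - (i, j).1 = 0 := by simp; omega
      rw [this, G.d0]
    · simp

def gh : Kh A →ₗ[ZMod 2] R.V := Finsupp.lsum (ZMod 2) (fun w => sandwichT R (G.g w))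

theorem gh_s (w a b) : G.gh (sn w (a ⊗ₜ b)) = R.actR (R.actL a (G.g w)) b := by
  simp [gh, sandT_tmul]

theorem gh_d (hd : A.d = 0) (κ) : G.gh (K.dK κ) = R.d (G.gh κ) := by
  have : G.gh.comp K.dK = R.d.comp G.gh := by
    apply Khext; intro i j a b
    simp only [LinearMap.comp_apply, gh_s, dK_s, DdL hd, DdR hd, dg]
    split_ifs
    · simp only [map_add, gh_s, R.actL_mul, LinearMap.add_apply]
      rw [← R.actLR a _ (K.x (j - 1)), R.actR_mul]
    · simp
  exact LinearMap.congr_fun this κ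

theorem gh_L (a κ) : G.gh (LK a κ) = R.actL a (G.gh κ) := by
  have : G.gh.comp (LK a) = (R.actL a).comp G.gh := by
    apply Khext; intro i j p q
    simp only [LinearMap.comp_apply, gh_s, LK_s, R.actL_mul, R.actLR]
  exact LinearMap.congr_fun this κ

theorem gh_R (κ a) : G.gh (RK κ a) = R.actR (G.gh κ) a := by
  have : G.gh.comp (RK.flip a) = (R.actR.flip a).comp G.gh := by
    apply Khext; intro i j p q
    simp only [LinearMap.comp_apply, gh_s, RK_s, R.actR_mul, LinearMap.flip_apply]
  exact LinearMap.congr_fun this κ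

theorem gh_ρ (hb : IsBHom R A.diag 0 ρ) (κ) : ρ (G.gh κ) = K.ep κ := by
  obtain ⟨-, hbd, hbL, hbR⟩ := hb
  have : ρ.comp G.gh = K.ep := by
    apply Khext; intro i j p q
    simp only [LinearMap.comp_apply, gh_s]
    refine (hbR _ _).trans ?_
    rw [hbL]
    refine Eq.trans ?_ (K.ep_s i j p q).symm
    change A.mul (A.mul p (ρ (G.g (i, j)))) q = _
    split_ifs with h
    · subst h
      rw [g, if_pos le_rfl]
      simp only [Nat.sub_self]
      rw [G.ρ0]
    · have : ρ (G.g (i, j)) = 0 := by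
        rw [g]
        split_ifs with h2
        · simp only at h2
          obtain ⟨n, hn⟩ : ∃ n, j - i = n + 1 := ⟨j - i - 1, by omega⟩
          simp only [hn]
          rw [G.ρ1]
        · simp
      rw [this]
      change A.mul (A.mul p (0 : A.V)) q = 0
      simp
  exact LinearMap.congr_fun this κ

/-- The cone of `gh`. -/
def cone (hd : A.d = 0) : UB A where
  V := Kh A × R.V
  d := LinearMap.prod (K.dK ∘ₗ LinearMap.fst _ _ _) (G.gh ∘ₗ LinearMap.fst _ _ _ + R.d ∘ₗ LinearMap.snd _ _ _)
  dd := by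
    rintro ⟨κ, r⟩
    simp [K.dKdK, G.gh_d hd, R.d_d, c2]
  L := LinearMap.mk₂ (ZMod 2) (fun a v => (LK a v.1, R.actL a v.2)) (by intros; simp) (by intros; simp)
    (by intros; simp) (by intros; simp)
  R := LinearMap.mk₂ (ZMod 2) (fun v a => (RK v.1 a, R.actR v.2 a)) (by intros; simp) (by intros; simp)
    (by intros; simp) (by intros; simp)
  L_one := by rintro ⟨κ, r⟩; exact Prod.ext (K.UK.L_one κ) (R.actL_one r)
  R_one := by rintro ⟨κ, r⟩; exact Prod.ext (K.UK.R_one κ) (R.actR_one r)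
  L_mul := by rintro a b ⟨κ, r⟩; exact Prod.ext (K.UK.L_mul a b κ) (R.actL_mul a b r)
  R_mul := by rintro ⟨κ, r⟩ a b; exact Prod.ext (K.UK.R_mul κ a b) (R.actR_mul r a b)
  LR := by rintro a ⟨κ, r⟩ b; exact Prod.ext (K.UK.LR a κ b) (R.actLR a r b)
  dL := by
    rintro a ⟨κ, r⟩
    refine Prod.ext (K.UK.dL a κ) ?_
    simp [gh_L, DdL hd]
  dR := by
    rintro ⟨κ, r⟩ a
    refine Prod.ext (K.UK.dR κ a) ?_
    simp [gh_R, DdR hd]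

theorem hH (hd : A.d = 0) (h : IsResolution R A.diag ρ) (hK : K.Acyc) :
    ∃ (η : R.V →ₗ[ZMod 2] Kh A) (H : R.V →ₗ[ZMod 2] R.V),
      (∀ x, K.piK (η x) = η x) ∧ (∀ x, K.dK (η x) = η (R.d x)) ∧
      (∀ a x, η (R.actL a x) = LK a (η x)) ∧ (∀ x a, η (R.actR x a) = RK (η x) a) ∧
      (∀ a x, H (R.actL a x) = R.actL a (H x)) ∧ (∀ x a, H (R.actR x a) = R.actR (H x) a) ∧
      (∀ x, G.gh (η x) + R.d (H x) = H (R.d x) + x) := by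
  obtain ⟨⟨C, hC, ι, r, ⟨-, hιd, hιL, hιR⟩, ⟨-, hrd, hrL, hrR⟩, -, hrι⟩, hb, -⟩ := id h
  let E0 : Submodule (ZMod 2) (G.cone hd).V :=
    LinearMap.ker ((K.piK + LinearMap.id) ∘ₗ LinearMap.fst (ZMod 2) (Kh A) R.V)
  have hE0 : ∀ κ r, ((κ, r) : Kh A × R.V) ∈ E0 ↔ K.piK κ = κ := by
    intro κ r
    change K.piK κ + κ = 0 ↔ _
    exact ⟨c2eq, fun h => by rw [h, c2]⟩
  obtain ⟨F, hF⟩ := cell_lemma hd C hC (G.cone hd) E0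
    (by
      rintro a ⟨κ, r⟩ h
      replace h := (hE0 _ _).1 h
      refine (hE0 _ _).2 ?_
      change K.piK (LK a κ) = LK a κ
      rw [piK_L, h])
    (by
      rintro a ⟨κ, r⟩ h
      replace h := (hE0 _ _).1 h
      refine (hE0 _ _).2 ?_
      change K.piK (RK κ a) = RK κ a
      rw [piK_R, h])
    (by
      rintro ⟨κ, r⟩ h0 hdx
      replace h0 := (hE0 _ _).1 h0
      have h1 : K.dK κ = 0 := congrArg Prod.fst hdx
      have h2 : G.gh κ + R.d r = 0 := congrArg Prod.snd hdx
      have h3 : K.ep κ = 0 := by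
        rw [← G.gh_ρ hb, c2eq h2, hb.2.1]
        change A.d (ρ r) = 0
        rw [hd]; rfl
      obtain ⟨κ', hp, hκ⟩ := hK κ h0 h1 h3
      let c : A.V := ρ (G.gh κ' + r)
      have hz1 : R.d (G.gh (κ' + K.s0 c) + r) = 0 := by
        rw [map_add, ← G.gh_d hd, map_add, d_s0, hκ, add_zero, h2]
      have hz2 : ρ (G.gh (κ' + K.s0 c) + r) = 0 := by
        have e : G.gh (κ' + K.s0 c) + r = (G.gh κ' + r) + G.gh (K.s0 c) := by rw [map_add]; abel
        rw [e, map_add, G.gh_ρ hb, ep_s0]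
        exact c2 _
      obtain ⟨r', hr'⟩ := res_inj h _ hz1 hz2
      refine ⟨(κ' + K.s0 c, r'), ?_, ?_⟩
      · refine (hE0 _ _).2 ?_
        rw [map_add, hp, pi_s0]
      · refine Prod.ext ?_ ?_
        · change K.dK (κ' + K.s0 c) = κ
          rw [map_add, d_s0, hκ, add_zero]
        · change G.gh (κ' + K.s0 c) + R.d r' = r
          rw [hr', c2'])
    (LinearMap.inr (ZMod 2) (Kh A) R.V ∘ₗ r)
    (by intro x; exact (hE0 _ _).2 (map_zero _))
    (by
      intro a x
      refine Prod.ext ?_ ?_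
      · change (0 : Kh A) = LK a 0
        rw [map_zero]
      · exact hrL a x)
    (by
      intro x a
      refine Prod.ext ?_ ?_
      · change (0 : Kh A) = RK 0 a
        rw [map_zero]; rfl
      · exact hrR x a)
    (by
      intro x
      refine Prod.ext ?_ ?_
      · change (0 : Kh A) = K.dK 0
        rw [map_zero]
      · change r (C.d x) = G.gh 0 + R.d (r x)
        rw [map_zero, zero_add, hrd])
  let F1 : C.V →ₗ[ZMod 2] Kh A := LinearMap.fst (ZMod 2) (Kh A) R.V ∘ₗ F
  let F2 : C.V →ₗ[ZMod 2] R.V := LinearMap.snd (ZMod 2) (Kh A) R.V ∘ₗ F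
  refine ⟨F1 ∘ₗ ι, F2 ∘ₗ ι, ?_, ?_, ?_, ?_, ?_, ?_, ?_⟩
  · intro x
    exact (hE0 _ _).1 (hF (ι x)).1
  · intro x
    have := congrArg Prod.fst (hF (ι x)).2.2.2
    have h2 : K.dK (F1 (ι x)) = F1 (C.d (ι x)) + 0 := this
    simp only [LinearMap.comp_apply]
    rw [h2, add_zero, hιd]
  · intro a x
    simp only [LinearMap.comp_apply]
    rw [hιL]
    exact congrArg Prod.fst ((hF (ι x)).2.1 a)
  · intro x a
    simp only [LinearMap.comp_apply]
    rw [hιR]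
    exact congrArg Prod.fst ((hF (ι x)).2.2.1 a)
  · intro a x
    simp only [LinearMap.comp_apply]
    rw [hιL]
    exact congrArg Prod.snd ((hF (ι x)).2.1 a)
  · intro x a
    simp only [LinearMap.comp_apply]
    rw [hιR]
    exact congrArg Prod.snd ((hF (ι x)).2.2.1 a)
  · intro x
    have := congrArg Prod.snd (hF (ι x)).2.2.2
    have h2 : G.gh (F1 (ι x)) + R.d (F2 (ι x)) = F2 (C.d (ι x)) + r (ι x) := this
    simp only [LinearMap.comp_apply]
    rw [h2, hιd]
    congr 1
    exact LinearMap.congr_fun hrι x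
end Gam
end KD

section
variable {A : DGA (ZMod 2)} (R M : DGBimod A)

def bm (F F' : R.V →ₗ[ZMod 2] R.V) : T4 R M →ₗ[ZMod 2] T4 R M :=
  TensorProduct.map F (TensorProduct.map LinearMap.id (TensorProduct.map F' LinearMap.id))

theorem bm_tmul (F F' r m r' m') : bm R M F F' (r ⊗ₜ (m ⊗ₜ (r' ⊗ₜ m'))) = F r ⊗ₜ (m ⊗ₜ (F' r' ⊗ₜ m')) := by
  simp [bm]

theorem bm_rel (F F' : R.V →ₗ[ZMod 2] R.V)
    (hL : ∀ a x, F (R.actL a x) = R.actL a (F x)) (hR : ∀ x a, F (R.actR x a) = R.actR (F x) a)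
    (hL' : ∀ a x, F' (R.actL a x) = R.actL a (F' x)) (hR' : ∀ x a, F' (R.actR x a) = R.actR (F' x) a)
    (z : T4 R M) (hz : z ∈ rel4 R M) : bm R M F F' z ∈ rel4 R M := by
  have : rel4 R M ≤ Submodule.comap (bm R M F F') (rel4 R M) := by
    apply rel_le <;> intro r a m r' m' <;>
      simp only [Submodule.mem_comap, map_add, bm_tmul, hL, hR, hL', hR']
    · apply rel_1
    · apply rel_2
    · apply rel_3
    · apply rel_4
  exact this hz

/-- Homotopy transfer reduction. -/
theorem Pun_of_model (f H : R.V →ₗ[ZMod 2] R.V)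
    (fd : ∀ x, f (R.d x) = R.d (f x))
    (fL : ∀ a x, f (R.actL a x) = R.actL a (f x)) (fR : ∀ x a, f (R.actR x a) = R.actR (f x) a)
    (HL : ∀ a x, H (R.actL a x) = R.actL a (H x)) (HR : ∀ x a, H (R.actR x a) = R.actR (H x) a)
    (hh : ∀ x, f x + R.d (H x) = H (R.d x) + x)
    (hmod : ∀ z0 z1 z2 : T4 R M, z0 + tau4 R M z0 ∈ rel4 R M →
      d4 R M z0 + (z1 + tau4 R M z1) ∈ rel4 R M → d4 R M z1 + (z2 + tau4 R M z2) ∈ rel4 R M →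
      ∃ t0 t1 u : T4 R M, t0 + tau4 R M t0 ∈ rel4 R M ∧ d4 R M t0 + (t1 + tau4 R M t1) ∈ rel4 R M ∧
        d4 R M t1 ∈ rel4 R M ∧ bm R M f f z0 + t0 + (u + tau4 R M u) ∈ rel4 R M) : Pun R M := by
  intro z0 z1 z2 h0 h1 h2
  obtain ⟨t0, t1, u, ht0, ht1, ht2, hu⟩ := hmod z0 z1 z2 h0 h1 h2
  let H1 : T4 R M →ₗ[ZMod 2] T4 R M := bm R M H f + bm R M LinearMap.id H
  let H2 : T4 R M →ₗ[ZMod 2] T4 R M := bm R M H H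
  have H1r : ∀ z ∈ rel4 R M, H1 z ∈ rel4 R M := fun z hz =>
    Submodule.add_mem _ (bm_rel R M _ _ HL HR fL fR z hz)
      (bm_rel R M _ _ (fun _ _ => rfl) (fun _ _ => rfl) HL HR z hz)
  have H2r : ∀ z ∈ rel4 R M, H2 z ∈ rel4 R M := fun z hz => bm_rel R M _ _ HL HR HL HR z hz
  have hdH : ∀ x, R.d (H x) = f x + (H (R.d x) + x) := fun x => by
    rw [← hh, c2']
  have e1 : ∀ z, d4 R M (H1 z) = H1 (d4 R M z) + z + bm R M f f z := by
    intro z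
    have : (d4 R M).comp H1 = H1.comp (d4 R M) + LinearMap.id + bm R M f f := by
      apply T4ext; intro r m r' m'
      simp only [H1, LinearMap.comp_apply, LinearMap.add_apply, map_add, bm_tmul, d4_tmul, LinearMap.id_apply, hdH, fd,
        add_tmul, tmul_add]
      apply c2eq; abel_nf; simp [c2z, c2n]
    exact LinearMap.congr_fun this z
  have e2 : ∀ z, H1 (tau4 R M z) = tau4 R M (H1 z) + d4 R M (H2 (tau4 R M z)) + H2 (tau4 R M (d4 R M z)) := by
    intro z
    have : H1.comp (tau4 R M) = (tau4 R M).comp H1 + (d4 R M).comp (H2.comp (tau4 R M)) + H2.comp ((tau4 R M).comp (d4 R M)) := by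
      apply T4ext; intro r m r' m'
      simp only [H1, H2, LinearMap.comp_apply, LinearMap.add_apply, map_add, bm_tmul, d4_tmul, LinearMap.id_apply, hdH, fd,
        add_tmul, tmul_add, tau4_tmul]
      apply c2eq; abel_nf; simp [c2z, c2n]
    exact LinearMap.congr_fun this z
  have e3 : ∀ z, H2 (tau4 R M z) = tau4 R M (H2 z) := by
    intro z
    have : H2.comp (tau4 R M) = (tau4 R M).comp H2 := by
      apply T4ext; intro r m r' m'
      simp only [H2, LinearMap.comp_apply, bm_tmul, tau4_tmul]
    exact LinearMap.congr_fun this z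
  refine ⟨t0, t1, H1 z1 + tau4 R M (H2 z2) + u, H1 z0 + tau4 R M (H2 z1), H2 z0, ht0, ht1, ht2, ?_, ?_, ?_⟩
  · have := Submodule.add_mem _ (Submodule.add_mem _ (H1r _ h1) (tau4_rel R M _ (H2r _ h2))) hu
    convert this using 1
    simp only [map_add, e1, e2, e3, tau4_tau4, d4_tau4]
    apply c2eq; abel_nf; simp [c2z, c2n]
  · have := Submodule.add_mem _ (H2r _ h1) (tau4_rel R M _ (H1r _ h0))
    convert this using 1
    simp only [map_add, e1, e2, e3, tau4_tau4, d4_tau4]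
    apply c2eq; abel_nf; simp [c2z, c2n]
  · have := H2r _ h0
    simpa [e3] using this
end

namespace KD
open MD
variable {A : DGA (ZMod 2)} {P N : ℕ} (K : KD A P N)
local notation "sn" => Finsupp.single (M := A.V ⊗[ZMod 2] A.V)

def md (hd : A.d = 0) (M : DGBimod A) : MD P N M.V where
  d := M.d
  l i := M.actL (K.x i)
  r i := M.actR.flip (K.x i)
  hP := K.hP
  hN := K.hN
  dd := M.d_d
  dl i m := DdL hd M _ _
  dr i m := DdR hd M _ _
  lr i j m := (M.actLR _ _ _).symm
  ll i m := by rw [← M.actL_mul, K.xx]; simp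
  rr i m := by simp only [LinearMap.flip_apply]; rw [M.actR_mul, K.xx]; simp
  l0 i hi m := by rw [K.x0 i hi]; simp
  r0 i hi m := by rw [LinearMap.flip_apply, K.x0 i hi]; simp

section
variable (M : DGBimod A)

def RZ : (ℕ × ℕ →₀ M.V) ⊗[ZMod 2] A.V →ₗ[ZMod 2] (ℕ × ℕ →₀ M.V) :=
  TensorProduct.lift (Finsupp.lsum (ZMod 2) (fun w => M.actR.compr₂ (Finsupp.lsingle w)))

theorem RZ_s (w m a) : RZ M (Finsupp.single w m ⊗ₜ a) = Finsupp.single w (M.actR m a) := by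
  simp [RZ]

def S1 (w : ℕ × ℕ) : A.V →ₗ[ZMod 2] A.V →ₗ[ZMod 2] M.V →ₗ[ZMod 2] (ℕ × ℕ →₀ M.V) ⊗[ZMod 2] A.V :=
  LinearMap.mk₂ (ZMod 2) (fun a b => ((TensorProduct.mk (ZMod 2) (ℕ × ℕ →₀ M.V) A.V).flip a) ∘ₗ
    (Finsupp.lsingle w) ∘ₗ (M.actL b))
    (by intros; ext m; simp [tmul_add]) (by intros; ext m; simp)
    (by intros; ext m; simp [add_tmul]) (by intros; ext m; simp [← Finsupp.smul_single, smul_tmul'])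

def Sm : Kh A ⊗[ZMod 2] M.V →ₗ[ZMod 2] (ℕ × ℕ →₀ M.V) ⊗[ZMod 2] A.V :=
  TensorProduct.lift (Finsupp.lsum (ZMod 2) (fun w => TensorProduct.lift (S1 M w)))

theorem Sm_s (w a b m) : Sm M (sn w (a ⊗ₜ b) ⊗ₜ m) = Finsupp.single w (M.actL b m) ⊗ₜ a := by
  simp [Sm, S1]

def Vm : ((ℕ × ℕ →₀ M.V) ⊗[ZMod 2] A.V) ⊗[ZMod 2] ((ℕ × ℕ →₀ M.V) ⊗[ZMod 2] A.V) →ₗ[ZMod 2]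
    (ℕ × ℕ →₀ M.V) ⊗[ZMod 2] (ℕ × ℕ →₀ M.V) :=
  TensorProduct.map (RZ M) (RZ M) ∘ₗ (TensorProduct.tensorTensorTensorComm (ZMod 2) _ _ _ _).toLinearMap ∘ₗ
    TensorProduct.map LinearMap.id (TensorProduct.comm (ZMod 2) A.V A.V).toLinearMap ∘ₗ
    (TensorProduct.tensorTensorTensorComm (ZMod 2) _ _ _ _).toLinearMap

theorem Vm_s (z a z' a') : Vm M ((z ⊗ₜ a) ⊗ₜ (z' ⊗ₜ a')) = RZ M (z ⊗ₜ a') ⊗ₜ RZ M (z' ⊗ₜ a) := by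
  simp [Vm]

def Wm : Kh A ⊗[ZMod 2] (M.V ⊗[ZMod 2] (Kh A ⊗[ZMod 2] M.V)) →ₗ[ZMod 2]
    (ℕ × ℕ →₀ M.V) ⊗[ZMod 2] (ℕ × ℕ →₀ M.V) :=
  Vm M ∘ₗ TensorProduct.map (Sm M) (Sm M) ∘ₗ (TensorProduct.assoc (ZMod 2) _ _ _).symm.toLinearMap

theorem Wm_s (w a b m w' a' b' m') : Wm M (sn w (a ⊗ₜ b) ⊗ₜ (m ⊗ₜ (sn w' (a' ⊗ₜ b') ⊗ₜ m'))) =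
    Finsupp.single w (M.actR (M.actL b m) a') ⊗ₜ Finsupp.single w' (M.actR (M.actL b' m') a) := by
  simp [Wm, Sm_s, Vm_s, RZ_s]

/-- induction principle -/
theorem Wext {X : Type} [AddCommGroup X] [Module (ZMod 2) X]
    {f g : Kh A → M.V → Kh A → M.V → X}
    (f1 : ∀ m κ' m' x y, f (x + y) m κ' m' = f x m κ' m' + f y m κ' m')
    (f3 : ∀ κ m m' x y, f κ m (x + y) m' = f κ m x m' + f κ m y m')
    (g1 : ∀ m κ' m' x y, g (x + y) m κ' m' = g x m κ' m' + g y m κ' m')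
    (g3 : ∀ κ m m' x y, g κ m (x + y) m' = g κ m x m' + g κ m y m')
    (h : ∀ i j a b m i' j' a' b' m', f (sn (i, j) (a ⊗ₜ b)) m (sn (i', j') (a' ⊗ₜ b')) m' =
      g (sn (i, j) (a ⊗ₜ b)) m (sn (i', j') (a' ⊗ₜ b')) m') (κ m κ' m') : f κ m κ' m' = g κ m κ' m' := by
  have key : ∀ (F G : Kh A → X), (∀ x y, F (x + y) = F x + F y) → (∀ x y, G (x + y) = G x + G y) →
      (∀ i j a b, F (sn (i, j) (a ⊗ₜ b)) = G (sn (i, j) (a ⊗ₜ b))) → ∀ κ, F κ = G κ := by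
    intro F G hF hG hs κ
    have := Khext (f := (AddMonoidHom.mk' F hF).toZModLinearMap 2)
      (g := (AddMonoidHom.mk' G hG).toZModLinearMap 2) hs
    exact LinearMap.congr_fun this κ
  apply key (fun κ => f κ m κ' m') (fun κ => g κ m κ' m') (f1 _ _ _) (g1 _ _ _)
  intro i j a b
  apply key (fun κ' => f _ m κ' m') (fun κ' => g _ m κ' m') (f3 _ _ _) (g3 _ _ _)
  intro i' j' a' b'
  exact h _ _ _ _ _ _ _ _ _ _

theorem Wm_sw (κ m κ' m') : Wm M (κ' ⊗ₜ (m' ⊗ₜ (κ ⊗ₜ m))) = sw _ (Wm M (κ ⊗ₜ (m ⊗ₜ (κ' ⊗ₜ m')))) := by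
  apply Wext M (f := fun κ m κ' m' => Wm M (κ' ⊗ₜ (m' ⊗ₜ (κ ⊗ₜ m))))
    (g := fun κ m κ' m' => sw _ (Wm M (κ ⊗ₜ (m ⊗ₜ (κ' ⊗ₜ m')))))
  any_goals (intros; simp only [map_add, add_tmul, tmul_add])
  intros
  simp only [Wm_s, sw_tmul]

theorem Wm_1 (c κ m κ' m') : Wm M (RK κ c ⊗ₜ (m ⊗ₜ (κ' ⊗ₜ m'))) = Wm M (κ ⊗ₜ (M.actL c m ⊗ₜ (κ' ⊗ₜ m'))) := by
  apply Wext M (f := fun κ m κ' m' => Wm M (RK κ c ⊗ₜ (m ⊗ₜ (κ' ⊗ₜ m'))))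
    (g := fun κ m κ' m' => Wm M (κ ⊗ₜ (M.actL c m ⊗ₜ (κ' ⊗ₜ m'))))
  any_goals (intros; simp [add_tmul, tmul_add])
  intros
  simp only [Wm_s, RK_s, M.actL_mul]

theorem Wm_2 (c κ m κ' m') : Wm M (LK c κ ⊗ₜ (m ⊗ₜ (κ' ⊗ₜ m'))) = Wm M (κ ⊗ₜ (m ⊗ₜ (κ' ⊗ₜ M.actR m' c))) := by
  apply Wext M (f := fun κ m κ' m' => Wm M (LK c κ ⊗ₜ (m ⊗ₜ (κ' ⊗ₜ m'))))
    (g := fun κ m κ' m' => Wm M (κ ⊗ₜ (m ⊗ₜ (κ' ⊗ₜ M.actR m' c))))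
  any_goals (intros; simp [add_tmul, tmul_add])
  intros
  simp only [Wm_s, LK_s, M.actLR, M.actR_mul]

theorem Wm_3 (c κ m κ' m') : Wm M (κ ⊗ₜ (M.actR m c ⊗ₜ (κ' ⊗ₜ m'))) = Wm M (κ ⊗ₜ (m ⊗ₜ (LK c κ' ⊗ₜ m'))) := by
  rw [Wm_sw, ← Wm_2, Wm_sw M (LK c κ') m' κ m]

theorem Wm_4 (c κ m κ' m') : Wm M (κ ⊗ₜ (m ⊗ₜ (RK κ' c ⊗ₜ m'))) = Wm M (κ ⊗ₜ (m ⊗ₜ (κ' ⊗ₜ M.actL c m'))) := by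
  rw [Wm_sw M _ _ κ, Wm_1, ← Wm_sw]

theorem Wm_d (hd : A.d = 0) (κ m κ' m') : (K.md hd M).dX (Wm M (κ ⊗ₜ (m ⊗ₜ (κ' ⊗ₜ m')))) =
    Wm M (K.dK κ ⊗ₜ (m ⊗ₜ (κ' ⊗ₜ m'))) + Wm M (κ ⊗ₜ (M.d m ⊗ₜ (κ' ⊗ₜ m'))) +
    Wm M (κ ⊗ₜ (m ⊗ₜ (K.dK κ' ⊗ₜ m'))) + Wm M (κ ⊗ₜ (m ⊗ₜ (κ' ⊗ₜ M.d m'))) := by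
  apply Wext M (f := fun κ m κ' m' => (K.md hd M).dX (Wm M (κ ⊗ₜ (m ⊗ₜ (κ' ⊗ₜ m')))))
    (g := fun κ m κ' m' => Wm M (K.dK κ ⊗ₜ (m ⊗ₜ (κ' ⊗ₜ m'))) + Wm M (κ ⊗ₜ (M.d m ⊗ₜ (κ' ⊗ₜ m'))) +
    Wm M (κ ⊗ₜ (m ⊗ₜ (K.dK κ' ⊗ₜ m'))) + Wm M (κ ⊗ₜ (m ⊗ₜ (κ' ⊗ₜ M.d m'))))
  any_goals (intros; simp only [map_add, add_tmul, tmul_add]; try abel)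
  intro i j a b m i' j' a' b' m'
  simp only [Wm_s, dX, LinearMap.add_apply, D1_s, D2_s, dK_s]
  by_cases h : i < j <;> by_cases h' : i' < j'
  · simp only [h, h', if_true, add_tmul, tmul_add, map_add, Wm_s, md, DdL hd, DdR hd, LinearMap.flip_apply, M.actL_mul, M.actLR, M.actR_mul]
    abel
  · simp only [h, h', if_true, if_false, add_tmul, tmul_add, map_add, Wm_s, md, DdL hd, DdR hd, LinearMap.flip_apply, M.actL_mul, M.actLR, M.actR_mul, zero_tmul, tmul_zero, map_zero]
    abel
  · simp only [h, h', if_true, if_false, add_tmul, tmul_add, map_add, Wm_s, md, DdL hd, DdR hd, LinearMap.flip_apply, M.actL_mul, M.actLR, M.actR_mul, zero_tmul, tmul_zero, map_zero]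
    abel
  · simp only [h, h', if_true, if_false, add_tmul, tmul_add, map_add, Wm_s, md, DdL hd, DdR hd, LinearMap.flip_apply, M.actL_mul, M.actLR, M.actR_mul, zero_tmul, tmul_zero, map_zero]
    abel

theorem Wm_E (κ m κ' m') : TensorProduct.map (Fl (valid P N)) (Fl (valid P N)) (Wm M (K.piK κ ⊗ₜ (m ⊗ₜ (K.piK κ' ⊗ₜ m'))))
    = Wm M (K.piK κ ⊗ₜ (m ⊗ₜ (K.piK κ' ⊗ₜ m'))) := by
  apply Wext M (f := fun κ m κ' m' => TensorProduct.map (Fl (valid P N)) (Fl (valid P N)) (Wm M (K.piK κ ⊗ₜ (m ⊗ₜ (K.piK κ' ⊗ₜ m')))))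
    (g := fun κ m κ' m' => Wm M (K.piK κ ⊗ₜ (m ⊗ₜ (K.piK κ' ⊗ₜ m'))))
  any_goals (intros; simp only [map_add, add_tmul, tmul_add])
  intro i j a b m i' j' a' b' m'
  simp only [piK_s]
  by_cases h : valid P N (i, j) <;> by_cases h' : valid P N (i', j')
  · simp only [h, h', if_true, Wm_s, TensorProduct.map_tmul, Fl_s]
  · simp only [h, h', if_false, zero_tmul, tmul_zero, map_zero]
  · simp only [h, h', if_false, zero_tmul, tmul_zero, map_zero]
  · simp only [h, h', if_false, zero_tmul, tmul_zero, map_zero]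
end

namespace Gam
variable {K : KD A P N} {R : DGBimod A} {ρ : R.V →ₗ[ZMod 2] A.diag.V} (G : Gam K R ρ) (M : DGBimod A)

def G1 : (ℕ × ℕ →₀ M.V) →ₗ[ZMod 2] R.V ⊗[ZMod 2] M.V :=
  Finsupp.lsum (ZMod 2) (fun w => TensorProduct.mk (ZMod 2) R.V M.V (G.g w))

def Gm : (ℕ × ℕ →₀ M.V) ⊗[ZMod 2] (ℕ × ℕ →₀ M.V) →ₗ[ZMod 2] T4 R M :=
  (TensorProduct.assoc (ZMod 2) R.V M.V (R.V ⊗[ZMod 2] M.V)).toLinearMap ∘ₗ TensorProduct.map (G.G1 M) (G.G1 M)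

theorem Gm_s (w m w' m') : G.Gm M (Finsupp.single w m ⊗ₜ Finsupp.single w' m') =
    G.g w ⊗ₜ (m ⊗ₜ (G.g w' ⊗ₜ m')) := by
  simp [Gm, G1]

theorem Gm_sw (x) : G.Gm M (sw _ x) = tau4 R M (G.Gm M x) := by
  have : (G.Gm M).comp (sw _) = (tau4 R M).comp (G.Gm M) := by
    apply ZZext
    intros
    simp only [LinearMap.comp_apply, sw_tmul, Gm_s, tau4_tmul]
  exact LinearMap.congr_fun this x

theorem q_eq {x y : T4 R M} (h : x + y ∈ rel4 R M) : (rel4 R M).mkQ x = (rel4 R M).mkQ y := by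
  apply c2eq
  rw [← map_add]
  exact (Submodule.Quotient.mk_eq_zero _).2 h

theorem of_q_eq {x y : T4 R M} (h : (rel4 R M).mkQ x = (rel4 R M).mkQ y) : x + y ∈ rel4 R M := by
  refine (Submodule.Quotient.mk_eq_zero _).1 ?_
  change (rel4 R M).mkQ (x + y) = 0
  rw [map_add, h, c2]

theorem q1 (r a m r' m') : (rel4 R M).mkQ (R.actR r a ⊗ₜ (m ⊗ₜ (r' ⊗ₜ m'))) =
    (rel4 R M).mkQ (r ⊗ₜ (M.actL a m ⊗ₜ (r' ⊗ₜ m'))) := q_eq M (rel_1 R M r a m r' m')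
theorem q2 (r a m r' m') : (rel4 R M).mkQ (R.actL a r ⊗ₜ (m ⊗ₜ (r' ⊗ₜ m'))) =
    (rel4 R M).mkQ (r ⊗ₜ (m ⊗ₜ (r' ⊗ₜ M.actR m' a))) := q_eq M (rel_2 R M r a m r' m')
theorem q3 (r a m r' m') : (rel4 R M).mkQ (r ⊗ₜ (m ⊗ₜ (R.actL a r' ⊗ₜ m'))) =
    (rel4 R M).mkQ (r ⊗ₜ (M.actR m a ⊗ₜ (r' ⊗ₜ m'))) := (q_eq M (rel_3 R M r a m r' m')).symm
theorem q4 (r a m r' m') : (rel4 R M).mkQ (r ⊗ₜ (m ⊗ₜ (R.actR r' a ⊗ₜ m'))) =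
    (rel4 R M).mkQ (r ⊗ₜ (m ⊗ₜ (r' ⊗ₜ M.actL a m'))) := q_eq M (rel_4 R M r a m r' m')

theorem Gm_d (hd : A.d = 0) (x) : G.Gm M ((K.md hd M).dX x) + d4 R M (G.Gm M x) ∈ rel4 R M := by
  apply of_q_eq
  have : (rel4 R M).mkQ.comp ((G.Gm M).comp (K.md hd M).dX) = (rel4 R M).mkQ.comp ((d4 R M).comp (G.Gm M)) := by
    apply ZZext
    intro i j m i' j' m'
    simp only [LinearMap.comp_apply, dX, LinearMap.add_apply, D1_s, D2_s, Gm_s, d4_tmul, dg]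
    by_cases h : i < j <;> by_cases h' : i' < j' <;>
    · simp only [h, h', if_true, if_false, add_tmul, tmul_add, map_add, Gm_s, zero_tmul, tmul_zero, map_zero, add_zero, q1, q2, q3, q4, md, LinearMap.flip_apply]
      abel
  exact LinearMap.congr_fun this x

theorem Gm_W (κ m κ' m') : G.Gm M (Wm M (κ ⊗ₜ (m ⊗ₜ (κ' ⊗ₜ m')))) + G.gh κ ⊗ₜ (m ⊗ₜ (G.gh κ' ⊗ₜ m')) ∈ rel4 R M := by
  apply of_q_eq
  apply Wext M (f := fun κ m κ' m' => (rel4 R M).mkQ (G.Gm M (Wm M (κ ⊗ₜ (m ⊗ₜ (κ' ⊗ₜ m'))))))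
    (g := fun κ m κ' m' => (rel4 R M).mkQ (G.gh κ ⊗ₜ (m ⊗ₜ (G.gh κ' ⊗ₜ m'))))
  any_goals (intros; simp only [map_add, add_tmul, tmul_add])
  intro i j a b m i' j' a' b' m'
  simp only [Wm_s, Gm_s, gh_s]
  rw [q1, q2, q4, q3, M.actLR, M.actLR]

theorem piFormal (G : Gam K R ρ) (M : DGBimod A) (hd : A.d = 0) (h : IsResolution R A.diag ρ) (hK : K.Acyc) : PiFormalBimod R M := by
  obtain ⟨η, H, η1, η2, ηL, ηR, HL, HR, hh⟩ := G.hH hd h hK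
  apply collapse_of_Pgr R M hd (Pgr_of_Pun R M ?_)
  apply Pun_of_model R M (G.gh ∘ₗ η) H
  · intro x; simp only [LinearMap.comp_apply, ← η2, G.gh_d hd]
  · intro a x; simp only [LinearMap.comp_apply, ηL, gh_L]
  · intro a x; simp only [LinearMap.comp_apply, ηR, gh_R]
  · exact HL
  · exact HR
  · exact hh
  let T : T4 R M →ₗ[ZMod 2] (ℕ × ℕ →₀ M.V) ⊗[ZMod 2] (ℕ × ℕ →₀ M.V) :=
    Wm M ∘ₗ TensorProduct.map η (TensorProduct.map LinearMap.id (TensorProduct.map η LinearMap.id))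
  have Ts : ∀ r m r' m', T (r ⊗ₜ (m ⊗ₜ (r' ⊗ₜ m'))) = Wm M (η r ⊗ₜ (m ⊗ₜ (η r' ⊗ₜ m'))) := by
    intros; simp [T]
  clear_value T
  have Tr : ∀ z ∈ rel4 R M, T z = 0 := by
    have : rel4 R M ≤ LinearMap.ker T := by
      apply rel_le <;> intro r a m r' m' <;> rw [LinearMap.mem_ker, map_add, Ts, Ts]
      · rw [ηR, Wm_1, c2]
      · rw [ηL, Wm_2, c2]
      · rw [ηL, Wm_3, c2]
      · rw [ηR, Wm_4, c2]
    exact fun z hz => this hz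
  have Tt : ∀ z, T (tau4 R M z) = sw _ (T z) := by
    intro z
    have : T.comp (tau4 R M) = (sw _).comp T := by
      apply T4ext; intro r m r' m'
      rw [LinearMap.comp_apply, LinearMap.comp_apply, tau4_tmul, Ts, Ts, Wm_sw]
    exact LinearMap.congr_fun this z
  have Td : ∀ z, (K.md hd M).dX (T z) = T (d4 R M z) := by
    intro z
    have : (K.md hd M).dX.comp T = T.comp (d4 R M) := by
      apply T4ext; intro r m r' m'
      rw [LinearMap.comp_apply, LinearMap.comp_apply, d4_tmul, Ts, Wm_d]
      simp only [map_add, Ts, η2]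
    exact LinearMap.congr_fun this z
  have TE : ∀ z, TensorProduct.map (Fl (valid P N)) (Fl (valid P N)) (T z) = T z := by
    intro z
    have : (TensorProduct.map (Fl (valid P N)) (Fl (valid P N))).comp T = T := by
      apply T4ext; intro r m r' m'
      rw [LinearMap.comp_apply, Ts, ← η1 r, ← η1 r', Wm_E]
    exact LinearMap.congr_fun this z
  have TG : ∀ z, bm R M (G.gh ∘ₗ η) (G.gh ∘ₗ η) z + G.Gm M (T z) ∈ rel4 R M := by
    intro z
    apply of_q_eq
    have : (rel4 R M).mkQ.comp (bm R M (G.gh ∘ₗ η) (G.gh ∘ₗ η)) = (rel4 R M).mkQ.comp ((G.Gm M).comp T) := by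
      apply T4ext; intro r m r' m'
      rw [LinearMap.comp_apply, LinearMap.comp_apply, LinearMap.comp_apply, bm_tmul, Ts]
      exact (q_eq M (G.Gm_W M (η r) m (η r') m')).symm
    exact LinearMap.congr_fun this z
  intro z0 z1 z2 h0 h1 h2
  have k0 := Tr _ h0
  have k1 := Tr _ h1
  have k2 := Tr _ h2
  rw [map_add, Tt] at k0
  rw [map_add, map_add, Tt, ← Td] at k1 k2
  obtain ⟨t0, t1, u, ht0, ht1, ht2, hu⟩ := (K.md hd M).X_claim (T z0) (T z1) (T z2) (TE z0)
    (c2eq k0).symm (c2eq k1) (c2eq k2)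
  refine ⟨G.Gm M t0, G.Gm M t1, G.Gm M u, ?_, ?_, ?_, ?_⟩
  · rw [← Gm_sw, ht0, c2]; exact Submodule.zero_mem _
  · have := G.Gm_d M hd t0
    rw [ht1, map_add, Gm_sw, add_comm] at this
    exact this
  · have := G.Gm_d M hd t1
    rw [ht2, map_zero, zero_add] at this
    exact this
  · have := TG z0
    rw [hu, map_add, map_add, Gm_sw] at this
    rw [add_assoc]; exact this
end Gam

theorem piFormal (K : KD A P N) (hd : A.d = 0) (hK : K.Acyc) {R : DGBimod A} {ρ : R.V →ₗ[ZMod 2] A.diag.V}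
    (h : IsResolution R A.diag ρ) (M : DGBimod A) : PiFormalBimod R M := by
  obtain ⟨γ, h1, h2, h3, h4, h5⟩ := gam_ex K hd h
  exact Gam.piFormal (K := K) ⟨γ, h1, h2, h3, h4, h5⟩ M hd h hK
end KD

namespace KD
open MD
variable {A : DGA (ZMod 2)} {P N : ℕ}
local notation "sn" => Finsupp.single (M := A.V ⊗[ZMod 2] A.V)

/-- Path basis data adapted to the Koszul data. -/
structure PD (K : KD A P N) where
  p : ℕ → ℕ → A.V
  kp : ℕ → ℕ
  B : Module.Basis {w : ℕ × ℕ // valid P N w} (ZMod 2) A.V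
  Bp : ∀ w, B w = p w.1.1 w.1.2
  kN : ∀ i, i < N → kp i < N
  kk : ∀ i, i < N → kp (kp i) = i
  kmod : ∀ i, i < N → kp i % P = i % P
  k1 : ∀ i t, 1 ≤ t → t ≤ N → i < N → t % P = i % P → t ≠ kp i → 1 ≤ i ∧ t - 1 = kp (i - 1)
  k2 : ∀ i, i + 1 < N → kp (i + 1) ≠ kp i + 1
  F0 : ∀ s, p s s = K.e s
  F1 : ∀ s t i, s ≤ t → A.mul (p s t) (K.e i) = if t % P = i % P then p s t else 0
  F2 : ∀ s t i, s ≤ t → A.mul (K.e i) (p s t) = if s % P = i % P then p s t else 0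
  F3 : ∀ s t i, s < t → i < N → A.mul (p s t) (K.x i) = if t = kp i then p s (t + 1) else 0
  F3' : ∀ i, i < N → K.x i = p (kp i) (kp i + 1)
  F4 : ∀ l t, l < N → l + 1 ≤ t → A.mul (K.x (kp l)) (p (l + 1) t) = p l t

namespace PD
variable {K : KD A P N} (D : PD K)

theorem per (s) : K.e s = D.p (s % P) (s % P) := by rw [D.F0, K.per]

theorem vd (K : KD A P N) (v) : valid P N (v % P, v % P) := Or.inr ⟨rfl, Nat.mod_lt _ K.hP⟩

theorem ind {X : Type} [AddCommGroup X] [Module (ZMod 2) X] {f g : A.V →ₗ[ZMod 2] X}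
    (h1 : ∀ s t, s < t → t ≤ N → f (D.p s t) = g (D.p s t)) (h2 : ∀ v, f (K.e v) = g (K.e v)) : f = g := by
  apply D.B.ext
  rintro ⟨⟨s, t⟩, h⟩
  rw [D.Bp]
  rcases h with ⟨h, h'⟩ | ⟨h, h'⟩
  · exact h1 s t h h'
  · simp only at h h' ⊢
    subst h
    rw [D.F0]; exact h2 s

def cst {X : Type} [AddCommGroup X] [Module (ZMod 2) X] (f : ℕ → ℕ → X) : A.V →ₗ[ZMod 2] X :=
  D.B.constr (ZMod 2) (fun w => f w.1.1 w.1.2)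

theorem cst_p {X : Type} [AddCommGroup X] [Module (ZMod 2) X] (f : ℕ → ℕ → X) (s t) (h : s < t) (h' : t ≤ N) :
    D.cst f (D.p s t) = f s t := by
  have := D.B.constr_basis (ZMod 2) (fun w => f w.1.1 w.1.2) ⟨(s, t), Or.inl ⟨h, h'⟩⟩
  rw [D.Bp] at this
  exact this

theorem cst_e {X : Type} [AddCommGroup X] [Module (ZMod 2) X] (f : ℕ → ℕ → X) (v) :
    D.cst f (K.e v) = f (v % P) (v % P) := by
  have := D.B.constr_basis (ZMod 2) (fun w => f w.1.1 w.1.2) ⟨(v % P, v % P), vd K v⟩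
  rw [D.Bp] at this
  rw [D.per]
  exact this

/-- truncation of the last arrow -/
def dl (i : ℕ) : A.V →ₗ[ZMod 2] A.V :=
  D.cst (fun s t => if s < t ∧ i < N ∧ t = D.kp i + 1 then D.p s (t - 1) else 0)

theorem dl_p (i s t) (h : s < t) (h' : t ≤ N) : D.dl i (D.p s t) = if i < N ∧ t = D.kp i + 1 then D.p s (t - 1) else 0 := by
  rw [dl, cst_p _ _ _ _ h h']; simp [h]

theorem dl_e (i v) : D.dl i (K.e v) = 0 := by
  rw [dl, cst_e]; simp

theorem ee (D : PD K) (i j) : A.mul (K.e i) (K.e j) = if i % P = j % P then K.e i else 0 := by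
  rw [← D.F0 i, D.F1 _ _ _ le_rfl]

theorem ex (D : PD K) (v i) (hi : i < N) : A.mul (K.e v) (K.x i) = if v % P = i % P then K.x i else 0 := by
  rw [D.F3' i hi, D.F2 _ _ _ (by omega), D.kmod i hi]
  simp only [eq_comm]

theorem dl_x (i) (hi : i < N) (a) : D.dl i (A.mul a (K.x i)) = A.mul a (K.e i) +
    if 1 ≤ i then A.mul (D.dl (i - 1) a) (K.x (i - 1)) else 0 := by
  have : (D.dl i) ∘ₗ (A.mul.flip (K.x i)) = A.mul.flip (K.e i) +
    if 1 ≤ i then (A.mul.flip (K.x (i - 1))) ∘ₗ D.dl (i - 1) else 0 := by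
    apply D.ind
    · intro s t h h'
      have e : ((if 1 ≤ i then (A.mul.flip (K.x (i - 1))) ∘ₗ D.dl (i - 1) else 0 : A.V →ₗ[ZMod 2] A.V)) (D.p s t) =
        if 1 ≤ i then A.mul (D.dl (i - 1) (D.p s t)) (K.x (i - 1)) else 0 := by split_ifs <;> rfl
      rw [LinearMap.add_apply, e]
      simp only [LinearMap.comp_apply, LinearMap.flip_apply]
      rw [D.F3 _ _ _ h hi, D.F1 _ _ _ h.le, dl_p _ _ _ _ h h']
      have hkN := D.kN i hi
      have hkm := D.kmod i hi
      by_cases h1 : t = D.kp i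
      · rw [if_pos h1, dl_p _ _ _ _ (by omega) (by omega), if_pos (by omega), if_pos (by rw [h1, hkm])]
        split_ifs with h2 h3
        · exfalso
          refine D.k2 (i - 1) (by omega) ?_
          rw [Nat.sub_add_cancel h2]; omega
        · simp
        · simp
      · rw [if_neg h1]
        by_cases h2 : t % P = i % P
        · obtain ⟨h3, h4⟩ := D.k1 i t (by omega) h' hi h2 h1
          rw [if_pos h2, if_pos h3, if_pos ⟨by omega, by omega⟩, map_zero]
          by_cases h5 : s < t - 1
          · rw [D.F3 _ _ _ h5 (by omega), if_pos h4, Nat.sub_add_cancel (by omega), c2]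
          · have : s = t - 1 := by omega
            rw [this, D.F0, D.ex _ _ (by omega), if_pos, D.F3' _ (by omega), ← h4, Nat.sub_add_cancel (by omega), c2]
            rw [h4, D.kmod _ (by omega)]
        · rw [if_neg h2]
          split_ifs with h3 h4
          · exfalso
            apply h2
            rw [h4.2, Nat.add_mod, D.kmod _ h4.1, ← Nat.add_mod, Nat.sub_add_cancel h3]
          · simp
          · simp
    · intro v
      have e : ((if 1 ≤ i then (A.mul.flip (K.x (i - 1))) ∘ₗ D.dl (i - 1) else 0 : A.V →ₗ[ZMod 2] A.V)) (K.e v) = 0 := by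
        split_ifs
        · simp [dl_e]
        · rfl
      rw [LinearMap.add_apply, e]
      simp only [LinearMap.comp_apply, LinearMap.flip_apply]
      rw [D.ex _ _ hi, D.ee, add_zero]
      split_ifs with h
      · have := D.kN i hi
        rw [D.F3' _ hi, dl_p _ _ _ _ (by omega) (by omega), if_pos ⟨hi, rfl⟩, Nat.add_sub_cancel, D.F0, ← K.per,
          D.kmod _ hi, ← h, K.per]
      · simp
  have := LinearMap.congr_fun this a
  rw [LinearMap.add_apply] at this
  rw [LinearMap.comp_apply, LinearMap.flip_apply] at this
  rw [this]
  split_ifs <;> rfl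

/-- the noncommutative differential -/
def dd : A.V →ₗ[ZMod 2] Kh A :=
  D.cst (fun s t => ∑ l ∈ Finset.Ico s t, sn (D.kp l, D.kp l + 1) (D.p s l ⊗ₜ D.p (l + 1) t))

theorem dd_p (s t) (h : s < t) (h' : t ≤ N) : D.dd (D.p s t) =
    ∑ l ∈ Finset.Ico s t, sn (D.kp l, D.kp l + 1) (D.p s l ⊗ₜ D.p (l + 1) t) := by
  rw [dd, cst_p _ _ _ _ h h']

theorem dd_e (v) : D.dd (K.e v) = 0 := by
  rw [dd, cst_e]; simp

theorem dd_x (i) (hi : i < N) (a) : RK (D.dd (A.mul a (K.x i))) (K.e (i + 1)) + RK (D.dd (A.mul a (K.e i))) (K.x i) =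
    sn (i, i + 1) (A.mul a (K.e i) ⊗ₜ K.e (i + 1)) +
    if 1 ≤ i then sn (i, i + 1) (A.mul (D.dl (i - 1) a) (K.x (i - 1)) ⊗ₜ K.e (i + 1)) +
      sn (i - 1, i) (D.dl (i - 1) a ⊗ₜ K.x i) else 0 := by
  have : (RK.flip (K.e (i + 1))) ∘ₗ D.dd ∘ₗ (A.mul.flip (K.x i)) + (RK.flip (K.x i)) ∘ₗ D.dd ∘ₗ (A.mul.flip (K.e i)) =
     Finsupp.lsingle (i, i + 1) ∘ₗ (TensorProduct.mk (ZMod 2) A.V A.V).flip (K.e (i + 1)) ∘ₗ (A.mul.flip (K.e i)) +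
     if 1 ≤ i then Finsupp.lsingle (i, i + 1) ∘ₗ (TensorProduct.mk (ZMod 2) A.V A.V).flip (K.e (i + 1)) ∘ₗ
       (A.mul.flip (K.x (i - 1))) ∘ₗ (D.dl (i - 1)) +
       Finsupp.lsingle (i - 1, i) ∘ₗ (TensorProduct.mk (ZMod 2) A.V A.V).flip (K.x i) ∘ₗ (D.dl (i - 1)) else 0 := by
    have e : ∀ a, ((if 1 ≤ i then Finsupp.lsingle (i, i + 1) ∘ₗ (TensorProduct.mk (ZMod 2) A.V A.V).flip (K.e (i + 1)) ∘ₗ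
       (A.mul.flip (K.x (i - 1))) ∘ₗ (D.dl (i - 1)) +
       Finsupp.lsingle (i - 1, i) ∘ₗ (TensorProduct.mk (ZMod 2) A.V A.V).flip (K.x i) ∘ₗ (D.dl (i - 1)) else 0 : A.V →ₗ[ZMod 2] Kh A)) a =
       if 1 ≤ i then sn (i, i + 1) (A.mul (D.dl (i - 1) a) (K.x (i - 1)) ⊗ₜ K.e (i + 1)) +
      sn (i - 1, i) (D.dl (i - 1) a ⊗ₜ K.x i) else 0 := by intro a; split_ifs <;> rfl
    have hkN := D.kN i hi
    have hkm := D.kmod i hi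
    apply D.ind
    · intro s t h h'
      rw [LinearMap.add_apply, LinearMap.add_apply, e]
      simp only [LinearMap.comp_apply, LinearMap.flip_apply, Finsupp.lsingle_apply, TensorProduct.mk_apply]
      rw [D.F3 _ _ _ h hi, D.F1 _ _ _ h.le, dl_p _ _ _ _ h h']
      by_cases h1 : t = D.kp i
      · have h3 : ¬ (1 ≤ i ∧ i - 1 < N ∧ t = D.kp (i - 1) + 1) := by
          rintro ⟨h2, h3, h4⟩
          refine D.k2 (i - 1) (by omega) ?_
          rw [Nat.sub_add_cancel h2]; omega
        have h2 : (if 1 ≤ i then sn (i, i + 1) (A.mul (if i - 1 < N ∧ t = D.kp (i - 1) + 1 then D.p s (t - 1) else 0) (K.x (i - 1)) ⊗ₜ K.e (i + 1)) +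
          sn (i - 1, i) ((if i - 1 < N ∧ t = D.kp (i - 1) + 1 then D.p s (t - 1) else 0) ⊗ₜ K.x i) else 0) = 0 := by
          split_ifs with h4 h5
          · exact absurd ⟨h4, h5⟩ h3
          · simp
          · rfl
        rw [h2, if_pos h1, if_pos (by rw [h1, hkm]), dd_p _ _ _ h h', dd_p _ _ _ (by omega) (by omega), add_zero]
        rw [map_sum, map_sum, LinearMap.sum_apply, LinearMap.sum_apply]
        simp only [RK_s]
        rw [Finset.sum_Ico_succ_top h.le]
        have e1 : ∀ l ∈ Finset.Ico s t, sn (D.kp l, D.kp l + 1) (D.p s l ⊗ₜ A.mul (D.p (l + 1) (t + 1)) (K.e (i + 1))) =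
            sn (D.kp l, D.kp l + 1) (D.p s l ⊗ₜ A.mul (D.p (l + 1) t) (K.x i)) := by
          intro l hl
          rw [Finset.mem_Ico] at hl
          have : (t + 1) % P = (i + 1) % P := by rw [h1, Nat.add_mod, hkm, ← Nat.add_mod]
          rw [D.F1 _ _ _ (by omega), if_pos this]
          by_cases hl2 : l + 1 < t
          · rw [D.F3 _ _ _ hl2 hi, if_pos h1]
          · have : l + 1 = t := by omega
            rw [this, D.F0, D.ex _ _ hi, if_pos (by rw [h1, hkm]), D.F3' _ hi, ← h1]
        rw [Finset.sum_congr rfl e1, add_right_comm, c2, zero_add, D.F0, D.ee, if_pos, h1, D.kk _ hi,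
          ← K.per (D.kp i + 1), ← K.per (i + 1), Nat.add_mod, hkm, ← Nat.add_mod]
        rw [h1, Nat.add_mod, hkm, ← Nat.add_mod]
      · rw [if_neg h1]
        by_cases h2 : t % P = i % P
        · obtain ⟨h3, h4⟩ := D.k1 i t (by omega) h' hi h2 h1
          rw [if_pos h2, if_pos h3, if_pos ⟨by omega, by omega⟩]
          have hx : A.mul (D.p s (t - 1)) (K.x (i - 1)) = D.p s t := by
            by_cases h5 : s < t - 1
            · rw [D.F3 _ _ _ h5 (by omega), if_pos h4, Nat.sub_add_cancel (by omega)]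
            · have : s = t - 1 := by omega
              rw [this, D.F0, D.ex _ _ (by omega), if_pos, D.F3' _ (by omega), ← h4, Nat.sub_add_cancel (by omega)]
              rw [h4, D.kmod _ (by omega)]
          rw [hx, c2', map_zero, map_zero, LinearMap.zero_apply, zero_add, dd_p _ _ _ h h', map_sum, LinearMap.sum_apply]
          simp only [RK_s]
          rw [Finset.sum_eq_single (t - 1)]
          · rw [h4, D.kk _ (by omega), ← h4, Nat.sub_add_cancel (by omega : 1 ≤ t), Nat.sub_add_cancel h3, D.F0, D.ex _ _ hi, if_pos h2]
          · intro l hl hl'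
            rw [Finset.mem_Ico] at hl
            rw [D.F3 _ _ _ (by omega) hi, if_neg h1]; simp
          · intro hl; simp at hl; omega
        · rw [if_neg h2]
          split_ifs with h3 h4
          · exfalso
            apply h2
            rw [h4.2, Nat.add_mod, D.kmod _ h4.1, ← Nat.add_mod, Nat.sub_add_cancel h3]
          · simp
          · simp
    · intro v
      rw [LinearMap.add_apply, LinearMap.add_apply, e]
      simp only [LinearMap.comp_apply, LinearMap.flip_apply, Finsupp.lsingle_apply, TensorProduct.mk_apply]
      rw [D.ex _ _ hi, D.ee, dl_e]
      simp only [map_zero, LinearMap.zero_apply, zero_tmul, Finsupp.single_zero, add_zero, ite_self]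
      split_ifs with h
      · rw [D.F3' _ hi, dd_p _ _ _ (by omega) (by omega), dd_e]
        simp only [Nat.Ico_succ_singleton, Finset.sum_singleton, map_zero, LinearMap.zero_apply, add_zero, RK_s, D.F0]
        rw [D.kk _ hi, D.ee]
        have : (D.kp i + 1) % P = (i + 1) % P := by rw [Nat.add_mod, hkm, ← Nat.add_mod]
        rw [if_pos this, ← K.per (D.kp i), hkm, ← h, K.per, ← K.per (D.kp i + 1), this, K.per]
      · simp
  have := LinearMap.congr_fun this a
  rw [LinearMap.add_apply, LinearMap.add_apply] at this
  simp only [LinearMap.comp_apply, LinearMap.flip_apply] at this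
  rw [this]
  split_ifs <;> rfl

theorem d_dd (a) : K.dK (D.dd a) = (∑ v ∈ Finset.range P, sn (v, v) (A.mul a (K.e v) ⊗ₜ K.e v)) + K.s0 a := by
  have : K.dK ∘ₗ D.dd = (∑ v ∈ Finset.range P, Finsupp.lsingle (v, v) ∘ₗ (TensorProduct.mk (ZMod 2) A.V A.V).flip (K.e v)
      ∘ₗ A.mul.flip (K.e v)) + K.s0 := by
    have e1 : ∀ s t, s ≤ t → ∑ v ∈ Finset.range P, sn (v, v) (A.mul (D.p s t) (K.e v) ⊗ₜ K.e v) =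
        sn (t % P, t % P) (D.p s t ⊗ₜ K.e t) := by
      intro s t h
      rw [Finset.sum_eq_single (t % P)]
      · rw [D.F1 _ _ _ h, if_pos (by simp), K.per]
      · intro v hv hv'
        rw [Finset.mem_range] at hv
        rw [D.F1 _ _ _ h, if_neg (by rw [Nat.mod_eq_of_lt hv]; exact hv'.symm)]; simp
      · intro h; exact absurd (Finset.mem_range.2 (Nat.mod_lt _ K.hP)) h
    have e2 : ∀ s t, s ≤ t → K.s0 (D.p s t) = sn (s % P, s % P) (K.e s ⊗ₜ D.p s t) := by
      intro s t h
      rw [s0_apply, Finset.sum_eq_single (s % P)]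
      · rw [D.F2 _ _ _ h, if_pos (by simp), K.per]
      · intro v hv hv'
        rw [Finset.mem_range] at hv
        rw [D.F2 _ _ _ h, if_neg (by rw [Nat.mod_eq_of_lt hv]; exact hv'.symm)]; simp
      · intro h; exact absurd (Finset.mem_range.2 (Nat.mod_lt _ K.hP)) h
    apply D.ind
    · intro s t h h'
      simp only [LinearMap.add_apply, LinearMap.sum_apply, LinearMap.comp_apply, LinearMap.flip_apply, Finsupp.lsingle_apply, TensorProduct.mk_apply]
      rw [e1 _ _ h.le, e2 _ _ h.le, dd_p _ _ _ h h', map_sum]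
      have key : ∀ n, s + n ≤ t → ∑ l ∈ Finset.Ico s (s + n), K.dK (sn (D.kp l, D.kp l + 1) (D.p s l ⊗ₜ D.p (l + 1) t)) =
          sn ((s + n) % P, (s + n) % P) (D.p s (s + n) ⊗ₜ D.p (s + n) t) + sn (s % P, s % P) (K.e s ⊗ₜ D.p s t) := by
        intro n
        induction n with
        | zero => intro _; simp [D.F0, c2]
        | succ n ih =>
          intro hn
          have hN : s + n < N := by omega
          have hm := D.kmod _ hN
          rw [← add_assoc, Finset.sum_Ico_succ_top (by omega), ih (by omega), dK_s, if_pos (by omega), Nat.add_sub_cancel,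
            cl_self, cl_self, hm, D.F4 _ _ hN (by omega)]
          have e3 : A.mul (D.p s (s + n)) (K.x (D.kp (s + n))) = D.p s (s + n + 1) := by
            rcases Nat.eq_zero_or_pos n with rfl | hn0
            · simp only [add_zero] at hN ⊢
              rw [D.F0, D.ex _ _ (D.kN _ hN), D.kmod _ hN, if_pos rfl, D.F3' _ (D.kN _ hN), D.kk _ hN]
            · rw [D.F3 _ _ _ (by omega) (D.kN _ hN), D.kk _ hN, if_pos rfl]
          have e4 : (D.kp (s + n) + 1) % P = (s + n + 1) % P := by rw [Nat.add_mod, hm, ← Nat.add_mod]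
          rw [e3, e4]
          apply c2eq; abel_nf; simp [c2z, c2n]
      have := key (t - s) (by omega)
      rw [Nat.add_sub_cancel' h.le] at this
      rw [this, D.F0]
    · intro v
      simp only [LinearMap.add_apply, LinearMap.sum_apply, LinearMap.comp_apply, LinearMap.flip_apply, Finsupp.lsingle_apply, TensorProduct.mk_apply]
      rw [dd_e, ← D.F0, e1 _ _ le_rfl, e2 _ _ le_rfl, D.F0, c2, map_zero]
  have := LinearMap.congr_fun this a
  simp only [LinearMap.add_apply, LinearMap.sum_apply, LinearMap.comp_apply, LinearMap.flip_apply, Finsupp.lsingle_apply, TensorProduct.mk_apply] at this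
  exact this

/-- contracting homotopy -/
def sK : Kh A →ₗ[ZMod 2] Kh A :=
  Finsupp.lsum (ZMod 2) (fun w => if w.1 < w.2 then
      (if 1 ≤ w.1 then Finsupp.lsingle (w.1 - 1, w.2) ∘ₗ TensorProduct.map (D.dl (w.1 - 1)) LinearMap.id else 0)
    else TensorProduct.lift (RK ∘ₗ D.dd))

theorem sK_s (i j a b) : D.sK (sn (i, j) (a ⊗ₜ b)) = if i < j then
    (if 1 ≤ i then sn (i - 1, j) (D.dl (i - 1) a ⊗ₜ b) else 0) else RK (D.dd a) b := by
  simp only [sK, Finsupp.lsum_single]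
  split_ifs <;> simp

theorem RK_mul (K : KD A P N) (κ : Kh A) (a b) : RK (RK κ a) b = RK κ (A.mul a b) := K.UK.R_mul κ a b
theorem RK_d (κ : Kh A) (a) : K.dK (RK κ a) = RK (K.dK κ) a := K.UK.dR κ a

theorem htpy (i j a b) (hv : valid P N (i, j)) (ha : A.mul a (K.e i) = a) (hb : A.mul (K.e j) b = b) :
    K.dK (D.sK (sn (i, j) (a ⊗ₜ b))) + D.sK (K.dK (sn (i, j) (a ⊗ₜ b))) =
      sn (i, j) (a ⊗ₜ b) + K.s0 (K.ep (sn (i, j) (a ⊗ₜ b))) := by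
  by_cases h : i < j
  · have hj : j ≤ N := by rcases hv with ⟨_, h⟩ | ⟨h', _⟩ <;> simp at * <;> omega
    have hi : i < N := by omega
    rw [sK_s, if_pos h, dK_s, if_pos h, ep_s, if_neg h.ne, map_zero, add_zero, map_add]
    by_cases h2 : i + 1 = j
    · subst h2
      have h3 := congrArg (fun κ => RK κ b) (D.dd_x i hi a)
      simp only [map_add, LinearMap.add_apply, RK_mul K] at h3
      have e0 : (RK (if 1 ≤ i then sn (i, i + 1) (A.mul (D.dl (i - 1) a) (K.x (i - 1)) ⊗ₜ K.e (i + 1)) +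
        sn (i - 1, i) (D.dl (i - 1) a ⊗ₜ K.x i) else 0)) b = if 1 ≤ i then
        sn (i, i + 1) (A.mul (D.dl (i - 1) a) (K.x (i - 1)) ⊗ₜ A.mul (K.e (i + 1)) b) +
        sn (i - 1, i) (D.dl (i - 1) a ⊗ₜ A.mul (K.x i) b) else 0 := by
        split_ifs
        · simp [RK_s]
        · simp
      rw [e0, ha, hb, RK_s, hb] at h3
      rw [Nat.add_sub_cancel, cl_self, cl_self, sK_s, if_neg (lt_irrefl _), sK_s, if_neg (lt_irrefl _), h3]
      split_ifs with h1
      · rw [dK_s, if_pos (by omega), Nat.add_sub_cancel, Nat.sub_add_cancel h1, cl_ne (by omega), cl_ne (by omega)]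
        apply c2eq; abel_nf; simp [c2z, c2n]
      · simp
    · rw [cl_ne h2, cl_ne (by omega), sK_s, sK_s, if_pos (show i + 1 < j by omega), if_pos (show 1 ≤ i + 1 by omega),
        if_pos (show i < j - 1 by omega), Nat.add_sub_cancel, D.dl_x i hi, ha]
      split_ifs with h1
      · rw [dK_s, if_pos (by omega), Nat.sub_add_cancel h1, cl_ne (by omega), cl_ne (by omega), add_tmul, Finsupp.single_add]
        apply c2eq; abel_nf; simp [c2z, c2n]
      · simp
  · have hv' : i = j ∧ i < P := by rcases hv with ⟨h', _⟩ | h'; exact absurd h' h; exact h'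
    obtain ⟨rfl, hP⟩ := hv'
    rw [sK_s, if_neg h, dK_s, if_neg h, ep_s, if_pos rfl, map_zero, add_zero, RK_d, d_dd, ha, map_add, LinearMap.add_apply]
    congr 1
    · rw [map_sum, LinearMap.sum_apply, Finset.sum_eq_single i]
      · rw [RK_s, ha, hb]
      · intro v hv hv'
        rw [Finset.mem_range] at hv
        rw [← ha, A.mul_assoc', D.ee, if_neg (by rw [Nat.mod_eq_of_lt hv, Nat.mod_eq_of_lt hP]; exact hv'.symm)]
        simp
      · intro h; exact absurd (Finset.mem_range.2 hP) h
    · rw [s0_apply, s0_apply, map_sum, LinearMap.sum_apply]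
      simp only [RK_s, A.mul_assoc']

theorem htpy' (κ) : K.dK (D.sK (K.piK κ)) + D.sK (K.dK (K.piK κ)) = K.piK κ + K.s0 (K.ep (K.piK κ)) := by
  have : K.dK ∘ₗ D.sK ∘ₗ K.piK + D.sK ∘ₗ K.dK ∘ₗ K.piK = K.piK + K.s0 ∘ₗ K.ep ∘ₗ K.piK := by
    apply Khext; intro i j a b
    simp only [LinearMap.add_apply, LinearMap.comp_apply, piK_s]
    split_ifs with h
    · apply D.htpy _ _ _ _ h
      · rw [A.mul_assoc', K.ee]
      · rw [← A.mul_assoc', K.ee]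
    · simp
  exact LinearMap.congr_fun this κ

theorem acyc (D : PD K) : K.Acyc := by
  intro κ h1 h2 h3
  have := D.htpy' κ
  rw [h1, h2, h3, map_zero, map_zero, add_zero, add_zero] at this
  refine ⟨K.piK (D.sK κ), K.piK_pi _, ?_⟩
  rw [← piK_d, this, h1]
end PD
end KD


/-- abstract quiver data -/
structure QP (Q : Type) [Ring Q] (P : ℕ) where
  e : ℕ → Q
  y : ℕ → Q
  per : ∀ v, e (v % P) = e v
  ee : ∀ v w, e v * e w = if v % P = w % P then e v else 0
  ey : ∀ n, e n * y n = y n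
  ye : ∀ n, y n * e (n + 1) = y n
  yy : ∀ n m, m ≠ n + 1 → y n * y m = 0

namespace QP
variable {Q : Type} [Ring Q] {P : ℕ} (G : QP Q P)

theorem e_eq {v w : ℕ} (h : v % P = w % P) : G.e v = G.e w := by rw [← G.per v, h, G.per]

theorem ey' (v n) : G.e v * G.y n = if n % P = v % P then G.y n else 0 := by
  rw [← G.ey n, ← mul_assoc, G.ee]
  by_cases h : n % P = v % P
  · rw [if_pos h, if_pos h.symm, G.e_eq h]
  · rw [if_neg h, if_neg (fun h' => h h'.symm), zero_mul]

theorem ye' (v n) : G.y n * G.e v = if (n + 1) % P = v % P then G.y n else 0 := by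
  rw [← G.ye n, mul_assoc, G.ee]
  split_ifs <;> simp

/-- paths of length n starting at arrow s -/
def pp : ℕ → ℕ → Q
  | 0, s => G.e s
  | n + 1, s => G.y s * pp n (s + 1)

theorem e_pp (n s v) : G.e v * G.pp n s = if s % P = v % P then G.pp n s else 0 := by
  cases n with
  | zero =>
    rw [pp, G.ee]
    by_cases h : s % P = v % P
    · rw [if_pos h, if_pos h.symm, G.e_eq h]
    · rw [if_neg h, if_neg (fun h' => h h'.symm)]
  | succ n =>
    rw [pp, ← mul_assoc, ey']
    split_ifs <;> simp

theorem pp_e (n s v) : G.pp n s * G.e v = if (s + n) % P = v % P then G.pp n s else 0 := by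
  induction n generalizing s with
  | zero => rw [pp, G.ee]; rfl
  | succ n ih =>
    rw [pp, mul_assoc, ih, add_right_comm, add_assoc]
    split_ifs <;> simp

theorem pp1 (s) : G.pp 1 s = G.y s := by rw [pp, pp, G.ye]

theorem y_pp (n s m) (h : 1 ≤ n) : G.y m * G.pp n s = if s = m + 1 then G.pp (n + 1) m else 0 := by
  obtain ⟨n, rfl⟩ : ∃ l, n = l + 1 := ⟨n - 1, by omega⟩
  split_ifs with h1
  · subst h1; rfl
  · rw [pp, ← mul_assoc, G.yy _ _ h1, zero_mul]

theorem pp_y (n s m) (h : 1 ≤ n) : G.pp n s * G.y m = if s + n = m then G.pp (n + 1) s else 0 := by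
  induction n generalizing s with
  | zero => omega
  | succ n ih =>
    rcases Nat.eq_zero_or_pos n with rfl | hn
    · rw [pp1]
      split_ifs with h1
      · subst h1
        rw [pp, pp1]
      · exact G.yy _ _ (fun h => h1 h.symm)
    · rw [pp, mul_assoc, ih _ hn, add_right_comm, add_assoc]
      split_ifs <;> simp [pp]

/-- paths -/
def p (s t : ℕ) : Q := G.pp (t - s) s

end QP

/-- arrow n as generator -/
def gy (k n : ℕ) (h : n + 1 < 4 * k) : QGen k :=
  if h1 : n < 2 * k - 1 then QGen.a ⟨n, h1⟩ else if h2 : n = 2 * k - 1 then QGen.c else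
    QGen.b ⟨n - 2 * k, by omega⟩

def qy (k : ℕ) (hk : 1 ≤ k) (n : ℕ) : QAlg k hk := if h : n + 1 < 4 * k then qgen (gy k n h) else 0

def qe (k : ℕ) (hk : 1 ≤ k) (v : ℕ) : QAlg k hk := qgen (QGen.e ⟨v % (2 * k), Nat.mod_lt _ (by omega)⟩)

section qalg
variable {k : ℕ} {hk : 1 ≤ k}

theorem qrel {x y : FreeAlgebra (ZMod 2) (QGen k)} (h : QRel k hk x y) :
    RingQuot.mkAlgHom (ZMod 2) (QRel k hk) x = RingQuot.mkAlgHom (ZMod 2) (QRel k hk) y :=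
  RingQuot.mkAlgHom_rel _ h

theorem qe_eq (v w : ℕ) (h : w < 2 * k) (h' : v % (2 * k) = w) : qe k hk v = qgen (QGen.e ⟨w, h⟩) := by
  subst h'; rfl

theorem gy_path (n : ℕ) (h : n + 1 < 4 * k) : (qgen (gy k n h) : QAlg k hk) = qe k hk n * qgen (gy k n h) * qe k hk (n + 1) := by
  unfold gy
  split_ifs with h1 h2
  · have := qrel (QRel.aPath (hk := hk) ⟨n, h1⟩)
    rw [map_mul, map_mul] at this
    rw [qe_eq n n (by omega) (Nat.mod_eq_of_lt (by omega)), qe_eq (n + 1) (n + 1) (by omega) (Nat.mod_eq_of_lt (by omega))]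
    exact this
  · have := qrel (QRel.cPath (k := k) (hk := hk))
    rw [map_mul, map_mul] at this
    rw [qe_eq n (2 * k - 1) (by omega) (by rw [h2]; exact Nat.mod_eq_of_lt (by omega)), qe_eq (n + 1) 0 (by omega) (by rw [h2, Nat.sub_add_cancel (by omega), Nat.mod_self])]
    exact this
  · have := qrel (QRel.bPath (hk := hk) ⟨n - 2 * k, by omega⟩)
    rw [map_mul, map_mul] at this
    rw [qe_eq n (n - 2 * k) (by omega) (by rw [Nat.mod_eq_sub_mod (by omega), Nat.mod_eq_of_lt (by omega)]),
      qe_eq (n + 1) (n - 2 * k + 1) (by omega) (by rw [Nat.mod_eq_sub_mod (by omega), Nat.mod_eq_of_lt (by omega)]; omega)]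
    exact this

theorem q_ee (v w) : qe k hk v * qe k hk w = if v % (2 * k) = w % (2 * k) then qe k hk v else 0 := by
  split_ifs with h
  · have := qrel (QRel.idem (hk := hk) ⟨v % (2 * k), Nat.mod_lt _ (by omega)⟩)
    rw [map_mul] at this
    rw [qe_eq w (v % (2 * k)) (Nat.mod_lt _ (by omega)) h.symm]
    exact this
  · have := qrel (QRel.orth (hk := hk) ⟨v % (2 * k), Nat.mod_lt _ (by omega)⟩ ⟨w % (2 * k), Nat.mod_lt _ (by omega)⟩
      (by simpa using h))
    rw [map_mul, map_zero] at this
    exact this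

theorem q_ey (n) : qe k hk n * qy k hk n = qy k hk n := by
  unfold qy
  split_ifs with h
  · rw [gy_path, ← mul_assoc, ← mul_assoc, q_ee, if_pos rfl]
  · simp

theorem q_ye (n) : qy k hk n * qe k hk (n + 1) = qy k hk n := by
  unfold qy
  split_ifs with h
  · rw [gy_path, mul_assoc, q_ee, if_pos rfl]
  · simp

theorem q_yy (n m) (hm : m ≠ n + 1) : qy k hk n * qy k hk m = 0 := by
  by_cases h0 : (n + 1) % (2 * k) = m % (2 * k)
  swap
  · rw [← q_ye n, ← q_ey m, mul_assoc, ← mul_assoc (qe k hk (n + 1)), q_ee, if_neg h0]; simp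
  unfold qy
  split_ifs with h1 h2
  · have hl : n + 1 < 2 * k ∧ m = n + 1 + 2 * k ∨ 2 * k ≤ n + 1 ∧ m = n + 1 - 2 * k := by
      rcases lt_or_ge (n + 1) (2 * k) with h3 | h3
      · rw [Nat.mod_eq_of_lt h3] at h0
        rcases lt_or_ge m (2 * k) with h4 | h4
        · rw [Nat.mod_eq_of_lt h4] at h0; omega
        · rw [Nat.mod_eq_sub_mod h4, Nat.mod_eq_of_lt (by omega)] at h0; omega
      · rw [Nat.mod_eq_sub_mod h3, Nat.mod_eq_of_lt (by omega)] at h0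
        rcases lt_or_ge m (2 * k) with h4 | h4
        · rw [Nat.mod_eq_of_lt h4] at h0; omega
        · rw [Nat.mod_eq_sub_mod h4, Nat.mod_eq_of_lt (by omega)] at h0; omega
    rcases hl with ⟨h3, rfl⟩ | ⟨h3, rfl⟩
    · unfold gy
      rw [dif_pos (by omega), dif_neg (by omega), dif_neg (by omega)]
      have := qrel (QRel.ab (hk := hk) ⟨n, by omega⟩)
      rw [map_mul, map_zero] at this
      simp only [Nat.add_sub_cancel]
      exact this
    · rcases Nat.eq_or_lt_of_le h3 with h4 | h4
      · unfold gy
        rw [dif_neg (by omega), dif_pos (by omega), dif_pos (by omega)]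
        have := qrel (QRel.ca (k := k) (hk := hk))
        rw [map_mul, map_zero] at this
        simp only [← h4, Nat.sub_self]
        exact this
      · unfold gy
        rw [dif_neg (by omega), dif_neg (by omega)]
        by_cases h5 : n + 1 - 2 * k < 2 * k - 1
        · rw [dif_pos h5]
          have := qrel (QRel.ba (hk := hk) ⟨n - 2 * k, by omega⟩)
          rw [map_mul, map_zero] at this
          simp only [show n + 1 - 2 * k = n - 2 * k + 1 by omega]
          exact this
        · rw [dif_neg h5, dif_pos (by omega)]
          have := qrel (QRel.bc (k := k) (hk := hk))
          rw [map_mul, map_zero] at this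
          simp only [show n - 2 * k = 2 * k - 2 by omega]
          exact this
  · simp
  · simp
  · simp

def qP (k : ℕ) (hk : 1 ≤ k) : QP (QAlg k hk) (2 * k) where
  e := qe k hk
  y := qy k hk
  per := by intro v; unfold qe; simp only [Nat.mod_mod]
  ee := q_ee
  ey := q_ey
  ye := q_ye
  yy := q_yy

theorem q_sum : ∑ v ∈ Finset.range (2 * k), qe k hk v = 1 := by
  have := qrel (QRel.total (k := k) (hk := hk))
  rw [map_sum, map_one] at this
  rw [← this, ← Fin.sum_univ_eq_sum_range]
  apply Finset.sum_congr rfl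
  intro i _
  exact qe_eq _ _ i.2 (Nat.mod_eq_of_lt i.2)

/-- the space carrying the standard representation -/
abbrev WV : Type := ℕ × ℕ →₀ ZMod 2

def Ee (P v : ℕ) : WV →ₗ[ZMod 2] WV :=
  Finsupp.lsum (ZMod 2) (fun w => if w.1 % P = v % P then Finsupp.lsingle w else 0)

def Yy (P n : ℕ) : WV →ₗ[ZMod 2] WV :=
  Finsupp.lsum (ZMod 2) (fun w => if w.1 < w.2 then (if w.1 = n + 1 then Finsupp.lsingle (n, w.2) else 0) else
    if w.1 = w.2 ∧ w.1 % P = (n + 1) % P then Finsupp.lsingle (n, n + 1) else 0)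

theorem Ee_s (P v i j c) : Ee P v (Finsupp.single (i, j) c) = if i % P = v % P then Finsupp.single (i, j) c else 0 := by
  simp only [Ee, Finsupp.lsum_single]
  split_ifs <;> simp

theorem Yy_s (P n i j c) : Yy P n (Finsupp.single (i, j) c) = if i < j then (if i = n + 1 then Finsupp.single (n, j) c else 0) else
    if i = j ∧ i % P = (n + 1) % P then Finsupp.single (n, n + 1) c else 0 := by
  simp only [Yy, Finsupp.lsum_single]
  split_ifs <;> simp

theorem Wext {f g : WV →ₗ[ZMod 2] WV} (h : ∀ i j c, f (Finsupp.single (i, j) c) = g (Finsupp.single (i, j) c)) : f = g := by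
  apply Finsupp.lhom_ext
  rintro ⟨i, j⟩ c
  exact h i j c

theorem EYE (P n v w) (hv : v % P = n % P) (hw : w % P = (n + 1) % P) : Yy P n = Ee P v * Yy P n * Ee P w := by
  apply Wext; intro i j c
  simp only [Module.End.mul_apply, Ee_s, hw]
  by_cases h : i % P = (n + 1) % P
  · rw [if_pos h, Yy_s]
    split_ifs <;> simp [Ee_s, hv]
  · rw [if_neg h, Yy_s, map_zero, map_zero]
    split_ifs with h1 h2 h3
    · subst h2; exact absurd rfl h
    · rfl
    · exact absurd h3.2 h
    · rfl

theorem YYm (P n m) (h : m ≠ n + 1) : Yy P n * Yy P m = 0 := by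
  apply Wext; intro i j c
  simp only [Module.End.mul_apply, LinearMap.zero_apply]
  rw [Yy_s P m]
  split_ifs with h1 h2
  · rw [Yy_s, if_pos (by omega), if_neg h]
  · simp
  · rw [Yy_s, if_pos (by omega), if_neg h]
  · simp

def repG (k : ℕ) : QGen k → (WV →ₗ[ZMod 2] WV)
  | QGen.e i => Ee (2 * k) i
  | QGen.a i => Yy (2 * k) i
  | QGen.b i => Yy (2 * k) (2 * k + i)
  | QGen.c => Yy (2 * k) (2 * k - 1)

theorem rep_rel {x y : FreeAlgebra (ZMod 2) (QGen k)} (h : QRel k hk x y) :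
    FreeAlgebra.lift (ZMod 2) (repG k) x = FreeAlgebra.lift (ZMod 2) (repG k) y := by
  cases h with
  | idem i =>
    simp only [map_mul, FreeAlgebra.lift_ι_apply, repG]
    apply Wext; intro a b c
    rw [Module.End.mul_apply, Ee_s]; split_ifs with h
    · rw [Ee_s, if_pos h]
    · simp
  | orth i j h =>
    simp only [map_mul, FreeAlgebra.lift_ι_apply, repG, map_zero]
    apply Wext; intro a b c
    rw [Module.End.mul_apply, Ee_s]; split_ifs with h1
    · rw [Ee_s, if_neg]; rfl
      intro h2
      rw [h1, Nat.mod_eq_of_lt i.2, Nat.mod_eq_of_lt j.2] at h2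
      exact h (Fin.ext h2.symm)
    · simp
  | total =>
    simp only [map_sum, FreeAlgebra.lift_ι_apply, repG, map_one]
    apply Wext; intro a b c
    rw [Fin.sum_univ_eq_sum_range (fun i => Ee (2 * k) i), LinearMap.sum_apply, Finset.sum_eq_single (a % (2 * k))]
    · rw [Ee_s, if_pos (by simp)]; rfl
    · intro v hv hv'
      rw [Finset.mem_range] at hv
      rw [Ee_s, if_neg (by rw [Nat.mod_eq_of_lt hv]; exact hv'.symm)]
    · intro h; exact absurd (Finset.mem_range.2 (Nat.mod_lt _ (by omega))) h
  | aPath i =>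
    simp only [map_mul, FreeAlgebra.lift_ι_apply, repG]
    exact EYE _ _ _ _ rfl rfl
  | bPath i =>
    simp only [map_mul, FreeAlgebra.lift_ι_apply, repG]
    exact EYE _ _ _ _ (by simp) (by simp [add_assoc])
  | cPath =>
    simp only [map_mul, FreeAlgebra.lift_ι_apply, repG]
    exact EYE _ _ _ _ rfl (by rw [Nat.sub_add_cancel (by omega)]; simp)
  | ab i =>
    simp only [map_mul, FreeAlgebra.lift_ι_apply, repG, map_zero]
    exact YYm _ _ _ (by simp; omega)
  | ba i =>
    simp only [map_mul, FreeAlgebra.lift_ι_apply, repG, map_zero]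
    exact YYm _ _ _ (by simp; omega)
  | bc =>
    simp only [map_mul, FreeAlgebra.lift_ι_apply, repG, map_zero]
    exact YYm _ _ _ (by simp; omega)
  | ca =>
    simp only [map_mul, FreeAlgebra.lift_ι_apply, repG, map_zero]
    exact YYm _ _ _ (by simp)

def rep (k : ℕ) (hk : 1 ≤ k) : QAlg k hk →ₐ[ZMod 2] Module.End (ZMod 2) WV :=
  RingQuot.liftAlgHom (ZMod 2) ⟨FreeAlgebra.lift (ZMod 2) (repG k), fun _ _ h => rep_rel h⟩

theorem rep_gen (g : QGen k) : rep k hk (qgen g) = repG k g := by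
  rw [rep, qgen, RingQuot.liftAlgHom_mkAlgHom_apply, FreeAlgebra.lift_ι_apply]

theorem rep_e (v) : rep k hk (qe k hk v) = Ee (2 * k) v := by
  rw [qe, rep_gen, repG]
  apply Wext; intro i j c; rw [Ee_s, Ee_s, Nat.mod_mod]

theorem rep_y (n) (h : n + 1 < 4 * k) : rep k hk (qy k hk n) = Yy (2 * k) n := by
  rw [qy, dif_pos h, rep_gen, gy]
  split_ifs with h1 h2
  · rfl
  · rw [h2]; rfl
  · simp only [repG]
    rw [Nat.add_sub_cancel' (by omega)]

def vac (P : ℕ) : WV := ∑ v ∈ Finset.range P, Finsupp.single (v, v) 1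

def Phi (k : ℕ) (hk : 1 ≤ k) : QAlg k hk →ₗ[ZMod 2] WV :=
  (LinearMap.applyₗ (vac (2 * k))) ∘ₗ (rep k hk).toLinearMap

theorem Phi_apply (x) : Phi k hk x = rep k hk x (vac (2 * k)) := rfl

theorem Phi_pp (n s : ℕ) (h : s + n < 4 * k) : Phi k hk ((qP k hk).pp n s) =
    if n = 0 then Finsupp.single (s % (2 * k), s % (2 * k)) 1 else Finsupp.single (s, s + n) 1 := by
  rw [Phi_apply]
  induction n generalizing s with
  | zero =>
    rw [if_pos rfl, QP.pp]
    simp only [qP, rep_e, vac, map_sum, Ee_s]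
    rw [Finset.sum_eq_single (s % (2 * k))]
    · simp
    · intro v hv hv'
      rw [Finset.mem_range] at hv
      rw [if_neg]; rw [Nat.mod_eq_of_lt hv]; exact hv'
    · intro h; exact absurd (Finset.mem_range.2 (Nat.mod_lt _ (by omega))) h
  | succ n ih =>
    rw [if_neg (by omega), QP.pp, map_mul, Module.End.mul_apply, ih (s + 1) (by omega)]
    change rep k hk (qy k hk s) _ = _
    rw [rep_y s (by omega)]
    split_ifs with h1
    · subst h1
      rw [Yy_s, if_neg (lt_irrefl _), if_pos ⟨rfl, by simp⟩]
    · rw [Yy_s, if_pos (by omega), if_pos rfl, add_right_comm, add_assoc]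

theorem p_li : LinearIndependent (ZMod 2) (fun w : {w : ℕ × ℕ // MD.valid (2 * k) (4 * k - 1) w} => (qP k hk).p w.1.1 w.1.2) := by
  apply LinearIndependent.of_comp (Phi k hk)
  have : (Phi k hk) ∘ (fun w : {w : ℕ × ℕ // MD.valid (2 * k) (4 * k - 1) w} => (qP k hk).p w.1.1 w.1.2) =
      (Finsupp.basisSingleOne (R := ZMod 2) (ι := ℕ × ℕ)) ∘ Subtype.val := by
    funext ⟨⟨s, t⟩, h⟩
    simp only [Function.comp_apply, QP.p, Finsupp.coe_basisSingleOne]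
    rcases h with ⟨h1, h2⟩ | ⟨h1, h2⟩
    · simp only at h1 h2
      rw [Phi_pp _ _ (by omega), if_neg (by omega), Nat.add_sub_cancel' h1.le]
    · simp only at h1 h2
      rw [Phi_pp _ _ (by omega), if_pos (by omega), Nat.mod_eq_of_lt h2, h1]
  rw [this]
  exact (Finsupp.basisSingleOne (R := ZMod 2) (ι := ℕ × ℕ)).linearIndependent.comp _ Subtype.val_injective

/-- span of the paths -/
def SP (k : ℕ) (hk : 1 ≤ k) : Submodule (ZMod 2) (QAlg k hk) :=
  Submodule.span (ZMod 2) (Set.range (fun w : {w : ℕ × ℕ // MD.valid (2 * k) (4 * k - 1) w} => (qP k hk).p w.1.1 w.1.2))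

theorem pp_mem (n s : ℕ) (h : s + n < 4 * k) : (qP k hk).pp n s ∈ SP k hk := by
  rcases Nat.eq_zero_or_pos n with rfl | hn
  · have : (qP k hk).pp 0 s = (qP k hk).p (s % (2 * k)) (s % (2 * k)) := by
      rw [QP.p, Nat.sub_self, QP.pp, QP.pp, QP.per]
    rw [this]
    exact Submodule.subset_span ⟨⟨(s % (2 * k), s % (2 * k)), Or.inr ⟨rfl, Nat.mod_lt _ (by omega)⟩⟩, rfl⟩
  · have : (qP k hk).pp n s = (qP k hk).p s (s + n) := by rw [QP.p, Nat.add_sub_cancel_left]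
    rw [this]
    exact Submodule.subset_span ⟨⟨(s, s + n), Or.inl ⟨by simp only; omega, by simp only; omega⟩⟩, rfl⟩

theorem SP_e (v) (z) (hz : z ∈ SP k hk) : qe k hk v * z ∈ SP k hk := by
  induction hz using Submodule.span_induction with
  | mem x hx =>
    obtain ⟨⟨⟨s, t⟩, h⟩, rfl⟩ := hx
    have h' : s + (t - s) < 4 * k := by
      rcases h with ⟨h1, h2⟩ | ⟨h1, h2⟩ <;> simp only at h1 h2 <;> omega
    have := (qP k hk).e_pp (t - s) s v
    change qe k hk v * _ = _ at this
    simp only [QP.p]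
    rw [this]
    split_ifs
    · exact pp_mem _ _ h'
    · exact zero_mem _
  | zero => rw [mul_zero]; exact zero_mem _
  | add x y _ _ h1 h2 => rw [mul_add]; exact add_mem h1 h2
  | smul c x _ h1 => rw [mul_smul_comm]; exact Submodule.smul_mem _ _ h1

theorem SP_y (m) (z) (hz : z ∈ SP k hk) : qy k hk m * z ∈ SP k hk := by
  by_cases hm : m + 1 < 4 * k
  swap
  · rw [qy, dif_neg hm, zero_mul]; exact zero_mem _
  induction hz using Submodule.span_induction with
  | mem x hx =>
    obtain ⟨⟨⟨s, t⟩, h⟩, rfl⟩ := hx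
    have h' : s + (t - s) < 4 * k := by
      rcases h with ⟨h1, h2⟩ | ⟨h1, h2⟩ <;> simp only at h1 h2 <;> omega
    simp only [QP.p]
    change (qP k hk).y m * _ ∈ _
    rcases Nat.eq_zero_or_pos (t - s) with h0 | h0
    · rw [h0, QP.pp, QP.ye']
      split_ifs
      · rw [← QP.pp1]; exact pp_mem _ _ hm
      · exact zero_mem _
    · rw [QP.y_pp _ _ _ _ h0]
      split_ifs
      · exact pp_mem _ _ (by omega)
      · exact zero_mem _
  | zero => rw [mul_zero]; exact zero_mem _
  | add x y _ _ h1 h2 => rw [mul_add]; exact add_mem h1 h2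
  | smul c x _ h1 => rw [mul_smul_comm]; exact Submodule.smul_mem _ _ h1

theorem SP_g (g : QGen k) (z) (hz : z ∈ SP k hk) : qgen g * z ∈ SP k hk := by
  cases g with
  | e i =>
    have := SP_e (hk := hk) i z hz
    rwa [qe_eq i i i.2 (Nat.mod_eq_of_lt i.2)] at this
  | a i =>
    have := SP_y (hk := hk) i z hz
    rwa [qy, dif_pos (by omega), gy, dif_pos i.2] at this
  | b i =>
    have := SP_y (hk := hk) (2 * k + i) z hz
    rw [qy, dif_pos (by omega), gy, dif_neg (by omega), dif_neg (by omega)] at this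
    simpa only [Nat.add_sub_cancel_left] using this
  | c =>
    have := SP_y (hk := hk) (2 * k - 1) z hz
    rwa [qy, dif_pos (by omega), gy, dif_neg (by omega), dif_pos rfl] at this

theorem SP_all (x : FreeAlgebra (ZMod 2) (QGen k)) (z) (hz : z ∈ SP k hk) :
    RingQuot.mkAlgHom (ZMod 2) (QRel k hk) x * z ∈ SP k hk := by
  induction x using FreeAlgebra.induction generalizing z with
  | grade0 r => rw [AlgHom.commutes, ← Algebra.smul_def]; exact Submodule.smul_mem _ _ hz
  | grade1 g => exact SP_g g z hz
  | mul a b ha hb => rw [map_mul, mul_assoc]; exact ha _ (hb _ hz)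
  | add a b ha hb => rw [map_add, add_mul]; exact add_mem (ha _ hz) (hb _ hz)

theorem SP_top : SP k hk = ⊤ := by
  rw [eq_top_iff]
  rintro x -
  obtain ⟨x, rfl⟩ := RingQuot.mkAlgHom_surjective (ZMod 2) (QRel k hk) x
  rw [← mul_one (RingQuot.mkAlgHom (ZMod 2) (QRel k hk) x)]
  apply SP_all
  rw [← q_sum]
  apply sum_mem
  intro v hv
  rw [Finset.mem_range] at hv
  exact pp_mem 0 v (by omega)

def pB (k : ℕ) (hk : 1 ≤ k) : Module.Basis {w : ℕ × ℕ // MD.valid (2 * k) (4 * k - 1) w} (ZMod 2) (QAlg k hk) :=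
  Module.Basis.mk p_li (SP_top (k := k) (hk := hk)).ge

/-- Koszul reordering of the arrows -/
def kap (k i : ℕ) : ℕ := if i % 2 = 1 then i else if i < 2 * k then i + 2 * k else i - 2 * k

theorem mod2k (i : ℕ) (h : i < 4 * k) : i % (2 * k) = if i < 2 * k then i else i - 2 * k := by
  split_ifs with h1
  · exact Nat.mod_eq_of_lt h1
  · rw [Nat.mod_eq_sub_mod (by omega), Nat.mod_eq_of_lt (by omega)]

end qalg

section final
variable {k : ℕ} {A : DGA (ZMod 2)}

theorem smul {hk : 1 ≤ k} (φ : A.V ≃ₗ[ZMod 2] QAlg k hk) (hmul : ∀ x y, φ (A.mul x y) = φ x * φ y) (x y) : A.mul (φ.symm x) (φ.symm y) = φ.symm (x * y) := by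
  apply φ.injective; rw [hmul]; simp

def theK (hk : 1 ≤ k) (φ : A.V ≃ₗ[ZMod 2] QAlg k hk)
    (hmul : ∀ x y, φ (A.mul x y) = φ x * φ y) (hone : φ A.one = 1) : KD A (2 * k) (4 * k - 1) where
  e := fun i => φ.symm ((qP k hk).e i)
  x := fun i => if i < 4 * k - 1 then φ.symm ((qP k hk).y (kap k i)) else 0
  hP := by omega
  hN := by omega
  per := fun i => by rw [QP.per]
  ee := fun i => by rw [smul φ hmul, QP.ee, if_pos rfl]
  sum := by
    apply φ.injective
    rw [map_sum, hone, ← q_sum]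
    apply Finset.sum_congr rfl
    intro v _; simp [qP]
  ex := fun i => by
    split_ifs with h
    · rw [smul φ hmul, QP.ey', if_pos]
      rw [mod2k _ (by unfold kap; split_ifs <;> omega), mod2k _ (by omega)]
      unfold kap; split_ifs <;> omega
    · simp
  xe := fun i => by
    split_ifs with h
    · rw [smul φ hmul, QP.ye', if_pos]
      rw [Nat.add_mod, Nat.add_mod i]
      congr 2
      rw [mod2k _ (by unfold kap; split_ifs <;> omega), mod2k _ (by omega)]
      unfold kap; split_ifs <;> omega
    · simp
  xx := fun i => by
    split_ifs with h h'
    · rw [smul φ hmul, QP.yy, map_zero]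
      unfold kap; split_ifs <;> omega
    · simp
    · simp
    · simp
  x0 := fun i h => if_neg (by omega)

theorem theK_x (hk : 1 ≤ k) (φ : A.V ≃ₗ[ZMod 2] QAlg k hk)
    (hmul : ∀ x y, φ (A.mul x y) = φ x * φ y) (hone : φ A.one = 1) (i) (h : i < 4 * k - 1) :
    (theK hk φ hmul hone).x i = φ.symm ((qP k hk).y (kap k i)) := if_pos h

theorem kap_lt (i : ℕ) (h : i < 4 * k - 1) : kap k i < 4 * k - 1 := by
  unfold kap; split_ifs <;> omega

theorem kap_kap (i : ℕ) (h : i < 4 * k - 1) : kap k (kap k i) = i := by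
  unfold kap; split_ifs <;> omega

theorem kap_mod (i : ℕ) (h : i < 4 * k - 1) : kap k i % (2 * k) = i % (2 * k) := by
  rw [mod2k _ (by have := kap_lt i h; omega), mod2k _ (by omega)]
  unfold kap; split_ifs <;> omega

def theD (hk : 1 ≤ k) (φ : A.V ≃ₗ[ZMod 2] QAlg k hk)
    (hmul : ∀ x y, φ (A.mul x y) = φ x * φ y) (hone : φ A.one = 1) : (theK hk φ hmul hone).PD where
  p := fun s t => φ.symm ((qP k hk).p s t)
  kp := kap k
  B := (pB k hk).map φ.symm
  Bp := fun w => (Module.Basis.map_apply _ _ _).trans <| congrArg φ.symm (by rw [pB]; exact Module.Basis.mk_apply _ _ w)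
  kN := kap_lt
  kk := kap_kap
  kmod := kap_mod
  k1 := fun i t h1 h2 h3 h4 h5 => by
    rw [mod2k _ (by omega), mod2k _ (by omega)] at h4
    unfold kap at h5 ⊢
    split_ifs at h4 h5 ⊢ <;> omega
  k2 := fun i h => by
    unfold kap; split_ifs <;> omega
  F0 := fun s => by rw [QP.p, Nat.sub_self]; rfl
  F1 := fun s t i h => by
    change A.mul (φ.symm _) (φ.symm _) = _
    rw [smul φ hmul, QP.p, QP.pp_e, Nat.add_sub_cancel' h]
    split_ifs <;> simp
  F2 := fun s t i h => by
    change A.mul (φ.symm _) (φ.symm _) = _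
    rw [smul φ hmul, QP.p, QP.e_pp]
    split_ifs <;> simp
  F3 := fun s t i h h' => by
    rw [theK_x _ _ _ _ _ h', smul φ hmul, QP.p, QP.pp_y _ _ _ _ (by omega), Nat.add_sub_cancel' h.le]
    split_ifs
    · rw [QP.p, Nat.succ_sub h.le]
    · simp
  F3' := fun i h => by
    rw [theK_x _ _ _ _ _ h, QP.p, Nat.add_sub_cancel_left, QP.pp1]
  F4 := fun l t h h' => by
    rw [theK_x _ _ _ _ _ (kap_lt l h), kap_kap l h, smul φ hmul, QP.p, QP.p, show t - l = (t - (l + 1)) + 1 by omega]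
    rfl
end final

/-- **Theorem 3.17 (π-formality of the extremal bordered algebras).** For `k ≥ 1`, let `A` be
the `𝔽₂` path algebra (with zero differential, graded by path length) of the quiver with
vertices `ι_1, …, ι_{2k}`, arrows `a_i, b_i : ι_i → ι_{i+1}` and `c : ι_{2k} → ι_1`, modulo
`a_i b_{i+1} = b_i a_{i+1} = b_{2k-1} c = c a_1 = 0` — the bordered Floer algebra
`𝒜(𝒵, -k+1)` of the genus-`k` antipodal pointed matched circle. Then `A` is `π`-formal:
every dg `(A,A)`-bimodule is `π`-formal. -/
theorem antipodal_extremal_algebra_pi_formal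
    (k : ℕ) (hk : 1 ≤ k)
    (A : DGA (ZMod 2)) (hd : A.d = 0)
    (φ : A.V ≃ₗ[ZMod 2] QAlg k hk)
    (hmul : ∀ x y, φ (A.mul x y) = φ x * φ y)
    (hone : φ A.one = 1)
    (hgr : ∀ m : ℕ, Submodule.map (φ : A.V →ₗ[ZMod 2] QAlg k hk) (A.gr (m : ℤ)) =
      lengthSpan k hk m)
    (hgrneg : ∀ i : ℤ, i < 0 → A.gr i = ⊥) :
    ∀ (R : DGBimod A) (ρ : R.V →ₗ[ZMod 2] A.diag.V), IsResolution R A.diag ρ →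
      ∀ M : DGBimod A, PiFormalBimod R M := by
  intro R ρ h M
  exact KD.piFormal (theK hk φ hmul hone) hd (theD hk φ hmul hone).acyc h M
end LT
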